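/- Fix γ > −1. A function ψ ∈ μ^{2γ+1} C^∞_{α,+,+}(∂₊S𝔻) belongs to the range of I₀d^γ acting on C^∞(𝔻) (i.e. ψ = I₀(d^γ f) for some f ∈ C^∞(𝔻)) if and only if ⟨ψ, ψ_{n,k}^γ⟩_{L²(∂₊S𝔻, μ^{−2γ} dβ dα)} = 0 for all n ≥ 0 and all k ∈ ℤ with k < 0 or k > n. -/

import Mathlib

open MeasureTheory Complex Metric Real Set

noncomputable section

/-! ## Geometry of the Euclidean disk and its space of lines (fan-beam coordinates) -/

/-- The chord of the closed unit disk through the boundary point `exp (I β)` with incoming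
direction `exp (I (β + π + α))`, parametrized by arclength `t ∈ [0, 2 cos α]`. -/
def chord (β α t : ℝ) : ℂ :=
  Complex.exp ((β : ℂ) * Complex.I) +
    (t : ℂ) * Complex.exp (((β + π + α : ℝ) : ℂ) * Complex.I)

/-- The X-ray transform `I₀` in fan-beam coordinates. -/
def XRT (f : ℂ → ℂ) (β α : ℝ) : ℂ :=
  ∫ t in (0:ℝ)..(2 * Real.cos α), f (chord β α t)

/-- The fan-beam coordinate `α₋(z, θ)` of the unique chord through `z` with direction `exp (I θ)`,
determined by `sin α₋ = Im (z * exp (-I θ))`. -/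
def alpham (z : ℂ) (θ : ℝ) : ℝ :=
  Real.arcsin ((z * Complex.exp (-(θ : ℂ) * Complex.I)).im)

/-- The fan-beam coordinate `β₋(z, θ)`, determined by `β₋ + α₋ + π = θ`. -/
def betam (z : ℂ) (θ : ℝ) : ℝ := θ - π - alpham z θ

/-- Reduction modulo `2π` to the fundamental interval `(0, 2π]`. -/
def wrap (x : ℝ) : ℝ := toIocMod Real.two_pi_pos 0 x

/-- The backprojection operator `I₀^♯`. -/
def BP (g : ℝ × ℝ → ℂ) (z : ℂ) : ℂ :=
  ∫ θ in (0:ℝ)..(2 * π), g (wrap (betam z θ), alpham z θ)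

/-- The weighted backprojection operator `I₀^♯ μ^{-2γ-1}`, where `μ(β, α) = cos α`. -/
def BPW (γ : ℝ) (g : ℝ × ℝ → ℂ) : ℂ → ℂ :=
  BP fun p => ((Real.cos p.2 ^ (-(2 * γ) - 1) : ℝ) : ℂ) * g p

/-- The rectangle `(0, 2π] × [-π/2, π/2]` modelling the space of lines `∂₊S𝔻`. -/
def Rect : Set (ℝ × ℝ) := Set.Ioc (0:ℝ) (2 * π) ×ˢ Set.Icc (-(π / 2)) (π / 2)

/-- The measure `μ^{-2γ} dβ dα` on `∂₊S𝔻`, where `μ(β, α) = cos α`. -/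
def bdryMeasure (γ : ℝ) : Measure (ℝ × ℝ) :=
  ((volume : Measure (ℝ × ℝ)).restrict Rect).withDensity
    fun p => ENNReal.ofReal (Real.cos p.2 ^ (-(2 * γ)))

/-- The measure `d^γ dz` on the closed unit disk, where `d(z) = 1 - |z|²`. -/
def diskMeasure (γ : ℝ) : Measure ℂ :=
  ((volume : Measure ℂ).restrict (Metric.closedBall 0 1)).withDensity
    fun z => ENNReal.ofReal ((1 - ‖z‖ ^ 2) ^ γ)

/-- `L n` is the monic orthogonal polynomial of degree `n` on `[-1, 1]` for the weight
`(1 - x²)^(γ + 1/2)`. -/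
def IsMonicOrtho (γ : ℝ) (L : ℕ → Polynomial ℝ) : Prop :=
  ∀ n, (L n).Monic ∧ (L n).natDegree = n ∧
    ∀ m, m < n →
      (∫ x in (-1:ℝ)..(1:ℝ), (L n).eval x * x ^ m * (1 - x ^ 2) ^ (γ + 1/2)) = 0

/-- The functions `ψ_{n,k}^γ = μ^{2γ+1} ((-1)^n / 2π) e^{i(n-2k)(β+α)} L_n^γ (sin α)`. -/
def psiF (γ : ℝ) (L : ℕ → Polynomial ℝ) (n : ℕ) (k : ℤ) (p : ℝ × ℝ) : ℂ :=
  ((Real.cos p.2 ^ (2 * γ + 1) : ℝ) : ℂ) * (((-1 : ℝ) ^ n / (2 * π) : ℝ) : ℂ) *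
    Complex.exp (Complex.I * ((n : ℂ) - 2 * (k : ℂ)) * ((p.1 + p.2 : ℝ) : ℂ)) *
    (((L n).eval (Real.sin p.2) : ℝ) : ℂ)

/-- The generalized Zernike polynomials
`G_{n,k}^γ (z) = (1/2π) ∫₀^{2π} e^{i(n-2k)θ} L_n^γ ((i/2)(z̄ e^{iθ} - z e^{-iθ})) dθ`. -/
def GZ (γ : ℝ) (L : ℕ → Polynomial ℝ) (n : ℕ) (k : ℤ) (z : ℂ) : ℂ :=
  ((1 / (2 * π) : ℝ) : ℂ) * ∫ θ in (0:ℝ)..(2 * π),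
    Complex.exp (Complex.I * ((n : ℂ) - 2 * (k : ℂ)) * (θ : ℂ)) *
      Polynomial.aeval
        ((Complex.I / 2) *
          ((starRingEnd ℂ) z * Complex.exp ((θ : ℂ) * Complex.I) -
            z * Complex.exp (-(θ : ℂ) * Complex.I))) (L n)

/-- `L²(𝔻, d^γ dz)`-norm. -/
def dNorm (γ : ℝ) (f : ℂ → ℂ) : ℝ := Real.sqrt (∫ z, ‖f z‖ ^ 2 ∂(diskMeasure γ))

/-- `L²(∂₊S𝔻, μ^{-2γ} dβ dα)`-norm. -/
def bNorm (γ : ℝ) (g : ℝ × ℝ → ℂ) : ℝ := Real.sqrt (∫ p, ‖g p‖ ^ 2 ∂(bdryMeasure γ))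

/-- `G_{n,k}^γ` normalized to unit norm in `L²(𝔻, d^γ dz)`. -/
def Ghat (γ : ℝ) (L : ℕ → Polynomial ℝ) (n : ℕ) (k : ℤ) (z : ℂ) : ℂ :=
  (((dNorm γ (GZ γ L n k))⁻¹ : ℝ) : ℂ) * GZ γ L n k z

/-- `ψ_{n,k}^γ` normalized to unit norm in `L²(∂₊S𝔻, μ^{-2γ} dβ dα)`. -/
def psihat (γ : ℝ) (L : ℕ → Polynomial ℝ) (n : ℕ) (k : ℤ) (p : ℝ × ℝ) : ℂ :=
  (((bNorm γ (psiF γ L n k))⁻¹ : ℝ) : ℂ) * psiF γ L n k p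

/-- The squared singular values `(σ_{n,k}^γ)²`. -/
def sigSq (γ : ℝ) (n k : ℕ) : ℝ :=
  2 ^ (2 * γ + 2) * π * (n.choose k) *
    Real.Gamma ((n : ℝ) - k + γ + 1) * Real.Gamma ((k : ℝ) + γ + 1) /
      Real.Gamma ((n : ℝ) + 2 * γ + 2)

/-- The singular values `σ_{n,k}^γ ≥ 0`. -/
def sig (γ : ℝ) (n k : ℕ) : ℝ := Real.sqrt (sigSq γ n k)

/-- The Beta function `B(x,y) = Γ(x)Γ(y)/Γ(x+y)`. -/
def betaFn (x y : ℝ) : ℝ := Real.Gamma x * Real.Gamma y / Real.Gamma (x + y)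

/-! ## Differential operators -/

/-- Radial derivative `∂_ρ` in polar coordinates `z = ρ e^{iω}`. -/
def dRho (f : ℂ → ℂ) (z : ℂ) : ℂ :=
  deriv (fun r : ℝ => f ((r : ℂ) * Complex.exp ((z.arg : ℂ) * Complex.I))) ‖z‖

/-- Angular derivative `∂_ω` in polar coordinates `z = ρ e^{iω}`. -/
def dOmega (f : ℂ → ℂ) (z : ℂ) : ℂ :=
  deriv (fun w : ℝ => f ((‖z‖ : ℂ) * Complex.exp ((w : ℂ) * Complex.I))) z.arg

/-- The operator `𝓛_γ = -(1-ρ²)∂_ρ² - (ρ⁻¹ - (3+2γ)ρ)∂_ρ - ρ⁻²∂_ω² + (γ+1)²`. -/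
def Lop (γ : ℝ) (f : ℂ → ℂ) (z : ℂ) : ℂ :=
  -(1 - (‖z‖ : ℂ) ^ 2) * dRho (dRho f) z -
    ((‖z‖ : ℂ)⁻¹ - (3 + 2 * (γ : ℂ)) * (‖z‖ : ℂ)) * dRho f z -
    ((‖z‖ : ℂ) ^ 2)⁻¹ * dOmega (dOmega f) z + ((γ : ℂ) + 1) ^ 2 * f z

/-- `∂_β` on `∂₊S𝔻`. -/
def dBeta (g : ℝ × ℝ → ℂ) (p : ℝ × ℝ) : ℂ := deriv (fun b : ℝ => g (b, p.2)) p.1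

/-- `∂_α` on `∂₊S𝔻`. -/
def dAlpha (g : ℝ × ℝ → ℂ) (p : ℝ × ℝ) : ℂ := deriv (fun a : ℝ => g (p.1, a)) p.2

/-- The operator `T = ∂_β - ∂_α`. -/
def Tline (g : ℝ × ℝ → ℂ) (p : ℝ × ℝ) : ℂ := dBeta g p - dAlpha g p

/-- The power `μ^e = (cos α)^e` as a complex-valued function on `∂₊S𝔻`. -/
def muC (e : ℝ) (p : ℝ × ℝ) : ℂ := ((Real.cos p.2 ^ e : ℝ) : ℂ)

/-- The operator `𝓣_γ = -μ^{2γ} T μ^{-2γ} T + γ²`. -/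
def Tgam (γ : ℝ) (g : ℝ × ℝ → ℂ) (p : ℝ × ℝ) : ℂ :=
  -muC (2 * γ) p * Tline (fun q => muC (-(2 * γ)) q * Tline g q) p + (γ : ℂ) ^ 2 * g p

/-! ## Scattering relations and the space `C^∞_{α,+,+}(∂₊S𝔻)` -/

/-- The scattering relation `𝒮(β, α) = (β + π + 2α, π - α)`. -/
def Scat (p : ℝ × ℝ) : ℝ × ℝ := (p.1 + π + 2 * p.2, π - p.2)

/-- The antipodal scattering relation `𝒮_A(β, α) = (β + π + 2α, -α)`. -/
def ScatA (p : ℝ × ℝ) : ℝ × ℝ := (p.1 + π + 2 * p.2, -p.2)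

/-- Membership in `C^∞_{α,+,+}(∂₊S𝔻)`: `f`, given on the strip `ℝ × [-π/2, π/2]` (2π-periodically
in β), has an even extension through the scattering relation which is smooth on all of `∂S𝔻`
(modelled as a doubly 2π-periodic smooth function on `ℝ²` invariant under `𝒮`), and `f` is
invariant under the antipodal scattering relation. -/
def MemCapp (f : ℝ × ℝ → ℂ) : Prop :=
  ∃ F : ℝ × ℝ → ℂ, ContDiff ℝ (⊤ : ℕ∞) F ∧
    (∀ p : ℝ × ℝ, F (p.1 + 2 * π, p.2) = F p) ∧
    (∀ p : ℝ × ℝ, F (p.1, p.2 + 2 * π) = F p) ∧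
    (∀ p : ℝ × ℝ, F (Scat p) = F p) ∧
    (∀ p : ℝ × ℝ, p.2 ∈ Set.Icc (-(π / 2)) (π / 2) → F (ScatA p) = F p) ∧
    (∀ p : ℝ × ℝ, p.2 ∈ Set.Icc (-(π / 2)) (π / 2) → f p = F p)

/-- `C^∞(𝔻)`: smooth up to the boundary of the closed unit disk. -/
def CinfDisk (f : ℂ → ℂ) : Prop := ContDiffOn ℝ (⊤ : ℕ∞) f (Metric.closedBall 0 1)

end

noncomputable section

/-- The measure `cos α ^ (2γ+2) dα` on `(-π/2, π/2)`. -/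
def angleMeasure (γ : ℝ) : Measure ℝ :=
  (volume.restrict (Ioo (-(π / 2)) (π / 2))).withDensity
    fun a => ENNReal.ofReal (Real.cos a ^ (2 * γ + 2))

/-- The measure `(1 - v²)^γ dv` on `(-1, 1)`. -/
def chordMeasure (γ : ℝ) : Measure ℝ :=
  (volume.restrict (Ioo (-1) 1)).withDensity fun v => ENNReal.ofReal ((1 - v ^ 2) ^ γ)

lemma measurable_cos_rpow (e : ℝ) : Measurable fun a : ℝ => Real.cos a ^ e :=
  Real.measurable_cos.pow_const e

lemma measurable_one_sub_sq_rpow (e : ℝ) : Measurable fun v : ℝ => (1 - v ^ 2) ^ e :=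
  (by fun_prop : Measurable fun v : ℝ => 1 - v ^ 2).pow_const e

lemma integral_angleMeasure {E : Type*} [NormedAddCommGroup E] [NormedSpace ℝ E] (γ : ℝ)
    (f : ℝ → E) :
    ∫ a, f a ∂angleMeasure γ =
      ∫ a in Ioo (-(π / 2)) (π / 2), (Real.cos a ^ (2 * γ + 2)) • f a := by
  rw [angleMeasure, integral_withDensity_eq_integral_toReal_smul
    (measurable_cos_rpow _).ennreal_ofReal (by simp)]
  refine setIntegral_congr_fun measurableSet_Ioo fun a ha => ?_
  rw [ENNReal.toReal_ofReal (Real.rpow_nonneg (Real.cos_pos_of_mem_Ioo ha).le _)]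

lemma one_sub_sq_pos {v : ℝ} (hv : v ∈ Ioo (-1 : ℝ) 1) : 0 < 1 - v ^ 2 := by
  nlinarith [hv.1, hv.2]

lemma integral_chordMeasure {E : Type*} [NormedAddCommGroup E] [NormedSpace ℝ E] (γ : ℝ)
    (f : ℝ → E) :
    ∫ v, f v ∂chordMeasure γ = ∫ v in Ioo (-1 : ℝ) 1, ((1 - v ^ 2) ^ γ) • f v := by
  rw [chordMeasure, integral_withDensity_eq_integral_toReal_smul
    (measurable_one_sub_sq_rpow _).ennreal_ofReal (by simp)]
  refine setIntegral_congr_fun measurableSet_Ioo fun a ha => ?_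
  rw [ENNReal.toReal_ofReal (Real.rpow_nonneg (one_sub_sq_pos ha).le _)]

instance isFiniteMeasure_angleMeasure (γ : ℝ) [hγ : Fact (-1 < γ)] :
    IsFiniteMeasure (angleMeasure γ) := by
  have hγ' := hγ.out
  refine isFiniteMeasure_withDensity_ofReal (Integrable.hasFiniteIntegral ?_)
  have hc : Continuous fun a : ℝ => Real.cos a ^ (2 * γ + 2) :=
    Real.continuous_cos.rpow_const fun _ => Or.inr (by linarith)
  exact (hc.continuousOn.integrableOn_compact (isCompact_Icc (a := -(π / 2)) (b := π / 2))).mono_set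
    Ioo_subset_Icc_self

lemma integrableOn_one_sub_sq_rpow {γ : ℝ} (hγ : -1 < γ) :
    IntegrableOn (fun v : ℝ => (1 - v ^ 2) ^ γ) (Ioo (-1) 1) := by
  have h1 : IntervalIntegrable (fun v : ℝ => (1 - v ^ 2) ^ γ) volume 0 1 := by
    have hb : IntervalIntegrable (fun v : ℝ => (1 - v) ^ γ) volume 0 1 := by
      have := (intervalIntegral.intervalIntegrable_rpow' (a := 0) (b := 1) hγ).comp_sub_left 1
      simpa using this.symm
    have hc : ContinuousOn (fun v : ℝ => (1 + v) ^ γ) (uIcc 0 1) := by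
      refine ContinuousOn.rpow_const (by fun_prop) fun v hv => Or.inl ?_
      rw [uIcc_of_le zero_le_one] at hv
      linarith [hv.1]
    refine (hb.mul_continuousOn hc).congr fun v hv => ?_
    rw [uIoc_of_le zero_le_one] at hv
    rw [← Real.mul_rpow (by linarith [hv.2]) (by linarith [hv.1])]
    ring_nf
  have h2 : IntervalIntegrable (fun v : ℝ => (1 - v ^ 2) ^ γ) volume (-1) 0 := by
    simpa using (h1.comp_sub_left 0).symm
  have h3 := h2.trans h1
  rw [intervalIntegrable_iff, uIoc_of_le (by norm_num)] at h3
  exact h3.mono_set Ioo_subset_Ioc_self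

instance isFiniteMeasure_chordMeasure (γ : ℝ) [hγ : Fact (-1 < γ)] :
    IsFiniteMeasure (chordMeasure γ) :=
  isFiniteMeasure_withDensity_ofReal (integrableOn_one_sub_sq_rpow hγ.out).hasFiniteIntegral

lemma chordMeasure_ae (γ : ℝ) : ∀ᵐ v ∂chordMeasure γ, v ∈ Ioo (-1 : ℝ) 1 :=
  (withDensity_absolutelyContinuous _ _).ae_le (ae_restrict_mem measurableSet_Ioo)

lemma angleMeasure_ae (γ : ℝ) : ∀ᵐ a ∂angleMeasure γ, a ∈ Ioo (-(π / 2)) (π / 2) :=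
  (withDensity_absolutelyContinuous _ _).ae_le (ae_restrict_mem measurableSet_Ioo)

/-- Continuous functions are integrable for `chordMeasure`. -/
lemma Continuous.integrable_chordMeasure {E : Type*} [NormedAddCommGroup E] {γ : ℝ}
    [Fact (-1 < γ)] {f : ℝ → E} (hf : Continuous f) : Integrable f (chordMeasure γ) := by
  have h := hf.continuousOn.integrableOn_compact (μ := chordMeasure γ)
    (isCompact_Icc (a := (-1 : ℝ)) (b := 1))
  rwa [IntegrableOn, Measure.restrict_eq_self_of_ae_mem] at h
  filter_upwards [chordMeasure_ae γ] with v hv using Ioo_subset_Icc_self hv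

lemma Continuous.integrable_angleMeasure {E : Type*} [NormedAddCommGroup E] {γ : ℝ}
    [Fact (-1 < γ)] {f : ℝ → E} (hf : Continuous f) : Integrable f (angleMeasure γ) := by
  have h := hf.continuousOn.integrableOn_compact (μ := angleMeasure γ)
    (isCompact_Icc (a := -(π / 2)) (b := π / 2))
  rwa [IntegrableOn, Measure.restrict_eq_self_of_ae_mem] at h
  filter_upwards [angleMeasure_ae γ] with v hv using Ioo_subset_Icc_self hv

lemma Continuous.integrable_angle_chord {E : Type*} [NormedAddCommGroup E] {γ : ℝ}
    [Fact (-1 < γ)] {f : ℝ × ℝ → E} (hf : Continuous f) :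
    Integrable f ((angleMeasure γ).prod (chordMeasure γ)) := by
  have h := hf.continuousOn.integrableOn_compact (μ := (angleMeasure γ).prod (chordMeasure γ))
    ((isCompact_Icc (a := -(π / 2)) (b := π / 2)).prod (isCompact_Icc (a := (-1 : ℝ)) (b := 1)))
  have h1 : (angleMeasure γ).restrict (Icc (-(π / 2)) (π / 2)) = angleMeasure γ :=
    Measure.restrict_eq_self_of_ae_mem (by
      filter_upwards [angleMeasure_ae γ] with v hv using Ioo_subset_Icc_self hv)
  have h2 : (chordMeasure γ).restrict (Icc (-1) 1) = chordMeasure γ :=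
    Measure.restrict_eq_self_of_ae_mem (by
      filter_upwards [chordMeasure_ae γ] with v hv using Ioo_subset_Icc_self hv)
  rwa [IntegrableOn, ← Measure.prod_restrict, h1, h2] at h

/-- The parametrization of the disk by `(α, v) ↦ sin α + i v cos α`. -/
def diskParam (p : ℝ × ℝ) : ℂ := ⟨Real.sin p.1, Real.cos p.1 * p.2⟩

@[fun_prop]
lemma continuous_diskParam : Continuous diskParam := by
  have : diskParam = fun p => (Complex.equivRealProdCLM.symm (Real.sin p.1, Real.cos p.1 * p.2)) := by
    ext p; simp [diskParam, Complex.ext_iff]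
  rw [this]
  fun_prop

lemma norm_diskParam_sq (p : ℝ × ℝ) :
    ‖diskParam p‖ ^ 2 = 1 - Real.cos p.1 ^ 2 * (1 - p.2 ^ 2) := by
  rw [← Complex.normSq_eq_norm_sq, Complex.normSq_apply, diskParam]
  simp only
  nlinarith [Real.sin_sq_add_cos_sq p.1]

lemma integral_diskParam (γ : ℝ) (g : ℂ → ℂ) :
    ∫ p, g (diskParam p) ∂(angleMeasure γ).prod (chordMeasure γ) =
      ∫ z in ball (0 : ℂ) 1, ((1 - ‖z‖ ^ 2) ^ γ) • g z := by
  have hprod : (angleMeasure γ).prod (chordMeasure γ) =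
      (volume.restrict (Ioo (-(π / 2)) (π / 2) ×ˢ Ioo (-1 : ℝ) 1)).withDensity
        (fun p : ℝ × ℝ => ENNReal.ofReal (Real.cos p.1 ^ (2 * γ + 2)) *
          ENNReal.ofReal ((1 - p.2 ^ 2) ^ γ)) := by
    rw [angleMeasure, chordMeasure, prod_withDensity (measurable_cos_rpow _).ennreal_ofReal
      (measurable_one_sub_sq_rpow _).ennreal_ofReal, Measure.prod_restrict]
    rfl
  have hmeas : Measurable fun p : ℝ × ℝ => ENNReal.ofReal (Real.cos p.1 ^ (2 * γ + 2)) *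
      ENNReal.ofReal ((1 - p.2 ^ 2) ^ γ) :=
    ((measurable_cos_rpow _).ennreal_ofReal.comp measurable_fst).mul
      ((measurable_one_sub_sq_rpow _).ennreal_ofReal.comp measurable_snd)
  rw [hprod, integral_withDensity_eq_integral_toReal_smul hmeas
    (Filter.Eventually.of_forall fun p => ENNReal.mul_lt_top (by simp) (by simp))]
  set R := Ioo (-(π / 2)) (π / 2) ×ˢ Ioo (-1 : ℝ) 1 with hR
  have hRm : MeasurableSet R := measurableSet_Ioo.prod measurableSet_Ioo
  let Φ : ℝ × ℝ → ℝ × ℝ := fun p => (Real.sin p.1, Real.cos p.1 * p.2)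
  let Φ' : ℝ × ℝ → (ℝ × ℝ →L[ℝ] ℝ × ℝ) := fun p =>
    (Real.cos p.1 • ContinuousLinearMap.fst ℝ ℝ ℝ).prod
      (Real.cos p.1 • ContinuousLinearMap.snd ℝ ℝ ℝ +
        p.2 • (-Real.sin p.1) • ContinuousLinearMap.fst ℝ ℝ ℝ)
  have hΦ' : ∀ p ∈ R, HasFDerivWithinAt Φ (Φ' p) R p := by
    intro p _
    have h1 : HasFDerivAt (fun p : ℝ × ℝ => Real.sin p.1)
        (Real.cos p.1 • ContinuousLinearMap.fst ℝ ℝ ℝ) p :=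
      (Real.hasDerivAt_sin p.1).comp_hasFDerivAt p hasFDerivAt_fst
    have h2 : HasFDerivAt (fun p : ℝ × ℝ => Real.cos p.1)
        ((-Real.sin p.1) • ContinuousLinearMap.fst ℝ ℝ ℝ) p :=
      (Real.hasDerivAt_cos p.1).comp_hasFDerivAt p hasFDerivAt_fst
    exact (h1.prodMk (h2.mul hasFDerivAt_snd)).hasFDerivWithinAt
  have hdet : ∀ p, (Φ' p).det = Real.cos p.1 ^ 2 := by
    intro p
    rw [ContinuousLinearMap.det, ← LinearMap.det_toMatrix (Module.Basis.finTwoProd ℝ)]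
    rw [Matrix.det_fin_two]
    simp only [LinearMap.toMatrix_apply, Φ']
    simp [sq]
  have hinj : InjOn Φ R := by
    rintro ⟨a, v⟩ ⟨ha, _⟩ ⟨b, w⟩ ⟨hb, _⟩ h
    simp only [Φ, Prod.mk.injEq] at h
    have hab : a = b := Real.injOn_sin (Ioo_subset_Icc_self ha) (Ioo_subset_Icc_self hb) h.1
    subst hab
    have := (Real.cos_pos_of_mem_Ioo ha).ne'
    simpa [this] using h.2
  have himg : Φ '' R = (Complex.equivRealProd) '' ball (0 : ℂ) 1 := by
    ext ⟨x, y⟩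
    constructor
    · rintro ⟨⟨a, v⟩, ⟨ha, hv⟩, h⟩
      refine ⟨diskParam (a, v), ?_, h⟩
      rw [mem_ball_zero_iff, ← abs_of_nonneg (norm_nonneg (diskParam _)), ← sq_lt_one_iff_abs_lt_one,
        norm_diskParam_sq]
      have := mul_pos (pow_pos (Real.cos_pos_of_mem_Ioo ha) 2) (one_sub_sq_pos hv)
      simpa using this
    · rintro ⟨z, hz, h⟩
      obtain ⟨rfl, rfl⟩ : z.re = x ∧ z.im = y := by simpa using h
      have hn : z.re ^ 2 + z.im ^ 2 < 1 := by
        have : ‖z‖ ^ 2 < 1 := by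
          rw [sq_lt_one_iff_abs_lt_one, abs_of_nonneg (norm_nonneg _)]; simpa using hz
        rw [← Complex.normSq_eq_norm_sq, Complex.normSq_apply] at this
        linarith
      have hx : z.re ∈ Ioo (-1 : ℝ) 1 := abs_lt.1 ((sq_lt_one_iff_abs_lt_one _).1 (by nlinarith [sq_nonneg z.im]))
      have hs := Real.sin_arcsin hx.1.le hx.2.le
      have hI : Real.arcsin z.re ∈ Ioo (-(π / 2)) (π / 2) :=
        ⟨Real.neg_pi_div_two_lt_arcsin.2 hx.1, Real.arcsin_lt_pi_div_two.2 hx.2⟩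
      have hc := Real.cos_pos_of_mem_Ioo hI
      refine ⟨(Real.arcsin z.re, z.im / Real.cos (Real.arcsin z.re)), ⟨hI, ?_⟩, ?_⟩
      · rw [mem_Ioo, ← abs_lt, ← sq_lt_one_iff_abs_lt_one, div_pow, div_lt_one (by positivity),
          Real.cos_sq', hs]
        linarith
      · simp only [Φ, hs, Prod.mk.injEq, true_and]
        field_simp
  have key := integral_image_eq_integral_abs_det_fderiv_smul volume hRm hΦ' hinj
    (fun q : ℝ × ℝ => ((1 - (q.1 ^ 2 + q.2 ^ 2)) ^ γ) • g ⟨q.1, q.2⟩)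
  have hL : ∫ p in R, ((ENNReal.ofReal (Real.cos p.1 ^ (2 * γ + 2)) *
      ENNReal.ofReal ((1 - p.2 ^ 2) ^ γ)).toReal) • g (diskParam p) =
      ∫ p in R, |(Φ' p).det| • ((1 - ((Φ p).1 ^ 2 + (Φ p).2 ^ 2)) ^ γ) • g ⟨(Φ p).1, (Φ p).2⟩ := by
    refine setIntegral_congr_fun hRm fun p hp => ?_
    have hc := Real.cos_pos_of_mem_Ioo hp.1
    have hv := one_sub_sq_pos hp.2
    rw [ENNReal.toReal_mul, ENNReal.toReal_ofReal (by positivity),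
      ENNReal.toReal_ofReal (by positivity), hdet, abs_of_pos (by positivity), smul_smul]
    have h1 : 1 - ((Φ p).1 ^ 2 + (Φ p).2 ^ 2) = Real.cos p.1 ^ 2 * (1 - p.2 ^ 2) := by
      simp only [Φ]; nlinarith [Real.sin_sq_add_cos_sq p.1]
    rw [h1, Real.mul_rpow (by positivity) hv.le, ← mul_assoc]
    congr 2
    rw [Real.rpow_add hc, ← Real.rpow_natCast_mul hc.le]
    simp [mul_comm]
  rw [hL, ← key, himg]
  have hmp := Complex.volume_preserving_equiv_real_prod
  have := hmp.setIntegral_image_emb Complex.measurableEquivRealProd.measurableEmbedding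
    (fun q : ℝ × ℝ => ((1 - (q.1 ^ 2 + q.2 ^ 2)) ^ γ) • g ⟨q.1, q.2⟩) (ball (0 : ℂ) 1)
  refine Eq.trans ?_ (this.trans ?_)
  · rfl
  · refine setIntegral_congr_fun measurableSet_ball fun z _ => ?_
    simp only [Complex.measurableEquivRealProd_apply]
    rw [← Complex.normSq_eq_norm_sq, Complex.normSq_apply]
    simp [sq]

/-- Rotation invariance of the disk measure in the coordinates `diskParam`. -/
lemma integral_diskParam_rotation (γ : ℝ) (g : ℂ → ℂ) (c : Circle) :
    ∫ p, g (c * diskParam p) ∂(angleMeasure γ).prod (chordMeasure γ) =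
      ∫ p, g (diskParam p) ∂(angleMeasure γ).prod (chordMeasure γ) := by
  rw [integral_diskParam γ (fun z => g (c * z)), integral_diskParam γ g]
  have := (rotation c).measurePreserving.setIntegral_preimage_emb
    (rotation c).toHomeomorph.measurableEmbedding
    (fun z => ((1 - ‖z‖ ^ 2) ^ γ) • g z) (ball 0 1)
  rw [← this]
  have hpre : (rotation c) ⁻¹' ball (0 : ℂ) 1 = ball 0 1 := by
    ext z; rw [mem_preimage, mem_ball_zero_iff, LinearIsometryEquiv.norm_map, mem_ball_zero_iff]
  rw [hpre]
  refine setIntegral_congr_fun measurableSet_ball fun z _ => ?_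
  rw [LinearIsometryEquiv.norm_map, rotation_apply]
end

noncomputable section

lemma Polynomial.eval_derivative_one_le {n : ℕ} {P : Polynomial ℝ} (hP : P.natDegree ≤ n) {M : ℝ}
    (hM : ∀ x ∈ Icc (-1 : ℝ) 1, |P.eval x| ≤ M) :
    P.derivative.eval 1 ≤ (n : ℝ) ^ 2 * M := by
  have hM0 : 0 ≤ M := (abs_nonneg _).trans (hM 0 (by norm_num))
  rcases hM0.eq_or_lt with rfl | hpos
  · have : P = 0 := Polynomial.eq_zero_of_infinite_isRoot P
      ((Icc_infinite (by norm_num : (-1 : ℝ) < 1)).mono fun x hx => by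
        simpa using hM x hx)
    simp [this]
  · have h := Polynomial.Chebyshev.eval_iterate_derivative_le_of_forall_abs_le_one (n := n)
      (P := Polynomial.C M⁻¹ * P) (k := 1) (x := 1) le_rfl
      (Polynomial.degree_le_of_natDegree_le ((Polynomial.natDegree_C_mul_le _ _).trans hP))
      (fun x hx => by
        rw [Polynomial.eval_mul, Polynomial.eval_C, abs_mul, abs_of_pos (inv_pos.2 hpos),
          inv_mul_le_one₀ hpos]
        exact hM x hx)
    rw [Function.iterate_one, Polynomial.Chebyshev.derivative_T_eval_one,
      Polynomial.derivative_C_mul, Polynomial.eval_mul, Polynomial.eval_C,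
      inv_mul_le_iff₀ hpos] at h
    simpa [mul_comm] using h

lemma Polynomial.eval_derivative_le_of_nonneg {n : ℕ} {P : Polynomial ℝ} (hP : P.natDegree ≤ n)
    {M : ℝ} (hM : ∀ x ∈ Icc (-1 : ℝ) 1, |P.eval x| ≤ M) {x : ℝ} (hx : x ∈ Icc (0 : ℝ) 1) :
    P.derivative.eval x ≤ 2 * (n : ℝ) ^ 2 * M := by
  have hM0 : 0 ≤ M := (abs_nonneg _).trans (hM 0 (by norm_num))
  set A : Polynomial ℝ := Polynomial.C ((1 + x) / 2) * Polynomial.X + Polynomial.C ((x - 1) / 2)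
  have hA : A.natDegree ≤ 1 := Polynomial.natDegree_linear_le
  have h := Polynomial.eval_derivative_one_le (n := n) (P := P.comp A) (M := M)
    (Polynomial.natDegree_comp_le.trans (by nlinarith)) (fun y hy => by
      rw [Polynomial.eval_comp]
      refine hM _ ?_
      simp only [A, Polynomial.eval_add, Polynomial.eval_mul, Polynomial.eval_C, Polynomial.eval_X]
      constructor <;> nlinarith [hx.1, hx.2, hy.1, hy.2])
  rw [Polynomial.derivative_comp, Polynomial.eval_mul, Polynomial.eval_comp] at h
  have h1 : A.eval 1 = x := by simp [A]; ring
  have h2 : A.derivative.eval 1 = (1 + x) / 2 := by simp [A]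
  rw [h1, h2] at h
  have h3 : 0 ≤ (n : ℝ) ^ 2 * M := by positivity
  by_contra! hc
  nlinarith [hx.1]

/-- A weak form of Markov's inequality. -/
lemma Polynomial.abs_eval_derivative_le {n : ℕ} {P : Polynomial ℝ} (hP : P.natDegree ≤ n)
    {M : ℝ} (hM : ∀ x ∈ Icc (-1 : ℝ) 1, |P.eval x| ≤ M) {x : ℝ} (hx : x ∈ Icc (-1 : ℝ) 1) :
    |P.derivative.eval x| ≤ 2 * (n : ℝ) ^ 2 * M := by
  have key : ∀ Q : Polynomial ℝ, Q.natDegree ≤ n → (∀ x ∈ Icc (-1 : ℝ) 1, |Q.eval x| ≤ M) →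
      ∀ y ∈ Icc (0 : ℝ) 1, |Q.derivative.eval y| ≤ 2 * (n : ℝ) ^ 2 * M := by
    intro Q hQ hQM y hy
    refine abs_le'.2 ⟨Polynomial.eval_derivative_le_of_nonneg hQ hQM hy, ?_⟩
    have := Polynomial.eval_derivative_le_of_nonneg (P := -Q) (by simpa using hQ)
      (by simpa using hQM) hy
    simpa using this
  rcases le_total 0 x with h0 | h0
  · exact key P hP hM x ⟨h0, hx.2⟩
  · have := key (P.comp (-Polynomial.X)) (by simpa [Polynomial.natDegree_comp] using hP)
      (fun y hy => by
        rw [Polynomial.eval_comp]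
        exact hM _ (by simp only [Polynomial.eval_neg, Polynomial.eval_X]; constructor <;> linarith [hy.1, hy.2]))
      (-x) ⟨by linarith, by linarith [hx.1]⟩
    simpa [Polynomial.derivative_comp, Polynomial.eval_comp] using this

lemma Polynomial.abs_eval_iterate_derivative_le {n : ℕ} {P : Polynomial ℝ} (hP : P.natDegree ≤ n)
    {M : ℝ} (hM : ∀ x ∈ Icc (-1 : ℝ) 1, |P.eval x| ≤ M) (i : ℕ) :
    ∀ x ∈ Icc (-1 : ℝ) 1,
      |(Polynomial.derivative^[i] P).eval x| ≤ (2 * (n : ℝ) ^ 2) ^ i * M := by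
  induction i with
  | zero => simpa using hM
  | succ i ih =>
    intro x hx
    rw [Function.iterate_succ_apply']
    have hd : (Polynomial.derivative^[i] P).natDegree ≤ n :=
      (Polynomial.natDegree_iterate_derivative P i).trans ((Nat.sub_le _ _).trans hP)
    refine (Polynomial.abs_eval_derivative_le hd ih hx).trans (le_of_eq ?_)
    ring

lemma Polynomial.abs_eval_le_of_one_sub_sq_mul {n : ℕ} {Q : Polynomial ℝ} (hQ : Q.natDegree ≤ n)
    {M : ℝ} (hM : ∀ x ∈ Icc (-1 : ℝ) 1, |((1 - Polynomial.X ^ 2) * Q).eval x| ≤ M) :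
    ∀ x ∈ Icc (-1 : ℝ) 1, |Q.eval x| ≤ 2 * ((n : ℝ) + 2) ^ 2 * M := by
  set R : Polynomial ℝ := (1 - Polynomial.X ^ 2) * Q with hR
  have hdeg : R.natDegree ≤ n + 2 := by
    have h1 : (1 - Polynomial.X ^ 2 : Polynomial ℝ).natDegree ≤ 2 := by compute_degree
    exact Polynomial.natDegree_mul_le.trans (by omega)
  have hder := fun x hx => Polynomial.abs_eval_derivative_le hdeg hM (x := x) hx
  push_cast at hder
  set B := 2 * ((n : ℝ) + 2) ^ 2 * M
  have hev : ∀ x, R.eval x = (1 - x ^ 2) * Q.eval x := fun x => by simp [hR]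
  have hdev : ∀ x, R.derivative.eval x = -2 * x * Q.eval x + (1 - x ^ 2) * Q.derivative.eval x := by
    intro x; simp [hR, Polynomial.derivative_mul]
    left; left; norm_num
  have hmv : ∀ x ∈ Icc (-1 : ℝ) 1, ∀ y ∈ Icc (-1 : ℝ) 1, |R.eval x - R.eval y| ≤ B * |x - y| := by
    intro x hx y hy
    have := (convex_Icc (-1 : ℝ) 1).norm_image_sub_le_of_norm_hasDerivWithin_le
      (fun z hz => (R.hasDerivAt z).hasDerivWithinAt) (C := B)
      (fun z hz => by simpa using hder z hz) hy hx
    simpa using this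
  intro x hx
  have hB : 0 ≤ B := (abs_nonneg _).trans (hder 0 (by norm_num))
  rcases eq_or_lt_of_le hx.2 with rfl | h1
  · have := hder 1 (by norm_num)
    rw [hdev, show (-2 : ℝ) * 1 * Q.eval 1 + (1 - 1 ^ 2) * Q.derivative.eval 1 = -2 * Q.eval 1 by ring,
      abs_mul] at this
    norm_num at this
    linarith [abs_nonneg (Q.eval 1)]
  rcases eq_or_lt_of_le hx.1 with rfl | h2
  · have := hder (-1) (by norm_num)
    rw [hdev, show (-2 : ℝ) * (-1) * Q.eval (-1) + (1 - (-1) ^ 2) * Q.derivative.eval (-1)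
      = 2 * Q.eval (-1) by ring, abs_mul] at this
    norm_num at this
    linarith [abs_nonneg (Q.eval (-1))]
  have hpos : 0 < 1 - x ^ 2 := by nlinarith
  have hq : (1 - x ^ 2) * |Q.eval x| = |R.eval x| := by rw [hev, abs_mul, abs_of_pos hpos]
  rcases le_total 0 x with h0 | h0
  · have := hmv x hx 1 (by norm_num)
    rw [hev 1, show (1 - (1 : ℝ) ^ 2) * Q.eval 1 = 0 by ring, sub_zero, ← hq,
      abs_of_neg (by linarith : x - 1 < 0)] at this
    have h3 : (1 - x) * |Q.eval x| ≤ (1 - x) * B := by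
      nlinarith [abs_nonneg (Q.eval x), mul_nonneg (mul_nonneg h0 (by linarith : 0 ≤ 1 - x)) (abs_nonneg (Q.eval x))]
    exact le_of_mul_le_mul_left h3 (by linarith)
  · have := hmv x hx (-1) (by norm_num)
    rw [hev (-1), show (1 - (-1 : ℝ) ^ 2) * Q.eval (-1) = 0 by ring, sub_zero, ← hq,
      abs_of_pos (by linarith : 0 < x - -1)] at this
    have h3 : (1 + x) * |Q.eval x| ≤ (1 + x) * B := by
      nlinarith [abs_nonneg (Q.eval x), mul_nonneg (mul_nonneg (by linarith : 0 ≤ -x) (by linarith : 0 ≤ 1 + x)) (abs_nonneg (Q.eval x))]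
    exact le_of_mul_le_mul_left h3 (by linarith)

lemma Polynomial.abs_eval_le_of_one_sub_sq_pow_mul (N : ℕ) : ∀ {n : ℕ} {Q : Polynomial ℝ},
    Q.natDegree ≤ n → ∀ {M : ℝ},
    (∀ x ∈ Icc (-1 : ℝ) 1, |((1 - Polynomial.X ^ 2) ^ N * Q).eval x| ≤ M) →
    ∀ x ∈ Icc (-1 : ℝ) 1, |Q.eval x| ≤ (2 * ((n : ℝ) + 2 * N) ^ 2) ^ N * M := by
  induction N with
  | zero => intro n Q _ M hM; simpa using hM
  | succ N ih =>
    intro n Q hQ M hM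
    have hdeg : ((1 - Polynomial.X ^ 2) * Q).natDegree ≤ n + 2 := by
      have h1 : (1 - Polynomial.X ^ 2 : Polynomial ℝ).natDegree ≤ 2 := by compute_degree
      exact Polynomial.natDegree_mul_le.trans (by omega)
    have h1 := ih hdeg (M := M) (by simpa only [pow_succ, mul_assoc] using hM)
    have hM0 : 0 ≤ M := (abs_nonneg _).trans (hM 0 (by norm_num))
    intro x hx
    refine (Polynomial.abs_eval_le_of_one_sub_sq_mul hQ h1 x hx).trans ?_
    push_cast
    have e : (n : ℝ) + 2 + 2 * N = n + 2 * (N + 1) := by ring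
    rw [e]
    have : (2 * ((n : ℝ) + 2) ^ 2) ≤ (2 * ((n : ℝ) + 2 * (N + 1)) ^ 2) := by
      gcongr; nlinarith [(Nat.cast_nonneg N : (0 : ℝ) ≤ N)]
    calc _ = ((2 * ((n : ℝ) + 2 * (N + 1)) ^ 2) ^ N * M) * (2 * ((n : ℝ) + 2) ^ 2) := by ring
      _ ≤ ((2 * ((n : ℝ) + 2 * (N + 1)) ^ 2) ^ N * M) * (2 * ((n : ℝ) + 2 * (N + 1)) ^ 2) := by
        gcongr
      _ = _ := by ring

lemma Polynomial.exists_antiderivative (Q : Polynomial ℝ) :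
    ∃ P : Polynomial ℝ, P.derivative = Q ∧ P.natDegree ≤ Q.natDegree + 1 := by
  refine ⟨∑ i ∈ Finset.range (Q.natDegree + 1), Polynomial.monomial (i + 1) (Q.coeff i / (i + 1)),
    ?_, ?_⟩
  · rw [Polynomial.derivative_sum]
    conv_rhs => rw [Q.as_sum_range]
    refine Finset.sum_congr rfl fun i _ => ?_
    rw [Polynomial.derivative_monomial]
    congr 1
    push_cast
    have : (i : ℝ) + 1 ≠ 0 := by positivity
    field_simp
  · refine Polynomial.natDegree_sum_le_of_forall_le _ _ fun i hi => ?_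
    refine (Polynomial.natDegree_monomial_le _).trans ?_
    have := Finset.mem_range.1 hi
    omega

/-- Nikolskii-type inequality: the sup norm of a polynomial on `[-1, 1]` is controlled by its
weighted `L²` norm, with polynomial loss in the degree. -/
lemma Polynomial.sq_eval_le_integral {n : ℕ} {Q : Polynomial ℝ} (hQ : Q.natDegree ≤ n) (N : ℕ) :
    ∀ x ∈ Icc (-1 : ℝ) 1, Q.eval x ^ 2 ≤
      (2 * (2 * (n : ℝ) + 2 * N + 1) ^ 2) ^ (N + 1) * ∫ y in (-1 : ℝ)..1, (1 - y ^ 2) ^ N * Q.eval y ^ 2 := by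
  obtain ⟨P, hP, hPd⟩ := Polynomial.exists_antiderivative ((1 - Polynomial.X ^ 2) ^ N * Q ^ 2)
  set I := ∫ y in (-1 : ℝ)..1, (1 - y ^ 2) ^ N * Q.eval y ^ 2 with hI
  have hQ2 : (Q ^ 2).natDegree ≤ 2 * n := Polynomial.natDegree_pow_le.trans (by omega)
  have hd1 : ((1 - Polynomial.X ^ 2 : Polynomial ℝ) ^ N).natDegree ≤ 2 * N := by
    refine Polynomial.natDegree_pow_le.trans ?_
    have h1 : (1 - Polynomial.X ^ 2 : Polynomial ℝ).natDegree ≤ 2 := by compute_degree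
    nlinarith
  have hPd' : (P - Polynomial.C (P.eval (-1))).natDegree ≤ 2 * n + 2 * N + 1 := by
    rw [Polynomial.natDegree_sub_C]
    refine hPd.trans ?_
    have := Polynomial.natDegree_mul_le (p := (1 - Polynomial.X ^ 2 : Polynomial ℝ) ^ N) (q := Q ^ 2)
    omega
  have hftc : ∀ x, P.eval x - P.eval (-1) = ∫ y in (-1 : ℝ)..x, (1 - y ^ 2) ^ N * Q.eval y ^ 2 := by
    intro x
    rw [intervalIntegral.integral_eq_sub_of_hasDerivAt (f := fun y => P.eval y)]
    · intro y _
      have := P.hasDerivAt y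
      rw [hP] at this
      simpa using this
    · exact Continuous.intervalIntegrable (by fun_prop) _ _
  have hnn : ∀ y ∈ Icc (-1 : ℝ) 1, 0 ≤ (1 - y ^ 2) ^ N * Q.eval y ^ 2 := by
    intro y hy
    have : 0 ≤ 1 - y ^ 2 := by nlinarith [hy.1, hy.2]
    positivity
  have hbd : ∀ x ∈ Icc (-1 : ℝ) 1, |(P - Polynomial.C (P.eval (-1))).eval x| ≤ I := by
    intro x hx
    rw [Polynomial.eval_sub, Polynomial.eval_C, hftc, abs_of_nonneg]
    · refine intervalIntegral.integral_mono_interval le_rfl hx.1 hx.2 ?_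
        (Continuous.intervalIntegrable (by fun_prop) _ _)
      filter_upwards [ae_restrict_mem measurableSet_Ioc] with y hy
      exact hnn y (Ioc_subset_Icc_self hy)
    · exact intervalIntegral.integral_nonneg hx.1 fun y hy => hnn y ⟨hy.1, hy.2.trans hx.2⟩
  have hI0 : 0 ≤ I := (abs_nonneg _).trans (hbd 0 (by norm_num))
  have h2 : ∀ x ∈ Icc (-1 : ℝ) 1, |((1 - Polynomial.X ^ 2) ^ N * Q ^ 2).eval x| ≤
      2 * (2 * (n : ℝ) + 2 * N + 1) ^ 2 * I := by
    intro x hx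
    have := Polynomial.abs_eval_derivative_le hPd' hbd hx
    rw [Polynomial.derivative_sub, Polynomial.derivative_C, sub_zero, hP] at this
    push_cast at this
    exact this
  intro x hx
  have h3 := Polynomial.abs_eval_le_of_one_sub_sq_pow_mul N hQ2 h2 x hx
  rw [Polynomial.eval_pow, abs_of_nonneg (sq_nonneg _)] at h3
  refine h3.trans ?_
  push_cast
  calc _ = (2 * (2 * (n : ℝ) + 2 * N) ^ 2) ^ N * ((2 * (2 * (n : ℝ) + 2 * N + 1) ^ 2) * I) := by ring
    _ ≤ (2 * (2 * (n : ℝ) + 2 * N + 1) ^ 2) ^ N * ((2 * (2 * (n : ℝ) + 2 * N + 1) ^ 2) * I) := by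
      have h4 : 2 * (n : ℝ) + 2 * N ≤ 2 * n + 2 * N + 1 := by linarith
      refine mul_le_mul_of_nonneg_right (pow_le_pow_left₀ (by positivity) ?_ _) (by positivity)
      exact mul_le_mul_of_nonneg_left (pow_le_pow_left₀ (by positivity) h4 _) (by norm_num)
    _ = _ := by ring
end

noncomputable section

lemma integral_angleMeasure_comp_sin (γ : ℝ) (g : ℝ → ℝ) :
    ∫ a, g (Real.sin a) ∂angleMeasure γ =
      ∫ x in (-1 : ℝ)..1, g x * (1 - x ^ 2) ^ (γ + 1 / 2) := by
  have himg : Real.sin '' Ioo (-(π / 2)) (π / 2) = Ioo (-1) 1 := by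
    have := Real.sinPartialHomeomorph.image_source_eq_target
    simpa [Real.sinPartialHomeomorph] using this
  rw [integral_angleMeasure, intervalIntegral.integral_of_le (by norm_num),
    integral_Ioc_eq_integral_Ioo, ← himg,
    integral_image_eq_integral_abs_deriv_smul measurableSet_Ioo
      (fun x _ => (Real.hasDerivAt_sin x).hasDerivWithinAt)
      (Real.injOn_sin.mono Ioo_subset_Icc_self)]
  refine setIntegral_congr_fun measurableSet_Ioo fun a ha => ?_
  have hc := Real.cos_pos_of_mem_Ioo ha
  have h1 : 1 - Real.sin a ^ 2 = Real.cos a ^ (2 : ℝ) := by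
    rw [Real.rpow_two, ← Real.sin_sq_add_cos_sq a]; ring
  simp only [smul_eq_mul]
  rw [h1, ← Real.rpow_mul hc.le, abs_of_pos hc, show 2 * γ + 2 = 2 * (γ + 1 / 2) + 1 by ring,
    Real.rpow_add_one hc.ne']
  ring

lemma exists_sq_eval_le_integral_angleMeasure (γ : ℝ) [Fact (-1 < γ)] :
    ∃ C : ℝ, ∃ K : ℕ, 0 < C ∧ ∀ (n : ℕ) (Q : Polynomial ℝ), Q.natDegree ≤ n →
      ∀ x ∈ Icc (-1 : ℝ) 1, Q.eval x ^ 2 ≤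
        C * (1 + n : ℝ) ^ K * ∫ a, Q.eval (Real.sin a) ^ 2 ∂angleMeasure γ := by
  obtain ⟨N, hN⟩ := exists_nat_ge (γ + 1 / 2)
  refine ⟨(2 * (2 * (N : ℝ) + 2) ^ 2) ^ (N + 1), 2 * (N + 1), by positivity, ?_⟩
  intro n Q hQ x hx
  refine (Polynomial.sq_eval_le_integral hQ N x hx).trans ?_
  have h1 : ∫ y in (-1 : ℝ)..1, (1 - y ^ 2) ^ N * Q.eval y ^ 2 ≤
      ∫ a, Q.eval (Real.sin a) ^ 2 ∂angleMeasure γ := by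
    have h2 := integral_angleMeasure_comp_sin ((N : ℝ) - 1 / 2) (fun y => Q.eval y ^ 2)
    simp only [sub_add_cancel, Real.rpow_natCast] at h2
    simp_rw [mul_comm ((1 - _ ^ 2 : ℝ) ^ N)]
    rw [← h2, integral_angleMeasure, integral_angleMeasure]
    have hc : ∀ e : ℝ, 0 ≤ e →
        IntegrableOn (fun a => (Real.cos a ^ e) • Q.eval (Real.sin a) ^ 2)
          (Ioo (-(π / 2)) (π / 2)) := fun e he =>
      (Continuous.integrableOn_Icc (by
        have : Continuous fun a => Real.cos a ^ e :=
          Real.continuous_cos.rpow_const fun _ => Or.inr he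
        fun_prop)).mono_set Ioo_subset_Icc_self
    have hγ := Fact.out (p := -1 < γ)
    refine setIntegral_mono_on (hc _ (by linarith [(Nat.cast_nonneg N : (0 : ℝ) ≤ N)]))
      (hc _ (by linarith)) measurableSet_Ioo fun a ha => ?_
    have := Real.rpow_le_rpow_of_exponent_ge (Real.cos_pos_of_mem_Ioo ha) (Real.cos_le_one a)
      (show 2 * γ + 2 ≤ 2 * ((N : ℝ) - 1 / 2) + 2 by linarith)
    exact mul_le_mul_of_nonneg_right this (sq_nonneg _)
  have h0 : 0 ≤ ∫ a, Q.eval (Real.sin a) ^ 2 ∂angleMeasure γ :=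
    integral_nonneg fun _ => sq_nonneg _
  calc _ ≤ (2 * (2 * (n : ℝ) + 2 * N + 1) ^ 2) ^ (N + 1) *
        ∫ a, Q.eval (Real.sin a) ^ 2 ∂angleMeasure γ := by gcongr
    _ ≤ (2 * ((2 * (N : ℝ) + 2) * (1 + n)) ^ 2) ^ (N + 1) *
        ∫ a, Q.eval (Real.sin a) ^ 2 ∂angleMeasure γ := by
      refine mul_le_mul_of_nonneg_right (pow_le_pow_left₀ (by positivity) ?_ _) h0
      refine mul_le_mul_of_nonneg_left (pow_le_pow_left₀ (by positivity) ?_ _) (by norm_num)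
      have : (0 : ℝ) ≤ N * n := by positivity
      nlinarith
    _ = _ := by rw [mul_pow (2 * (N : ℝ) + 2), ← mul_assoc, mul_pow _ ((1 + n : ℝ) ^ 2), ← pow_mul]

lemma Polynomial.eq_zero_of_integral_sq_eq_zero {γ : ℝ} [Fact (-1 < γ)] {Q : Polynomial ℝ}
    (h : ∫ a, Q.eval (Real.sin a) ^ 2 ∂angleMeasure γ = 0) : Q = 0 := by
  obtain ⟨C, K, -, hC⟩ := exists_sq_eval_le_integral_angleMeasure γ
  refine Polynomial.eq_zero_of_infinite_isRoot Q
    ((Icc_infinite (by norm_num : (-1 : ℝ) < 1)).mono fun x hx => ?_)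
  have := hC _ Q le_rfl x hx
  rw [h, mul_zero] at this
  exact pow_eq_zero_iff (two_ne_zero) |>.1 (le_antisymm this (sq_nonneg _))

namespace IsMonicOrtho

variable {γ : ℝ} [Fact (-1 < γ)] {L : ℕ → Polynomial ℝ}

lemma integral_mul_eq_zero (hL : IsMonicOrtho γ L) {n : ℕ} {q : Polynomial ℝ}
    (hq : q.degree < n) :
    ∫ a, (L n).eval (Real.sin a) * q.eval (Real.sin a) ∂angleMeasure γ = 0 := by
  simp_rw [Polynomial.eval_eq_sum_range (p := q), Finset.mul_sum]
  rw [integral_finsetSum _ fun i _ => Continuous.integrable_angleMeasure (by fun_prop)]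
  refine Finset.sum_eq_zero fun i hi => ?_
  by_cases hi0 : q.coeff i = 0
  · simp [hi0]
  have hin : i < n := by
    have := Polynomial.le_degree_of_ne_zero hi0
    exact_mod_cast this.trans_lt hq
  have := (hL n).2.2 i hin
  rw [← integral_angleMeasure_comp_sin γ fun x => (L n).eval x * x ^ i] at this
  calc _ = ∫ a, q.coeff i * ((L n).eval (Real.sin a) * Real.sin a ^ i) ∂angleMeasure γ := by
        congr 1; ext a; ring
    _ = _ := by rw [integral_const_mul, this, mul_zero]

lemma eq_C_mul (hL : IsMonicOrtho γ L) {n : ℕ} {R : Polynomial ℝ}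
    (hR : R.natDegree ≤ n) (h : ∀ q : Polynomial ℝ, q.degree < n →
      ∫ a, R.eval (Real.sin a) * q.eval (Real.sin a) ∂angleMeasure γ = 0) :
    R = Polynomial.C (R.coeff n) * L n := by
  rw [← sub_eq_zero]
  set D := R - Polynomial.C (R.coeff n) * L n with hD
  have hdeg : D.degree < n := by
    rw [Polynomial.degree_lt_iff_coeff_zero]
    intro m hm
    rcases hm.eq_or_lt with rfl | hm
    · have : (L n).coeff n = 1 := by
        have := (hL n).1.coeff_natDegree
        rwa [(hL n).2.1] at this
      simp [hD, this]
    · have h1 : R.coeff m = 0 := Polynomial.coeff_eq_zero_of_natDegree_lt (hR.trans_lt hm)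
      have h2 : (L n).coeff m = 0 :=
        Polynomial.coeff_eq_zero_of_natDegree_lt ((hL n).2.1.trans_lt hm)
      simp [hD, h1, h2]
  apply Polynomial.eq_zero_of_integral_sq_eq_zero (γ := γ)
  have h1 := h D hdeg
  have h2 := hL.integral_mul_eq_zero hdeg
  calc _ = ∫ a, (R.eval (Real.sin a) * D.eval (Real.sin a) -
        R.coeff n * ((L n).eval (Real.sin a) * D.eval (Real.sin a))) ∂angleMeasure γ := by
        congr 1; ext a
        simp only [hD, Polynomial.eval_sub, Polynomial.eval_mul, Polynomial.eval_C]
        ring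
    _ = 0 := by
      rw [integral_sub (Continuous.integrable_angleMeasure (by fun_prop))
        (Continuous.integrable_angleMeasure (by fun_prop)), integral_const_mul, h1, h2]
      simp

end IsMonicOrtho

/-- The weight defining `angleMeasure` is even. -/
lemma integral_angleMeasure_neg {E : Type*} [NormedAddCommGroup E] [NormedSpace ℝ E] (γ : ℝ)
    (f : ℝ → E) : ∫ a, f (-a) ∂angleMeasure γ = ∫ a, f a ∂angleMeasure γ := by
  rw [integral_angleMeasure, integral_angleMeasure, ← integral_Ioc_eq_integral_Ioo,
    ← integral_Ioc_eq_integral_Ioo, ← intervalIntegral.integral_of_le (by linarith [pi_pos]),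
    ← intervalIntegral.integral_of_le (by linarith [pi_pos])]
  have := intervalIntegral.integral_comp_neg (a := -(π / 2)) (b := π / 2)
    fun a => Real.cos a ^ (2 * γ + 2) • f a
  simpa using this

lemma integral_chordMeasure_neg {E : Type*} [NormedAddCommGroup E] [NormedSpace ℝ E] (γ : ℝ)
    (f : ℝ → E) : ∫ v, f (-v) ∂chordMeasure γ = ∫ v, f v ∂chordMeasure γ := by
  rw [integral_chordMeasure, integral_chordMeasure, ← integral_Ioc_eq_integral_Ioo,
    ← integral_Ioc_eq_integral_Ioo, ← intervalIntegral.integral_of_le (by norm_num),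
    ← intervalIntegral.integral_of_le (by norm_num)]
  have := intervalIntegral.integral_comp_neg (a := -1) (b := 1)
    fun v : ℝ => (1 - v ^ 2) ^ γ • f v
  simpa using this

namespace IsMonicOrtho

variable {γ : ℝ} [Fact (-1 < γ)] {L : ℕ → Polynomial ℝ}

lemma comp_neg_X (hL : IsMonicOrtho γ L) (n : ℕ) :
    (L n).comp (-Polynomial.X) = Polynomial.C ((-1) ^ n) * L n := by
  have hd : ((L n).comp (-Polynomial.X)).natDegree = n := by
    simp [Polynomial.natDegree_comp, (hL n).2.1]
  have h := hL.eq_C_mul hd.le (fun q hq => by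
    have hq' : (q.comp (-Polynomial.X)).degree < n := by
      refine lt_of_le_of_lt ?_ hq
      by_cases h0 : q.comp (-Polynomial.X) = 0
      · simp [h0]
      have hq0 : q ≠ 0 := by rintro rfl; simp at h0
      rw [Polynomial.degree_eq_natDegree h0, Polynomial.degree_eq_natDegree hq0,
        Polynomial.natDegree_comp]
      simp
    rw [← hL.integral_mul_eq_zero hq', ← integral_angleMeasure_neg]
    simp [Polynomial.eval_comp])
  have hc : ((L n).comp (-Polynomial.X)).coeff n = (-1) ^ n := by
    have := Polynomial.leadingCoeff_comp (p := L n) (q := -Polynomial.X) (by simp)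
    rw [Polynomial.leadingCoeff, hd] at this
    simpa [(hL n).1.leadingCoeff, (hL n).2.1] using this
  rw [h, hc]

lemma eval_neg (hL : IsMonicOrtho γ L) (n : ℕ) (x : ℝ) :
    (L n).eval (-x) = (-1) ^ n * (L n).eval x := by
  have := congrArg (Polynomial.eval x) (hL.comp_neg_X n)
  simpa [Polynomial.eval_comp] using this

lemma integral_sq_pos (hL : IsMonicOrtho γ L) (n : ℕ) :
    0 < ∫ a, (L n).eval (Real.sin a) ^ 2 ∂angleMeasure γ := by
  refine lt_of_le_of_ne (integral_nonneg fun _ => sq_nonneg _) fun h => ?_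
  exact (hL n).1.ne_zero (Polynomial.eq_zero_of_integral_sq_eq_zero h.symm)

end IsMonicOrtho
end

noncomputable section

/-- The multiplier of degree `n` of the averaging operator over chords at angle `φ`. -/
def multiplier (γ : ℝ) (n : ℕ) (φ : ℝ) : ℂ :=
  ∫ v, ((Real.cos φ : ℂ) + (v : ℂ) * (Real.sin φ : ℂ) * Complex.I) ^ n ∂chordMeasure γ

lemma integral_chordMeasure_pow_of_odd (γ : ℝ) {j : ℕ} (hj : Odd j) :
    ∫ v, v ^ j ∂chordMeasure γ = 0 := by
  have := integral_chordMeasure_neg γ fun v => v ^ j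
  simp only [hj.neg_pow, integral_neg] at this
  linarith

lemma multiplier_eq_sum (γ : ℝ) [Fact (-1 < γ)] (l : ℕ) (φ : ℝ) :
    multiplier γ l φ = ∑ j ∈ Finset.range (l + 1), ((l.choose j : ℝ) * Real.cos φ ^ (l - j) *
      Real.sin φ ^ j * ∫ v, v ^ j ∂chordMeasure γ : ℝ) * Complex.I ^ j := by
  have h : ∀ v : ℝ, ((Real.cos φ : ℂ) + (v : ℂ) * (Real.sin φ : ℂ) * Complex.I) ^ l =
      ∑ j ∈ Finset.range (l + 1), ((l.choose j : ℝ) * Real.cos φ ^ (l - j) *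
        Real.sin φ ^ j : ℝ) * Complex.I ^ j * ((v ^ j : ℝ) : ℂ) := by
    intro v
    rw [add_comm, add_pow]
    refine Finset.sum_congr rfl fun j _ => ?_
    push_cast
    ring
  rw [multiplier]
  simp_rw [h]
  rw [integral_finsetSum _ fun i _ => Continuous.integrable_chordMeasure (by fun_prop)]
  refine Finset.sum_congr rfl fun j _ => ?_
  rw [integral_const_mul, integral_complex_ofReal]
  push_cast
  ring

lemma exists_chordAverage_monomial (γ : ℝ) [Fact (-1 < γ)] (l : ℕ) (φ : ℝ) :
    ∃ R : Polynomial ℝ, R.natDegree ≤ l ∧ ((R.coeff l : ℝ) : ℂ) = multiplier γ l φ ∧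
      ∀ a : ℝ, ∫ v, (Real.sin a * Real.cos φ + Real.cos a * v * Real.sin φ) ^ l ∂chordMeasure γ =
        R.eval (Real.sin a) := by
  have hq : (1 - Polynomial.X ^ 2 : Polynomial ℝ).natDegree ≤ 2 := by compute_degree
  refine ⟨∑ j ∈ Finset.range (l + 1), Polynomial.C ((l.choose j : ℝ) * Real.cos φ ^ (l - j) *
      Real.sin φ ^ j * ∫ v, v ^ j ∂chordMeasure γ) *
        (Polynomial.X ^ (l - j) * (1 - Polynomial.X ^ 2) ^ (j / 2)), ?_, ?_, ?_⟩
  · refine Polynomial.natDegree_sum_le_of_forall_le _ _ fun j hj => ?_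
    refine (Polynomial.natDegree_C_mul_le _ _).trans ?_
    refine Polynomial.natDegree_mul_le.trans ?_
    have h1 : ((1 - Polynomial.X ^ 2 : Polynomial ℝ) ^ (j / 2)).natDegree ≤ (j / 2) * 2 :=
      Polynomial.natDegree_pow_le.trans (Nat.mul_le_mul_left _ hq)
    rw [Polynomial.natDegree_X_pow]
    have := Finset.mem_range.1 hj
    omega
  · rw [multiplier_eq_sum, Polynomial.finsetSum_coeff, Complex.ofReal_sum]
    refine Finset.sum_congr rfl fun j hj => ?_
    rcases Nat.even_or_odd' j with ⟨i, rfl | rfl⟩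
    · have hl : l = i * 2 + (l - 2 * i) := by have := Finset.mem_range.1 hj; omega
      rw [Polynomial.coeff_C_mul, Nat.mul_div_cancel_left _ two_pos]
      have hcoef : (Polynomial.X ^ (l - 2 * i) * (1 - Polynomial.X ^ 2) ^ i : Polynomial ℝ).coeff l =
          (-1) ^ i := by
        conv_lhs => rw [hl]
        rw [show i * 2 + (l - 2 * i) - 2 * i = l - 2 * i by omega, Polynomial.coeff_X_pow_mul,
          Polynomial.coeff_pow_of_natDegree_le hq]
        simp [Polynomial.coeff_one]
      rw [hcoef, pow_mul Complex.I, Complex.I_sq]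
      push_cast
      ring
    · simp [integral_chordMeasure_pow_of_odd γ (odd_two_mul_add_one i)]
  · intro a
    have h : ∀ v : ℝ, (Real.sin a * Real.cos φ + Real.cos a * v * Real.sin φ) ^ l =
        ∑ j ∈ Finset.range (l + 1), ((l.choose j : ℝ) * Real.cos φ ^ (l - j) *
          Real.sin φ ^ j * (Real.sin a ^ (l - j) * Real.cos a ^ j)) * v ^ j := by
      intro v
      rw [add_comm, add_pow]
      refine Finset.sum_congr rfl fun j _ => ?_
      ring
    simp_rw [h]
    rw [integral_finsetSum _ fun i _ => Continuous.integrable_chordMeasure (by fun_prop),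
      Polynomial.eval_finsetSum]
    refine Finset.sum_congr rfl fun j _ => ?_
    rw [integral_const_mul]
    rcases Nat.even_or_odd' j with ⟨i, rfl | rfl⟩
    · have : Real.cos a ^ (2 * i) = (1 - Real.sin a ^ 2) ^ i := by
        rw [pow_mul, Real.cos_sq']
      simp [this]
      ring
    · simp [integral_chordMeasure_pow_of_odd γ (odd_two_mul_add_one i)]

lemma exists_chordAverage_eq (γ : ℝ) [Fact (-1 < γ)] (φ : ℝ) {n : ℕ} {p : Polynomial ℝ}
    (hp : p.natDegree ≤ n) :
    ∃ R : Polynomial ℝ, R.natDegree ≤ n ∧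
      ((R.coeff n : ℝ) : ℂ) = p.coeff n * multiplier γ n φ ∧
      ∀ a : ℝ, ∫ v, p.eval (Real.sin a * Real.cos φ + Real.cos a * v * Real.sin φ) ∂chordMeasure γ =
        R.eval (Real.sin a) := by
  choose R hd hc hR using fun l => exists_chordAverage_monomial γ l φ
  refine ⟨∑ l ∈ Finset.range (n + 1), Polynomial.C (p.coeff l) * R l, ?_, ?_, ?_⟩
  · refine Polynomial.natDegree_sum_le_of_forall_le _ _ fun l hl => ?_
    have := Finset.mem_range.1 hl
    exact (Polynomial.natDegree_C_mul_le _ _).trans ((hd l).trans (by omega))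
  · rw [Polynomial.finsetSum_coeff, Finset.sum_eq_single n]
    · rw [Polynomial.coeff_C_mul, Complex.ofReal_mul, hc]
    · intro l hl hne
      have := Finset.mem_range.1 hl
      rw [Polynomial.coeff_C_mul, Polynomial.coeff_eq_zero_of_natDegree_lt (p := R l)
        ((hd l).trans_lt (by omega)), mul_zero]
    · simp
  · intro a
    have h : ∀ x, p.eval x = ∑ l ∈ Finset.range (n + 1), p.coeff l * x ^ l := fun x =>
      Polynomial.eval_eq_sum_range' (Nat.lt_succ_of_le hp) x
    simp_rw [h]
    rw [integral_finsetSum _ fun i _ => Continuous.integrable_chordMeasure (by fun_prop),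
      Polynomial.eval_finsetSum]
    refine Finset.sum_congr rfl fun l _ => ?_
    rw [integral_const_mul, hR]
    simp

lemma re_circle_mul_diskParam (φ a v : ℝ) :
    ((Circle.exp φ : ℂ) * diskParam (a, v)).re =
      Real.sin a * Real.cos (-φ) + Real.cos a * v * Real.sin (-φ) := by
  rw [Circle.coe_exp, Complex.mul_re, Complex.exp_ofReal_mul_I_re, Complex.exp_ofReal_mul_I_im]
  simp only [diskParam, Real.cos_neg, Real.sin_neg]
  ring

namespace IsMonicOrtho

variable {γ : ℝ} [Fact (-1 < γ)] {L : ℕ → Polynomial ℝ}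

/-- Product formula: `L n` is an eigenfunction of the averaging operators over chords. -/
lemma integral_chordMeasure_eval (hL : IsMonicOrtho γ L) (n : ℕ) (φ a : ℝ) :
    ((∫ v, (L n).eval (Real.sin a * Real.cos φ + Real.cos a * v * Real.sin φ)
      ∂chordMeasure γ : ℝ) : ℂ) = multiplier γ n φ * (L n).eval (Real.sin a) := by
  obtain ⟨R, hd, hc, hR⟩ := exists_chordAverage_eq γ φ (hL n).2.1.le
  have hlc : (L n).coeff n = 1 := by
    have := (hL n).1.coeff_natDegree
    rwa [(hL n).2.1] at this
  rw [hlc, Complex.ofReal_one, one_mul] at hc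
  have key := hL.eq_C_mul hd (fun q hq => by
    rcases eq_or_ne q 0 with rfl | hq0
    · simp
    obtain ⟨S, hSd, -, hS⟩ := exists_chordAverage_eq γ (-φ) (le_refl q.natDegree)
    have hSn : S.degree < n := by
      rw [Polynomial.degree_eq_natDegree hq0] at hq
      exact lt_of_le_of_lt Polynomial.degree_le_natDegree
        (lt_of_le_of_lt (by exact_mod_cast hSd) hq)
    have hrot := integral_diskParam_rotation γ
      (fun z => (((L n).eval ((Circle.exp (-φ) : ℂ) * z).re * q.eval z.re : ℝ) : ℂ)) (Circle.exp φ)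
    have hcancel : ∀ z : ℂ, (Circle.exp (-φ) : ℂ) * ((Circle.exp φ : ℂ) * z) = z := by
      intro z
      rw [← mul_assoc, ← Circle.coe_mul, ← Circle.exp_add]
      simp
    simp only [hcancel] at hrot
    rw [integral_complex_ofReal, integral_complex_ofReal, Complex.ofReal_inj,
      integral_prod _ (Continuous.integrable_angle_chord (by fun_prop)),
      integral_prod _ (Continuous.integrable_angle_chord (by fun_prop))] at hrot
    simp only [re_circle_mul_diskParam, neg_neg] at hrot
    simp only [diskParam, integral_const_mul, integral_mul_const, hS, hR] at hrot
    rw [← hrot]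
    exact hL.integral_mul_eq_zero hSn)
  rw [hR, ← hc]
  conv_lhs => rw [key]
  rw [Polynomial.eval_mul, Polynomial.eval_C, Complex.ofReal_mul]

end IsMonicOrtho
end

noncomputable section

lemma factorial_mul_integral_pow_mul_one_sub_pow (a b : ℕ) :
    ((a + b + 1).factorial : ℝ) * ∫ x in (0 : ℝ)..1, x ^ a * (1 - x) ^ b =
      a.factorial * b.factorial := by
  have h := Complex.Gamma_mul_Gamma_eq_betaIntegral (s := (a : ℂ) + 1) (t := (b : ℂ) + 1)
    (by simp; positivity) (by simp; positivity)
  rw [Complex.Gamma_nat_eq_factorial, Complex.Gamma_nat_eq_factorial,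
    show (a : ℂ) + 1 + (b + 1) = ((a + b + 1 : ℕ) : ℂ) + 1 by push_cast; ring,
    Complex.Gamma_nat_eq_factorial, Complex.betaIntegral] at h
  have h2 : ∀ x : ℝ, (x : ℂ) ^ ((a : ℂ) + 1 - 1) * (1 - (x : ℂ)) ^ ((b : ℂ) + 1 - 1) =
      ((x ^ a * (1 - x) ^ b : ℝ) : ℂ) := by
    intro x
    rw [add_sub_cancel_right, add_sub_cancel_right, Complex.cpow_natCast, Complex.cpow_natCast]
    push_cast
    ring
  simp_rw [h2] at h
  rw [intervalIntegral.integral_ofReal] at h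
  exact_mod_cast h.symm

lemma integral_exp_int_mul (m : ℤ) :
    ∫ t in (0 : ℝ)..(2 * π), Complex.exp (Complex.I * m * t) = if m = 0 then 2 * π else 0 := by
  split_ifs with h
  · simp [h]
  · have hc : Complex.I * (m : ℂ) ≠ 0 := by simp [h]
    rw [integral_exp_mul_complex hc]
    have : Complex.exp (Complex.I * m * ((2 * π : ℝ) : ℂ)) = 1 := by
      rw [Complex.exp_eq_one_iff]
      exact ⟨m, by push_cast; ring⟩
    rw [this]
    simp

/-- The coefficient of `exp (I (n - 2 k) φ)` in the trigonometric polynomial `multiplier γ n φ`. -/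
def multiplierCoeff (γ : ℝ) (n k : ℕ) : ℝ :=
  ∫ v, (n.choose k : ℝ) * ((1 + v) / 2) ^ (n - k) * ((1 - v) / 2) ^ k ∂chordMeasure γ

lemma multiplier_eq_sum_exp (γ : ℝ) [Fact (-1 < γ)] (n : ℕ) (φ : ℝ) :
    multiplier γ n φ = ∑ k ∈ Finset.range (n + 1),
      (multiplierCoeff γ n k : ℂ) * Complex.exp (Complex.I * ((n : ℤ) - 2 * (k : ℤ) : ℤ) * φ) := by
  have h : ∀ v : ℝ, ((Real.cos φ : ℂ) + (v : ℂ) * (Real.sin φ : ℂ) * Complex.I) ^ n =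
      ∑ k ∈ Finset.range (n + 1),
        (((n.choose k : ℝ) * ((1 + v) / 2) ^ (n - k) * ((1 - v) / 2) ^ k : ℝ) : ℂ) *
          Complex.exp (Complex.I * ((n : ℤ) - 2 * (k : ℤ) : ℤ) * φ) := by
    intro v
    have e : (Real.cos φ : ℂ) + (v : ℂ) * (Real.sin φ : ℂ) * Complex.I =
        ((1 - v) / 2) * Complex.exp (-(φ * Complex.I)) + ((1 + v) / 2) * Complex.exp (φ * Complex.I) := by
      rw [← neg_mul, Complex.exp_mul_I, Complex.exp_mul_I]
      simp only [Complex.cos_neg, Complex.sin_neg, Complex.ofReal_cos, Complex.ofReal_sin]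
      ring
    rw [e, add_pow]
    refine Finset.sum_congr rfl fun k hk => ?_
    have hk' : k ≤ n := Nat.lt_succ_iff.1 (Finset.mem_range.1 hk)
    have e2 : Complex.exp (Complex.I * ((n : ℤ) - 2 * (k : ℤ) : ℤ) * φ) =
        Complex.exp (-(φ * Complex.I)) ^ k * Complex.exp (φ * Complex.I) ^ (n - k) := by
      rw [← Complex.exp_nat_mul, ← Complex.exp_nat_mul, ← Complex.exp_add]
      congr 1
      push_cast [Nat.cast_sub hk']
      ring
    rw [e2, mul_pow, mul_pow]
    push_cast
    ring
  rw [multiplier]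
  simp_rw [h]
  rw [integral_finsetSum _ fun i _ => Continuous.integrable_chordMeasure (by fun_prop)]
  refine Finset.sum_congr rfl fun k _ => ?_
  rw [integral_mul_const, integral_complex_ofReal]
  rfl

lemma integral_exp_mul_multiplier (γ : ℝ) [Fact (-1 < γ)] {n k : ℕ} (hk : k ≤ n) (t : ℝ) :
    ∫ θ in (0 : ℝ)..(2 * π), Complex.exp (Complex.I * ((n : ℤ) - 2 * (k : ℤ) : ℤ) * θ) *
        multiplier γ n (t - θ) =
      2 * π * multiplierCoeff γ n k * Complex.exp (Complex.I * ((n : ℤ) - 2 * (k : ℤ) : ℤ) * t) := by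
  have h : ∀ θ : ℝ, Complex.exp (Complex.I * ((n : ℤ) - 2 * (k : ℤ) : ℤ) * θ) *
      multiplier γ n (t - θ) = ∑ j ∈ Finset.range (n + 1), (multiplierCoeff γ n j : ℂ) *
        Complex.exp (Complex.I * ((n : ℤ) - 2 * (j : ℤ) : ℤ) * t) *
          Complex.exp (Complex.I * (2 * ((j : ℤ) - (k : ℤ)) : ℤ) * θ) := by
    intro θ
    rw [multiplier_eq_sum_exp, Finset.mul_sum]
    refine Finset.sum_congr rfl fun j _ => ?_
    rw [mul_left_comm, mul_assoc (multiplierCoeff γ n j : ℂ), ← Complex.exp_add, ← Complex.exp_add]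
    congr 2
    push_cast
    ring
  simp_rw [h]
  rw [intervalIntegral.integral_finsetSum fun i _ =>
    Continuous.intervalIntegrable (by fun_prop) _ _]
  rw [Finset.sum_eq_single k]
  · rw [intervalIntegral.integral_const_mul, integral_exp_int_mul]
    simp
    ring
  · intro j _ hj
    rw [intervalIntegral.integral_const_mul, integral_exp_int_mul, if_neg (by omega)]
    simp
  · intro hn
    exact absurd (Finset.mem_range.2 (by omega)) hn

lemma exists_le_multiplierCoeff (γ : ℝ) [Fact (-1 < γ)] :
    ∃ C : ℝ, ∃ K : ℕ, 0 < C ∧ ∀ n k : ℕ, k ≤ n →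
      1 ≤ C * (1 + n : ℝ) ^ K * multiplierCoeff γ n k := by
  obtain ⟨N, hN⟩ := exists_nat_ge γ
  refine ⟨(2 * N + 1 : ℝ) ^ (2 * N + 1), 2 * N + 1, by positivity, fun n k hk => ?_⟩
  have h1 : ∫ v in (-1 : ℝ)..1, (n.choose k : ℝ) * (((1 + v) / 2) ^ (n - k + N) *
      ((1 - v) / 2) ^ (k + N)) ≤ multiplierCoeff γ n k := by
    rw [multiplierCoeff, integral_chordMeasure, intervalIntegral.integral_of_le (by norm_num),
      integral_Ioc_eq_integral_Ioo]
    refine setIntegral_mono_on ?_ ?_ measurableSet_Ioo fun v hv => ?_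
    · exact (Continuous.integrableOn_Icc (by fun_prop)).mono_set Ioo_subset_Icc_self
    · have hc : ContinuousOn (fun v : ℝ => (n.choose k : ℝ) * ((1 + v) / 2) ^ (n - k) *
        ((1 - v) / 2) ^ k) (Icc (-1) 1) := by fun_prop
      have hi := (integrableOn_one_sub_sq_rpow (Fact.out (p := -1 < γ)))
      rw [← integrableOn_Icc_iff_integrableOn_Ioo] at hi ⊢
      exact hi.mul_continuousOn hc isCompact_Icc
    · have hp : 0 ≤ (1 + v) / 2 := by linarith [hv.1]
      have hm : 0 ≤ (1 - v) / 2 := by linarith [hv.2]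
      have hv1 := one_sub_sq_pos hv
      have hle : (1 - v ^ 2) ^ N ≤ (1 - v ^ 2) ^ γ := by
        rw [← Real.rpow_natCast]
        exact Real.rpow_le_rpow_of_exponent_ge hv1 (by nlinarith [sq_nonneg v]) hN
      have h4 : ((1 + v) / 2) ^ N * ((1 - v) / 2) ^ N ≤ (1 - v ^ 2) ^ γ := by
        refine le_trans ?_ hle
        rw [← mul_pow]
        refine pow_le_pow_left₀ (mul_nonneg hp hm) ?_ _
        nlinarith
      calc _ = (((1 + v) / 2) ^ N * ((1 - v) / 2) ^ N) * ((n.choose k : ℝ) *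
            ((1 + v) / 2) ^ (n - k) * ((1 - v) / 2) ^ k) := by ring
        _ ≤ _ := mul_le_mul_of_nonneg_right h4 (by positivity)
  have h2 : ∫ v in (-1 : ℝ)..1, ((1 + v) / 2) ^ (n - k + N) * ((1 - v) / 2) ^ (k + N) =
      2 * ∫ x in (0 : ℝ)..1, x ^ (n - k + N) * (1 - x) ^ (k + N) := by
    have := intervalIntegral.integral_comp_mul_add (a := -1) (b := 1)
      (fun x : ℝ => x ^ (n - k + N) * (1 - x) ^ (k + N)) (c := 1 / 2) (by norm_num) (1 / 2)
    rw [smul_eq_mul] at this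
    norm_num at this
    rw [← this]
    congr 1
    ext v
    ring
  rw [intervalIntegral.integral_const_mul, h2] at h1
  have h3 := factorial_mul_integral_pow_mul_one_sub_pow (n - k + N) (k + N)
  rw [show n - k + N + (k + N) + 1 = n + (2 * N + 1) by omega] at h3
  set J := ∫ x in (0 : ℝ)..1, x ^ (n - k + N) * (1 - x) ^ (k + N)
  have h5 : ((n + (2 * N + 1)).factorial : ℝ) ≤
      n.factorial * ((2 * N + 1) * (1 + n : ℝ)) ^ (2 * N + 1) := by
    rw [← Nat.factorial_mul_ascFactorial, Nat.cast_mul]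
    refine mul_le_mul_of_nonneg_left ?_ (by positivity)
    calc _ ≤ (((n + (2 * N + 1)) ^ (2 * N + 1) : ℕ) : ℝ) := by
          exact_mod_cast Nat.ascFactorial_le_pow_add n (2 * N + 1)
      _ ≤ _ := by
        push_cast
        refine pow_le_pow_left₀ (by positivity) ?_ _
        have : (0 : ℝ) ≤ N * n := by positivity
        nlinarith
  have h6 : (n.factorial : ℝ) ≤ n.choose k * ((n - k + N).factorial * (k + N).factorial) := by
    have : n.choose k * k.factorial * (n - k).factorial = n.factorial :=
      Nat.choose_mul_factorial_mul_factorial hk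
    have h7 : n.factorial ≤ n.choose k * ((n - k + N).factorial * (k + N).factorial) := by
      rw [← this, mul_assoc, mul_comm (k.factorial)]
      gcongr <;> omega
    exact_mod_cast h7
  have hnf : (0 : ℝ) < n.factorial := by positivity
  have hJ : 0 ≤ J := intervalIntegral.integral_nonneg (by norm_num) fun x hx =>
    mul_nonneg (pow_nonneg hx.1 _) (pow_nonneg (by linarith [hx.2]) _)
  rw [← h3] at h6
  have hch : (0 : ℝ) ≤ n.choose k := by positivity
  have h8 : (n.factorial : ℝ) * 1 ≤ n.factorial *
      (((2 * N + 1) * (1 + n : ℝ)) ^ (2 * N + 1) * (n.choose k * J)) := by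
    calc _ ≤ (n.choose k : ℝ) * ((n + (2 * N + 1)).factorial * J) := by linarith
      _ ≤ (n.choose k : ℝ) * ((n.factorial * ((2 * N + 1) * (1 + n : ℝ)) ^ (2 * N + 1)) * J) := by
        gcongr
      _ = _ := by ring
  have h9 := le_of_mul_le_mul_left h8 hnf
  rw [mul_pow] at h9
  refine h9.trans (mul_le_mul_of_nonneg_left ?_ (by positivity))
  nlinarith [mul_nonneg hch hJ]
end

noncomputable section

/-- The signed distance coordinate `-Im (z e^{-iθ})` of the line through `z` at angle `θ`. -/
def lineCoord (θ : ℝ) (z : ℂ) : ℝ := z.re * Real.sin θ - z.im * Real.cos θ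

@[fun_prop]
lemma continuous_lineCoord {X : Type*} [TopologicalSpace X] {f : X → ℝ} {g : X → ℂ}
    (hf : Continuous f) (hg : Continuous g) : Continuous fun x => lineCoord (f x) (g x) := by
  unfold lineCoord
  fun_prop

lemma lineCoord_mem_Icc {z : ℂ} (hz : z ∈ closedBall (0 : ℂ) 1) (θ : ℝ) :
    lineCoord θ z ∈ Icc (-1 : ℝ) 1 := by
  have h1 : z.re ^ 2 + z.im ^ 2 ≤ 1 := by
    have h := Complex.normSq_eq_norm_sq z
    rw [Complex.normSq_apply] at h
    have h2 : ‖z‖ ≤ 1 := by simpa using hz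
    nlinarith [norm_nonneg z]
  rw [mem_Icc, ← abs_le, ← sq_le_one_iff_abs_le_one, lineCoord]
  nlinarith [sq_nonneg (z.re * Real.cos θ + z.im * Real.sin θ), Real.sin_sq_add_cos_sq θ]

/-- Backprojection of `b(θ) P(s)`. -/
def ridgeIntegral (b : ℝ → ℂ) (P : Polynomial ℝ) (z : ℂ) : ℂ :=
  ∫ θ in (0 : ℝ)..(2 * π), b θ * ((P.eval (lineCoord θ z) : ℝ) : ℂ)

/-- The differential of a function on `ℂ` with partial derivatives `u`, `-v`. -/
def gradCLM (u v : ℂ) : ℂ →L[ℝ] ℂ :=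
  u • (Complex.ofRealCLM.comp Complex.reCLM) - v • (Complex.ofRealCLM.comp Complex.imCLM)

lemma hasFDerivAt_ridge (c : ℂ) (θ : ℝ) (P : Polynomial ℝ) (x : ℂ) :
    HasFDerivAt (fun x => c * ((P.eval (lineCoord θ x) : ℝ) : ℂ))
      (gradCLM (c * Real.sin θ * ((P.derivative.eval (lineCoord θ x) : ℝ) : ℂ))
        (c * Real.cos θ * ((P.derivative.eval (lineCoord θ x) : ℝ) : ℂ))) x := by
  have h1 : HasFDerivAt (fun x : ℂ => lineCoord θ x)
      (Real.sin θ • Complex.reCLM - Real.cos θ • Complex.imCLM) x := by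
    have := (Real.sin θ • Complex.reCLM - Real.cos θ • Complex.imCLM).hasFDerivAt (x := x)
    refine this.congr_of_eventuallyEq (Filter.Eventually.of_forall fun y => ?_)
    simp [lineCoord]
    ring
  have h2 := ((P.hasDerivAt (lineCoord θ x)).comp_hasFDerivAt x h1)
  have h3 := (Complex.ofRealCLM.hasFDerivAt.comp x h2).const_mul c
  refine h3.congr_fderiv ?_
  refine ContinuousLinearMap.ext fun v => ?_
  simp [gradCLM]
  ring

lemma hasFDerivAt_intervalIntegral_of_continuous {a b : ℝ} {F : ℂ → ℝ → ℂ}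
    {F' : ℂ → ℝ → ℂ →L[ℝ] ℂ} (hF : ∀ z, Continuous (F z))
    (hF' : Continuous fun q : ℂ × ℝ => F' q.1 q.2) (hd : ∀ z θ, HasFDerivAt (F · θ) (F' z θ) z)
    (z : ℂ) : HasFDerivAt (fun z => ∫ θ in a..b, F z θ) (∫ θ in a..b, F' z θ) z := by
  obtain ⟨C, hC⟩ := ((isCompact_closedBall z 1).prod (isCompact_uIcc (a := a) (b := b)))
    |>.exists_bound_of_continuousOn hF'.continuousOn
  exact intervalIntegral.hasFDerivAt_integral_of_dominated_of_fderiv_le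
    (closedBall_mem_nhds z one_pos)
    (Filter.Eventually.of_forall fun x => (hF x).aestronglyMeasurable)
    ((hF z).intervalIntegrable _ _)
    (hF'.comp (by fun_prop : Continuous fun θ : ℝ => (z, θ))).aestronglyMeasurable
    (Filter.Eventually.of_forall fun θ hθ x hx => hC (x, θ) ⟨hx, uIoc_subset_uIcc hθ⟩)
    intervalIntegrable_const
    (Filter.Eventually.of_forall fun θ _ x _ => hd x θ)

@[fun_prop]
lemma Continuous.gradCLM {X : Type*} [TopologicalSpace X] {u v : X → ℂ} (hu : Continuous u)
    (hv : Continuous v) : Continuous fun x => gradCLM (u x) (v x) := by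
  unfold _root_.gradCLM
  fun_prop

lemma intervalIntegral_gradCLM {a b : ℝ} {u v : ℝ → ℂ} (hu : Continuous u) (hv : Continuous v) :
    ∫ t in a..b, gradCLM (u t) (v t) = gradCLM (∫ t in a..b, u t) (∫ t in a..b, v t) := by
  unfold gradCLM
  rw [intervalIntegral.integral_sub (Continuous.intervalIntegrable (by fun_prop) _ _)
    (Continuous.intervalIntegrable (by fun_prop) _ _), intervalIntegral.integral_smul_const,
    intervalIntegral.integral_smul_const]

lemma hasFDerivAt_ridgeIntegral {b : ℝ → ℂ} (hb : Continuous b) (P : Polynomial ℝ) (z : ℂ) :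
    HasFDerivAt (ridgeIntegral b P)
      (gradCLM (ridgeIntegral (fun θ => b θ * Real.sin θ) P.derivative z)
        (ridgeIntegral (fun θ => b θ * Real.cos θ) P.derivative z)) z := by
  unfold ridgeIntegral
  rw [← intervalIntegral_gradCLM (by fun_prop) (by fun_prop)]
  exact hasFDerivAt_intervalIntegral_of_continuous (fun z => by fun_prop) (by fun_prop)
    (fun z θ => hasFDerivAt_ridge (b θ) θ P z) z

lemma norm_ridgeIntegral_le {b : ℝ → ℂ} {B : ℝ} (hb : ∀ θ, ‖b θ‖ ≤ B) {P : Polynomial ℝ} {M : ℝ}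
    (hP : ∀ x ∈ Icc (-1 : ℝ) 1, |P.eval x| ≤ M) {z : ℂ} (hz : z ∈ closedBall (0 : ℂ) 1) :
    ‖ridgeIntegral b P z‖ ≤ 2 * π * (B * M) := by
  have := intervalIntegral.norm_integral_le_of_norm_le_const (a := 0) (b := 2 * π) (C := B * M)
    (f := fun θ => b θ * ((P.eval (lineCoord θ z) : ℝ) : ℂ)) (fun θ _ => by
      rw [norm_mul, Complex.norm_real, Real.norm_eq_abs]
      exact mul_le_mul (hb θ) (hP _ (lineCoord_mem_Icc hz θ)) (abs_nonneg _)
        ((norm_nonneg _).trans (hb θ)))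
  rw [sub_zero, abs_of_pos Real.two_pi_pos] at this
  rw [ridgeIntegral]
  linarith

lemma norm_gradCLM_le (u v : ℂ) : ‖gradCLM u v‖ ≤ ‖u‖ + ‖v‖ := by
  refine ContinuousLinearMap.opNorm_le_bound _ (by positivity) fun w => ?_
  have h1 := Complex.abs_re_le_norm w
  have h2 := Complex.abs_im_le_norm w
  have e : gradCLM u v w = u * (w.re : ℂ) - v * (w.im : ℂ) := by simp [gradCLM]
  rw [e]
  refine (norm_sub_le _ _).trans ?_
  rw [norm_mul, norm_mul, Complex.norm_real, Complex.norm_real, Real.norm_eq_abs,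
    Real.norm_eq_abs, add_mul]
  gcongr

/-- Termwise differentiation of a series on the closed unit disk. -/
lemma hasFDerivWithinAt_tsum_closedBall {ι : Type*} {f : ι → ℂ → ℂ} {f' : ι → ℂ → ℂ →L[ℝ] ℂ}
    {u v : ι → ℝ} (hu : Summable u) (hv : Summable v) (hf : ∀ i x, HasFDerivAt (f i) (f' i x) x)
    (hc : ∀ i, Continuous (f' i)) (hfu : ∀ i, ∀ x ∈ closedBall (0 : ℂ) 1, ‖f i x‖ ≤ u i)
    (hfv : ∀ i, ∀ x ∈ closedBall (0 : ℂ) 1, ‖f' i x‖ ≤ v i) {x : ℂ}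
    (hx : x ∈ closedBall (0 : ℂ) 1) :
    HasFDerivWithinAt (fun y => ∑' i, f i y) (∑' i, f' i x) (closedBall 0 1) x := by
  have hcl : closure (ball (0 : ℂ) 1) = closedBall 0 1 := closure_ball _ one_ne_zero
  have hfc : ContinuousOn (fun y => ∑' i, f i y) (closedBall 0 1) :=
    continuousOn_tsum (fun i y _ => (hf i y).continuousAt.continuousWithinAt) hu hfu
  have hfc' : ContinuousOn (fun y => ∑' i, f' i y) (closedBall 0 1) :=
    continuousOn_tsum (fun i => (hc i).continuousOn) hv hfv
  have hd : ∀ y ∈ ball (0 : ℂ) 1, HasFDerivAt (fun y => ∑' i, f i y) (∑' i, f' i y) y := by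
    intro y hy
    exact hasFDerivAt_tsum_of_isPreconnected hv isOpen_ball (convex_ball _ _).isPreconnected
      (fun i x _ => hf i x) (fun i x hx => hfv i x (ball_subset_closedBall hx))
      hy (Summable.of_norm_bounded hu fun i => hfu i y (ball_subset_closedBall hy)) hy
  rw [← hcl]
  refine hasFDerivWithinAt_closure_of_tendsto_fderiv
    (fun y hy => (hd y hy).differentiableAt.differentiableWithinAt) (convex_ball _ _) isOpen_ball
    (fun y hy => (hfc y (hcl ▸ hy)).mono ball_subset_closedBall) ?_
  refine Filter.Tendsto.congr' ?_ ((hfc' x hx).mono ball_subset_closedBall)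
  filter_upwards [self_mem_nhdsWithin] with y hy using (hd y hy).fderiv.symm

lemma continuous_ridgeIntegral {b : ℝ → ℂ} (hb : Continuous b) (P : Polynomial ℝ) :
    Continuous (ridgeIntegral b P) :=
  continuous_iff_continuousAt.2 fun z => (hasFDerivAt_ridgeIntegral hb P z).continuousAt

lemma contDiffOn_tsum_ridgeIntegral_nat {ι : Type*} (k : ℕ) : ∀ {b : ι → ℝ → ℂ}
    {P : ι → Polynomial ℝ} {B : ι → ℝ} {M : ℕ → ι → ℝ}, (∀ i, Continuous (b i)) →
    (∀ i θ, ‖b i θ‖ ≤ B i) →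
    (∀ r i, ∀ x ∈ Icc (-1 : ℝ) 1, |(Polynomial.derivative^[r] (P i)).eval x| ≤ M r i) →
    (∀ r, Summable fun i => B i * M r i) →
    ContDiffOn ℝ k (fun z => ∑' i, ridgeIntegral (b i) (P i) z) (closedBall 0 1) := by
  induction k with
  | zero =>
    intro b P B M hb hB hM hs
    rw [Nat.cast_zero, contDiffOn_zero]
    exact continuousOn_tsum (fun i => (continuous_ridgeIntegral (hb i) (P i)).continuousOn)
      ((hs 0).mul_left (2 * π)) fun i z hz => norm_ridgeIntegral_le (hB i) (hM 0 i) hz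
  | succ k ih =>
    intro b P B M hb hB hM hs
    have hB1 : ∀ i θ, ‖b i θ * Real.sin θ‖ ≤ B i := fun i θ => by
      rw [norm_mul, Complex.norm_real, Real.norm_eq_abs]
      exact (mul_le_of_le_one_right (norm_nonneg _) (Real.abs_sin_le_one θ)).trans (hB i θ)
    have hB2 : ∀ i θ, ‖b i θ * Real.cos θ‖ ≤ B i := fun i θ => by
      rw [norm_mul, Complex.norm_real, Real.norm_eq_abs]
      exact (mul_le_of_le_one_right (norm_nonneg _) (Real.abs_cos_le_one θ)).trans (hB i θ)
    have hc1 : ∀ i, Continuous fun θ => b i θ * Real.sin θ := fun i => by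
      have := hb i
      fun_prop
    have hc2 : ∀ i, Continuous fun θ => b i θ * Real.cos θ := fun i => by
      have := hb i
      fun_prop
    have hM' : ∀ r i, ∀ x ∈ Icc (-1 : ℝ) 1,
        |(Polynomial.derivative^[r] (P i).derivative).eval x| ≤ M (r + 1) i := fun r i x hx => by
      simpa only [Function.iterate_succ_apply] using hM (r + 1) i x hx
    have h1 := ih hc1 hB1 hM' fun r => hs (r + 1)
    have h2 := ih hc2 hB2 hM' fun r => hs (r + 1)
    have hn1 := fun i z hz => norm_ridgeIntegral_le (hB1 i) (hM' 0 i) (z := z) hz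
    have hn2 := fun i z hz => norm_ridgeIntegral_le (hB2 i) (hM' 0 i) (z := z) hz
    have hu : UniqueDiffOn ℝ (closedBall (0 : ℂ) 1) :=
      uniqueDiffOn_convex (convex_closedBall _ _) ⟨0, by simp [interior_closedBall]⟩
    rw [Nat.cast_succ, contDiffOn_succ_iff_hasFDerivWithinAt_of_uniqueDiffOn hu]
    refine ⟨by simp, fun z => gradCLM
      (∑' i, ridgeIntegral (fun θ => b i θ * Real.sin θ) (P i).derivative z)
      (∑' i, ridgeIntegral (fun θ => b i θ * Real.cos θ) (P i).derivative z), ?_, fun z hz => ?_⟩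
    · unfold gradCLM
      exact (h1.smul contDiffOn_const).sub (h2.smul contDiffOn_const)
    · have key := hasFDerivWithinAt_tsum_closedBall ((hs 0).mul_left (2 * π))
        (((hs 1).mul_left (2 * π)).add ((hs 1).mul_left (2 * π)))
        (fun i x => hasFDerivAt_ridgeIntegral (hb i) (P i) x)
        (fun i => by
          have g1 := continuous_ridgeIntegral (hc1 i) (P i).derivative
          have g2 := continuous_ridgeIntegral (hc2 i) (P i).derivative
          unfold gradCLM
          fun_prop)
        (fun i x hx => norm_ridgeIntegral_le (hB i) (hM 0 i) hx)
        (fun i x hx => (norm_gradCLM_le _ _).trans (add_le_add (hn1 i x hx) (hn2 i x hx))) hz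
      refine key.congr_fderiv ?_
      have s1 : Summable fun i => ridgeIntegral (fun θ => b i θ * Real.sin θ) (P i).derivative z :=
        Summable.of_norm_bounded ((hs 1).mul_left (2 * π)) fun i => hn1 i z hz
      have s2 : Summable fun i => ridgeIntegral (fun θ => b i θ * Real.cos θ) (P i).derivative z :=
        Summable.of_norm_bounded ((hs 1).mul_left (2 * π)) fun i => hn2 i z hz
      unfold gradCLM
      rw [(s1.smul_const _).tsum_sub (s2.smul_const _), s1.tsum_smul_const, s2.tsum_smul_const]

lemma contDiffOn_tsum_ridgeIntegral {ι : Type*} {b : ι → ℝ → ℂ}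
    {P : ι → Polynomial ℝ} {B : ι → ℝ} {M : ℕ → ι → ℝ} (hb : ∀ i, Continuous (b i))
    (hB : ∀ i θ, ‖b i θ‖ ≤ B i)
    (hM : ∀ r i, ∀ x ∈ Icc (-1 : ℝ) 1, |(Polynomial.derivative^[r] (P i)).eval x| ≤ M r i)
    (hs : ∀ r, Summable fun i => B i * M r i) :
    ContDiffOn ℝ (⊤ : ℕ∞) (fun z => ∑' i, ridgeIntegral (b i) (P i) z) (closedBall 0 1) :=
  contDiffOn_infty.2 fun k => contDiffOn_tsum_ridgeIntegral_nat k hb hB hM hs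
end

noncomputable section

/-- The unnormalised Fourier coefficient `∫₀^{2π} e^{-imt} G(t) dt`. -/
def periodCoeff (G : ℝ → ℂ) (m : ℤ) : ℂ :=
  ∫ t in (0 : ℝ)..(2 * π), Complex.exp (-(Complex.I * m * t)) * G t

lemma norm_exp_neg_I_mul (m : ℤ) (t : ℝ) : ‖Complex.exp (-(Complex.I * m * t))‖ = 1 := by
  have : -(Complex.I * m * t) = ((-(m * t) : ℝ) : ℂ) * Complex.I := by push_cast; ring
  rw [this, Complex.norm_exp_ofReal_mul_I]

lemma exp_neg_I_mul_periodic (m : ℤ) :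
    Function.Periodic (fun t : ℝ => Complex.exp (-(Complex.I * m * t))) (2 * π) := by
  intro t
  have : -(Complex.I * m * ((t + 2 * π : ℝ) : ℂ)) =
      -(Complex.I * m * t) + ((-m : ℤ) : ℂ) * (2 * π * Complex.I) := by push_cast; ring
  simp only [this, Complex.exp_add, Complex.exp_int_mul_two_pi_mul_I, mul_one]

lemma norm_periodCoeff_le {G : ℝ → ℂ} {M : ℝ} (hM : ∀ t, ‖G t‖ ≤ M) (m : ℤ) :
    ‖periodCoeff G m‖ ≤ 2 * π * M := by
  have := intervalIntegral.norm_integral_le_of_norm_le_const (a := 0) (b := 2 * π)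
    (f := fun t : ℝ => Complex.exp (-(Complex.I * m * t)) * G t) (C := M) (fun t _ => by
      rw [norm_mul, norm_exp_neg_I_mul, one_mul]; exact hM t)
  rw [sub_zero, abs_of_pos Real.two_pi_pos] at this
  rw [periodCoeff]
  linarith

lemma periodCoeff_deriv {G : ℝ → ℂ} (hG : ContDiff ℝ (⊤ : ℕ∞) G)
    (hp : Function.Periodic G (2 * π)) (m : ℤ) :
    periodCoeff (deriv G) m = Complex.I * m * periodCoeff G m := by
  have hd : ∀ t, HasDerivAt G (deriv G t) t := fun t =>
    (hG.differentiable (by simp)).differentiableAt.hasDerivAt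
  have hc : Continuous (deriv G) := hG.continuous_deriv (by simp)
  have he : ∀ t : ℝ, HasDerivAt (fun t : ℝ => Complex.exp (-(Complex.I * m * t)))
      (Complex.exp (-(Complex.I * m * t)) * -(Complex.I * m)) t := by
    intro t
    have h1 : HasDerivAt (fun t : ℝ => -(Complex.I * m * (t : ℂ))) (-(Complex.I * m)) t := by
      have h2 := ((Complex.ofRealCLM.hasDerivAt (x := t)).const_mul (-(Complex.I * m)))
      simp only [Complex.ofRealCLM_apply, Complex.ofReal_one, mul_one, neg_mul] at h2
      exact h2
    exact h1.cexp
  have h := intervalIntegral.integral_mul_deriv_eq_deriv_mul (a := 0) (b := 2 * π)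
    (fun t _ => he t) (fun t _ => hd t)
    (Continuous.intervalIntegrable (by fun_prop) _ _) (hc.intervalIntegrable _ _)
  rw [periodCoeff, h]
  have h1 := exp_neg_I_mul_periodic m 0
  have h2 := hp 0
  rw [zero_add] at h1 h2
  simp only at h1
  rw [h1, h2, sub_self, zero_sub, periodCoeff, ← intervalIntegral.integral_const_mul,
    ← intervalIntegral.integral_neg]
  congr 1 with t
  ring

lemma periodic_deriv {G : ℝ → ℂ} {c : ℝ} (hp : Function.Periodic G c) :
    Function.Periodic (deriv G) c := by
  intro t
  rw [← deriv_comp_add_const]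
  congr 1
  ext s
  exact hp s

lemma periodCoeff_iteratedDeriv {G : ℝ → ℂ} (hG : ContDiff ℝ (⊤ : ℕ∞) G)
    (hp : Function.Periodic G (2 * π)) (m : ℤ) (r : ℕ) :
    periodCoeff (iteratedDeriv r G) m = (Complex.I * m) ^ r * periodCoeff G m := by
  induction r generalizing G with
  | zero => simp
  | succ r ih =>
    have hG' : ContDiff ℝ (⊤ : ℕ∞) (deriv G) := (contDiff_infty_iff_deriv.1 hG).2
    rw [iteratedDeriv_succ', ih hG' (periodic_deriv hp), periodCoeff_deriv hG hp]
    ring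

lemma norm_periodCoeff_mul_le {G : ℝ → ℂ} (hG : ContDiff ℝ (⊤ : ℕ∞) G)
    (hp : Function.Periodic G (2 * π)) {M : ℝ} {r : ℕ} (hM : ∀ t, ‖iteratedDeriv r G t‖ ≤ M)
    (m : ℤ) : |(m : ℝ)| ^ r * ‖periodCoeff G m‖ ≤ 2 * π * M := by
  have h := norm_periodCoeff_le hM m
  rw [periodCoeff_iteratedDeriv hG hp] at h
  simpa using h

lemma hasSum_periodCoeff {G : ℝ → ℂ} (hG : Continuous G) (hp : Function.Periodic G (2 * π))
    (hs : Summable (periodCoeff G)) (t : ℝ) :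
    HasSum (fun m : ℤ => (2 * π : ℂ)⁻¹ * periodCoeff G m * Complex.exp (Complex.I * m * t))
      (G t) := by
  have : Fact (0 < 2 * π) := ⟨Real.two_pi_pos⟩
  let F : C(AddCircle (2 * π), ℂ) := ⟨hp.lift, continuous_coinduced_dom.mpr hG⟩
  have hπ : (π : ℂ) ≠ 0 := by exact_mod_cast Real.pi_ne_zero
  have hexp : ∀ (m : ℤ) (t : ℝ), fourier m (t : AddCircle (2 * π)) =
      Complex.exp (Complex.I * m * t) := by
    intro m t
    rw [fourier_coe_apply]
    congr 1
    push_cast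
    field_simp
  have hF : ∀ m, fourierCoeff F m = (2 * π : ℂ)⁻¹ * periodCoeff G m := by
    intro m
    rw [fourierCoeff_eq_intervalIntegral _ m 0, zero_add, periodCoeff, Complex.real_smul]
    congr 1
    · push_cast; simp
    · refine intervalIntegral.integral_congr fun t _ => ?_
      simp only [hexp, smul_eq_mul]
      congr 1
      congr 1
      push_cast
      ring
  have hS : Summable (fourierCoeff F) := by
    have : fourierCoeff F = fun m => (2 * π : ℂ)⁻¹ * periodCoeff G m := funext hF
    rw [this]
    exact hs.mul_left _
  have h := has_pointwise_sum_fourier_series_of_summable hS (t : AddCircle (2 * π))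
  simp only [hF, smul_eq_mul, hexp] at h
  exact h

lemma eq_zero_of_periodCoeff_eq_zero {G : ℝ → ℂ} (hG : Continuous G)
    (hp : Function.Periodic G (2 * π)) (h0 : ∀ m, periodCoeff G m = 0) (t : ℝ) : G t = 0 := by
  have hs : Summable (periodCoeff G) := by
    rw [show periodCoeff G = fun _ => 0 from funext h0]
    exact summable_zero
  have h := hasSum_periodCoeff hG hp hs t
  simp only [h0, mul_zero, zero_mul] at h
  exact h.unique hasSum_zero

lemma periodCoeff_comp_add {G : ℝ → ℂ} (hp : Function.Periodic G (2 * π)) (m : ℤ) (c : ℝ) :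
    periodCoeff (fun t => G (t + c)) m = Complex.exp (Complex.I * m * c) * periodCoeff G m := by
  have h1 : ∀ t : ℝ, Complex.exp (-(Complex.I * m * t)) * G (t + c) =
      Complex.exp (Complex.I * m * c) *
        (Complex.exp (-(Complex.I * m * ((t + c : ℝ) : ℂ))) * G (t + c)) := by
    intro t
    rw [← mul_assoc, ← Complex.exp_add]
    congr 2
    push_cast
    ring
  rw [periodCoeff]
  simp_rw [h1]
  rw [intervalIntegral.integral_const_mul, intervalIntegral.integral_comp_add_right
    (fun t : ℝ => Complex.exp (-(Complex.I * m * (t : ℂ))) * G t)]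
  have hper : Function.Periodic (fun t : ℝ => Complex.exp (-(Complex.I * m * (t : ℂ))) * G t)
    (2 * π) := fun t => by
      have := exp_neg_I_mul_periodic m t
      simp only at this
      simp only [this, hp t]
  have := hper.intervalIntegral_add_eq c 0
  rw [zero_add, add_comm (2 * π) c] at *
  rw [this]
  rfl

lemma norm_exp_I_mul_int (m : ℤ) (t : ℝ) : ‖Complex.exp (Complex.I * m * t)‖ = 1 := by
  have : (Complex.I * m * t) = (((m * t) : ℝ) : ℂ) * Complex.I := by push_cast; ring
  rw [this, Complex.norm_exp_ofReal_mul_I]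

/-- Symmetrisation of `e^{ijα}` under `α ↦ π - α`. -/
def symExp (j : ℤ) (α : ℝ) : ℂ :=
  (Complex.exp (Complex.I * j * α) + Complex.exp (Complex.I * j * ((π - α : ℝ) : ℂ))) / 2

lemma symExp_eq (j : ℤ) (α : ℝ) : symExp j α = Complex.exp (Complex.I * j * ((π / 2 : ℝ) : ℂ)) *
    (((Polynomial.Chebyshev.T ℝ j).eval (Real.sin α) : ℝ) : ℂ) := by
  rw [← Real.cos_pi_div_two_sub α, Polynomial.Chebyshev.T_real_cos, Complex.ofReal_cos,
    Complex.cos, symExp, mul_div_assoc', mul_add, ← Complex.exp_add, ← Complex.exp_add, add_comm]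
  congr 3 <;> push_cast <;> ring

lemma norm_symExp_le (j : ℤ) (α : ℝ) : ‖symExp j α‖ ≤ 1 := by
  rw [symExp, norm_div]
  have := norm_add_le (Complex.exp (Complex.I * j * α))
    (Complex.exp (Complex.I * j * ((π - α : ℝ) : ℂ)))
  rw [norm_exp_I_mul_int, norm_exp_I_mul_int] at this
  rw [Complex.norm_ofNat]
  linarith

@[fun_prop]
lemma continuous_symExp (j : ℤ) : Continuous (symExp j) := by unfold symExp; fun_prop

end

noncomputable section

lemma norm_integral_mul_eval_le {γ : ℝ} [Fact (-1 < γ)] {n r : ℕ} (hn : 1 ≤ n)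
    {P : Polynomial ℝ} (hP : ∀ q : Polynomial ℝ, q.degree < n →
      ∫ a, P.eval (Real.sin a) * q.eval (Real.sin a) ∂angleMeasure γ = 0)
    {G : ℝ → ℂ} (hG : ContDiff ℝ (⊤ : ℕ∞) G) (hp : Function.Periodic G (2 * π))
    (hsym : ∀ t, G (π - t) = G t) {M : ℝ} (hM : ∀ t, ‖iteratedDeriv (r + 2) G t‖ ≤ M) :
    ‖∫ a, G a * ((P.eval (Real.sin a) : ℝ) : ℂ) ∂angleMeasure γ‖ * (n : ℝ) ^ r ≤
      (∑' j : ℤ, 1 / (j : ℝ) ^ 2) * M * ∫ a, |P.eval (Real.sin a)| ∂angleMeasure γ := by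
  have hM0 : 0 ≤ M := (norm_nonneg _).trans (hM 0)
  have hn0 : (0 : ℝ) < n := by exact_mod_cast hn
  have hZ : Summable fun j : ℤ => 1 / (j : ℝ) ^ 2 :=
    Real.summable_one_div_int_pow.2 one_lt_two
  have hb : ∀ j : ℤ, j ≠ 0 → ‖(2 * π : ℂ)⁻¹ * periodCoeff G j‖ ≤ M / |(j : ℝ)| ^ (r + 2) := by
    intro j hj
    have hj' : 0 < |(j : ℝ)| := abs_pos.2 (by exact_mod_cast hj)
    have := norm_periodCoeff_mul_le hG hp hM j
    rw [le_div_iff₀ (by positivity), norm_mul, norm_inv, norm_mul, Complex.norm_real,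
      Real.norm_of_nonneg pi_pos.le, Complex.norm_ofNat, mul_assoc,
      inv_mul_le_iff₀ (by positivity)]
    linarith
  have hb2 : ∀ j : ℤ, ‖(2 * π : ℂ)⁻¹ * periodCoeff G j‖ ≤
      M * (1 / (j : ℝ) ^ 2) + (if j = 0 then ‖(2 * π : ℂ)⁻¹ * periodCoeff G 0‖ else 0) := by
    intro j
    split_ifs with h
    · subst h; simp
    · refine (hb j h).trans ?_
      rw [add_zero, ← sq_abs, mul_one_div]
      have hj1 : 1 ≤ |(j : ℝ)| := by exact_mod_cast Int.one_le_abs h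
      have := pow_le_pow_right₀ hj1 (by omega : 2 ≤ r + 2)
      gcongr
  have hsumm : Summable fun j : ℤ => ‖(2 * π : ℂ)⁻¹ * periodCoeff G j‖ := by
    refine Summable.of_nonneg_of_le (fun _ => norm_nonneg _) hb2 ((hZ.mul_left M).add ?_)
    exact (hasSum_ite_eq (0 : ℤ) _).summable
  have hpi : (2 * π : ℂ) ≠ 0 := by
    have : (π : ℂ) ≠ 0 := by exact_mod_cast Real.pi_ne_zero
    simp [this]
  have hs : Summable (periodCoeff G) := by
    have h := hsumm.of_norm.mul_left (2 * π : ℂ)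
    refine h.congr fun j => ?_
    rw [mul_inv_cancel_left₀ hpi]
  have hsum : ∀ t, HasSum (fun j : ℤ => (2 * π : ℂ)⁻¹ * periodCoeff G j * symExp j t) (G t) := by
    intro t
    have h1 := hasSum_periodCoeff hG.continuous hp hs t
    have h2 := hasSum_periodCoeff hG.continuous hp hs (π - t)
    rw [hsym] at h2
    have h3 := (h1.add h2).div_const 2
    rw [add_self_div_two] at h3
    refine h3.congr_fun fun j => ?_
    rw [symExp]
    push_cast
    ring
  set s : Finset ℤ := Finset.Ioo (-(n : ℤ)) n with hsdef
  set R : ℝ → ℂ := fun t => G t - ∑ j ∈ s, (2 * π : ℂ)⁻¹ * periodCoeff G j * symExp j t with hR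
  have hRc : Continuous R := by
    have := hG.continuous
    fun_prop
  have hRb : ∀ t, ‖R t‖ ≤ (∑' j : ℤ, 1 / (j : ℝ) ^ 2) * M / (n : ℝ) ^ r := by
    intro t
    have h1 : HasSum (fun j : ℤ => if j ∈ s then 0 else
        (2 * π : ℂ)⁻¹ * periodCoeff G j * symExp j t) (R t) := by
      have h := (hsum t).sub (hasSum_sum_of_ne_finset_zero (s := s) (f := fun j : ℤ => if j ∈ s then
        (2 * π : ℂ)⁻¹ * periodCoeff G j * symExp j t else 0) (fun j hj => by simp [hj]))
      rw [Finset.sum_congr rfl (fun j hj => if_pos hj)] at h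
      refine h.congr_fun fun j => ?_
      split_ifs <;> simp
    rw [← h1.tsum_eq]
    have h2 : HasSum (fun j : ℤ => 1 / (j : ℝ) ^ 2 * M / (n : ℝ) ^ r)
        ((∑' j : ℤ, 1 / (j : ℝ) ^ 2) * M / (n : ℝ) ^ r) := (hZ.hasSum.mul_right M).div_const _
    refine tsum_of_norm_bounded h2 fun j => ?_
    split_ifs with hj
    · rw [norm_zero]; positivity
    · have hj' : (n : ℤ) ≤ |j| := by
        rw [hsdef, Finset.mem_Ioo, ← abs_lt] at hj
        omega
      have hj'' : (n : ℝ) ≤ |(j : ℝ)| := by exact_mod_cast hj'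
      have hj0 : j ≠ 0 := by
        rintro rfl
        simp at hj'
        omega
      rw [norm_mul]
      calc _ ≤ ‖(2 * π : ℂ)⁻¹ * periodCoeff G j‖ * 1 := by gcongr; exact norm_symExp_le j t
        _ ≤ M / |(j : ℝ)| ^ (r + 2) := by rw [mul_one]; exact hb j hj0
        _ = 1 / (j : ℝ) ^ 2 * M / |(j : ℝ)| ^ r := by
          rw [pow_add, ← sq_abs (j : ℝ)]
          field_simp
        _ ≤ 1 / (j : ℝ) ^ 2 * M / (n : ℝ) ^ r := by gcongr
  have hzero : ∀ j ∈ s, ∫ a, symExp j a * ((P.eval (Real.sin a) : ℝ) : ℂ) ∂angleMeasure γ = 0 := by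
    intro j hj
    have h1 : ∀ a, symExp j a * ((P.eval (Real.sin a) : ℝ) : ℂ) =
        Complex.exp (Complex.I * j * ((π / 2 : ℝ) : ℂ)) * ((P.eval (Real.sin a) *
          (Polynomial.Chebyshev.T ℝ j).eval (Real.sin a) : ℝ) : ℂ) := by
      intro a
      rw [symExp_eq]
      push_cast
      ring
    simp_rw [h1]
    rw [integral_const_mul, integral_complex_ofReal, hP, Complex.ofReal_zero, mul_zero]
    rw [Polynomial.Chebyshev.degree_T]
    rw [hsdef, Finset.mem_Ioo] at hj
    exact_mod_cast (by omega : j.natAbs < n)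
  have hquot : ∫ a, G a * ((P.eval (Real.sin a) : ℝ) : ℂ) ∂angleMeasure γ =
      ∫ a, R a * ((P.eval (Real.sin a) : ℝ) : ℂ) ∂angleMeasure γ := by
    have h1 : ∀ a, R a * ((P.eval (Real.sin a) : ℝ) : ℂ) = G a * ((P.eval (Real.sin a) : ℝ) : ℂ) -
        ∑ j ∈ s, (2 * π : ℂ)⁻¹ * periodCoeff G j *
          (symExp j a * ((P.eval (Real.sin a) : ℝ) : ℂ)) := by
      intro a
      rw [hR]
      simp only [sub_mul, Finset.sum_mul, mul_assoc]
    have hGc := hG.continuous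
    simp_rw [h1]
    rw [integral_sub (Continuous.integrable_angleMeasure (by fun_prop))
      (Continuous.integrable_angleMeasure (by fun_prop)), integral_finsetSum _ fun i _ =>
      Continuous.integrable_angleMeasure (by fun_prop), Finset.sum_eq_zero, sub_zero]
    intro j hj
    rw [integral_const_mul, hzero j hj, mul_zero]
  rw [hquot, ← le_div_iff₀ (by positivity)]
  refine (norm_integral_le_integral_norm _).trans ?_
  have h3 : ∫ a, ‖R a * ((P.eval (Real.sin a) : ℝ) : ℂ)‖ ∂angleMeasure γ ≤
      ∫ a, (∑' j : ℤ, 1 / (j : ℝ) ^ 2) * M / (n : ℝ) ^ r * |P.eval (Real.sin a)|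
        ∂angleMeasure γ := by
    refine integral_mono (Continuous.integrable_angleMeasure (by fun_prop))
      (Continuous.integrable_angleMeasure (by fun_prop)) fun a => ?_
    simp only [norm_mul, Complex.norm_real, Real.norm_eq_abs]
    gcongr
    exact hRb a
  refine h3.trans_eq ?_
  rw [integral_const_mul]
  ring

namespace IsMonicOrtho

variable {γ : ℝ} [Fact (-1 < γ)] {L : ℕ → Polynomial ℝ}

lemma exists_norm_integral_mul_eval_le (hL : IsMonicOrtho γ L) (r : ℕ) :
    ∃ C : ℝ, 0 ≤ C ∧ ∀ (G : ℝ → ℂ) (M : ℝ), ContDiff ℝ (⊤ : ℕ∞) G →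
      Function.Periodic G (2 * π) → (∀ t, G (π - t) = G t) → (∀ t, ‖G t‖ ≤ M) →
      (∀ t, ‖iteratedDeriv (r + 2) G t‖ ≤ M) → ∀ n,
      ‖∫ a, G a * (((L n).eval (Real.sin a) : ℝ) : ℂ) ∂angleMeasure γ‖ * (1 + n : ℝ) ^ r ≤
        C * M * ∫ a, |(L n).eval (Real.sin a)| ∂angleMeasure γ := by
  have hZ : 0 ≤ ∑' j : ℤ, 1 / (j : ℝ) ^ 2 := tsum_nonneg fun _ => by positivity
  refine ⟨1 + 2 ^ r * ∑' j : ℤ, 1 / (j : ℝ) ^ 2, by positivity, ?_⟩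
  intro G M hG hp hsym hM0 hM n
  have hMp : 0 ≤ M := (norm_nonneg _).trans (hM0 0)
  have hI : 0 ≤ ∫ a, |(L n).eval (Real.sin a)| ∂angleMeasure γ :=
    integral_nonneg fun _ => abs_nonneg _
  rcases Nat.eq_zero_or_pos n with rfl | hn
  · simp only [Nat.cast_zero, add_zero, one_pow, mul_one]
    refine (norm_integral_le_integral_norm _).trans ?_
    have hGc := hG.continuous
    have : ∫ a, ‖G a * (((L 0).eval (Real.sin a) : ℝ) : ℂ)‖ ∂angleMeasure γ ≤
        ∫ a, M * |(L 0).eval (Real.sin a)| ∂angleMeasure γ := by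
      refine integral_mono (Continuous.integrable_angleMeasure (by fun_prop))
        (Continuous.integrable_angleMeasure (by fun_prop)) fun a => ?_
      simp only [norm_mul, Complex.norm_real, Real.norm_eq_abs]
      gcongr
      exact hM0 a
    refine this.trans ?_
    rw [integral_const_mul]
    gcongr
    exact le_mul_of_one_le_left hMp (le_add_of_nonneg_right (by positivity))
  · have h := norm_integral_mul_eval_le (r := r) hn (fun q hq => hL.integral_mul_eq_zero hq)
      hG hp hsym hM
    have hn1 : (1 : ℝ) ≤ n := by exact_mod_cast hn
    calc _ ≤ ‖∫ a, G a * (((L n).eval (Real.sin a) : ℝ) : ℂ) ∂angleMeasure γ‖ *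
          (2 * n : ℝ) ^ r := by gcongr; linarith
      _ = 2 ^ r * (‖∫ a, G a * (((L n).eval (Real.sin a) : ℝ) : ℂ) ∂angleMeasure γ‖ *
          (n : ℝ) ^ r) := by rw [mul_pow]; ring
      _ ≤ 2 ^ r * ((∑' j : ℤ, 1 / (j : ℝ) ^ 2) * M *
          ∫ a, |(L n).eval (Real.sin a)| ∂angleMeasure γ) := by gcongr
      _ = 2 ^ r * (∑' j : ℤ, 1 / (j : ℝ) ^ 2) *
          (M * ∫ a, |(L n).eval (Real.sin a)| ∂angleMeasure γ) := by ring
      _ ≤ (1 + 2 ^ r * ∑' j : ℤ, 1 / (j : ℝ) ^ 2) *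
          (M * ∫ a, |(L n).eval (Real.sin a)| ∂angleMeasure γ) := by
        gcongr; linarith
      _ = _ := by ring

/-- A polynomially weighted bound for `L n` on `[-1, 1]` in terms of its weighted norm. -/
lemma exists_abs_eval_mul_integral_le (hL : IsMonicOrtho γ L) :
    ∃ C : ℝ, ∃ K : ℕ, ∃ S : ℕ → ℝ, 0 ≤ C ∧ (∀ n, ∀ x ∈ Icc (-1 : ℝ) 1, |(L n).eval x| ≤ S n) ∧
      ∀ n, (∫ a, |(L n).eval (Real.sin a)| ∂angleMeasure γ) * S n ≤
        C * (1 + n : ℝ) ^ K * ∫ a, (L n).eval (Real.sin a) ^ 2 ∂angleMeasure γ := by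
  obtain ⟨C, K, hC, h⟩ := exists_sq_eval_le_integral_angleMeasure γ
  set N : ℕ → ℝ := fun n => ∫ a, (L n).eval (Real.sin a) ^ 2 ∂angleMeasure γ with hN
  have hNn : ∀ n, 0 < N n := fun n => hL.integral_sq_pos n
  set S : ℕ → ℝ := fun n => Real.sqrt (C * (1 + n : ℝ) ^ K * N n) with hS
  have hSb : ∀ n, ∀ x ∈ Icc (-1 : ℝ) 1, |(L n).eval x| ≤ S n := by
    intro n x hx
    exact Real.abs_le_sqrt (h n (L n) (hL n).2.1.le x hx)
  refine ⟨C * (angleMeasure γ).real univ, K, S, by positivity, hSb, ?_⟩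
  intro n
  have h1 : ∫ a, |(L n).eval (Real.sin a)| ∂angleMeasure γ ≤ (angleMeasure γ).real univ * S n := by
    have : ∫ a, |(L n).eval (Real.sin a)| ∂angleMeasure γ ≤ ∫ _, S n ∂angleMeasure γ :=
      integral_mono (Continuous.integrable_angleMeasure (by fun_prop)) (integrable_const _)
        fun a => hSb n _ ⟨Real.neg_one_le_sin a, Real.sin_le_one a⟩
    simpa using this
  have hS0 : 0 ≤ S n := Real.sqrt_nonneg _
  have hSS : S n * S n = C * (1 + n : ℝ) ^ K * N n :=
    Real.mul_self_sqrt (by have := hNn n; positivity)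
  calc _ ≤ (angleMeasure γ).real univ * S n * S n := by gcongr
    _ = (angleMeasure γ).real univ * (S n * S n) := by ring
    _ = _ := by rw [hSS]; ring

end IsMonicOrtho

end

noncomputable section

/-- Smooth functions of (direction, angle), doubly `2π`-periodic and invariant under
`α ↦ π - α`. -/
structure IsSmoothSymmetric (H : ℝ × ℝ → ℂ) : Prop where
  contDiff : ContDiff ℝ (⊤ : ℕ∞) H
  periodic_fst : ∀ θ α, H (θ + 2 * π, α) = H (θ, α)
  periodic_snd : ∀ θ α, H (θ, α + 2 * π) = H (θ, α)
  symm : ∀ θ α, H (θ, π - α) = H (θ, α)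

lemma exists_bound_of_periodic {H : ℝ × ℝ → ℂ} (hc : Continuous H)
    (h1 : ∀ θ α, H (θ + 2 * π, α) = H (θ, α)) (h2 : ∀ θ α, H (θ, α + 2 * π) = H (θ, α)) :
    ∃ M, ∀ p, ‖H p‖ ≤ M := by
  obtain ⟨M, hM⟩ := ((isCompact_Icc (a := (0 : ℝ)) (b := 2 * π)).prod
    (isCompact_Icc (a := (0 : ℝ)) (b := 2 * π))).exists_bound_of_continuousOn hc.continuousOn
  refine ⟨M, fun p => ?_⟩
  have e1 : Function.Periodic (fun θ => H (θ, p.2)) (2 * π) := fun θ => h1 θ p.2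
  obtain ⟨θ, hθ, h3⟩ := e1.exists_mem_Ico₀ Real.two_pi_pos p.1
  have e2 : Function.Periodic (fun α => H (θ, α)) (2 * π) := fun α => h2 θ α
  obtain ⟨α, hα, h4⟩ := e2.exists_mem_Ico₀ Real.two_pi_pos p.2
  have : H p = H (θ, α) := h3.trans h4
  rw [this]
  exact hM _ ⟨Ico_subset_Icc_self hθ, Ico_subset_Icc_self hα⟩

lemma exists_bound_iteratedDeriv {H : ℝ × ℝ → ℂ} (hc : ContDiff ℝ (⊤ : ℕ∞) H)
    (h1 : ∀ θ α, H (θ + 2 * π, α) = H (θ, α)) (h2 : ∀ θ α, H (θ, α + 2 * π) = H (θ, α)) (r : ℕ) :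
    ∃ M, ∀ θ t, ‖iteratedDeriv r (fun α => H (θ, α)) t‖ ≤ M := by
  induction r generalizing H with
  | zero =>
    obtain ⟨M, hM⟩ := exists_bound_of_periodic hc.continuous h1 h2
    exact ⟨M, fun θ t => by simpa using hM (θ, t)⟩
  | succ r ih =>
    have hd : ∀ θ, deriv (fun α => H (θ, α)) = fun α => fderiv ℝ H (θ, α) (0, 1) := by
      intro θ
      ext α
      have ha : HasDerivAt (fun α : ℝ => (θ, α)) ((0 : ℝ), (1 : ℝ)) α :=
        (hasDerivAt_const α θ).prodMk (hasDerivAt_id α)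
      exact ((hc.differentiable (by simp)).differentiableAt.hasFDerivAt.comp_hasDerivAt α ha).deriv
    have hc' : ContDiff ℝ (⊤ : ℕ∞) fun p => fderiv ℝ H p (0, 1) :=
      (hc.fderiv_right (m := (⊤ : ℕ∞)) (by simp)).clm_apply contDiff_const
    obtain ⟨M, hM⟩ := ih hc' (fun θ α => by
        have : (fun α => H (θ + 2 * π, α)) = fun α => H (θ, α) := funext (h1 θ)
        have h3 := congrFun (hd (θ + 2 * π)) α
        rw [this, hd θ] at h3
        exact h3.symm) (fun θ α => by
        have hp : Function.Periodic (fun α => H (θ, α)) (2 * π) := fun α => h2 θ α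
        have := periodic_deriv hp α
        rwa [hd θ] at this)
    refine ⟨M, fun θ t => ?_⟩
    rw [iteratedDeriv_succ', hd]
    exact hM θ t

variable {γ : ℝ} [Fact (-1 < γ)] {L : ℕ → Polynomial ℝ} {H : ℝ × ℝ → ℂ}

/-- The moment in the angle variable against `L n (sin α)`. -/
def angleMoment (γ : ℝ) (L : ℕ → Polynomial ℝ) (H : ℝ × ℝ → ℂ) (n : ℕ) (θ : ℝ) : ℂ :=
  ∫ a, H (θ, a) * (((L n).eval (Real.sin a) : ℝ) : ℂ) ∂angleMeasure γ

lemma continuous_angleMoment {M : ℝ} (hH : Continuous H) (hM : ∀ p, ‖H p‖ ≤ M) (n : ℕ) :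
    Continuous (angleMoment γ L H n) := by
  refine continuous_of_dominated (bound := fun a => M * |(L n).eval (Real.sin a)|)
    (fun θ => ?_) (fun θ => ?_) ?_ ?_
  · exact (by fun_prop : Continuous fun a =>
      H (θ, a) * (((L n).eval (Real.sin a) : ℝ) : ℂ)).aestronglyMeasurable
  · refine Filter.Eventually.of_forall fun a => ?_
    rw [norm_mul, Complex.norm_real, Real.norm_eq_abs]
    gcongr
    exact hM _
  · exact Continuous.integrable_angleMeasure (by fun_prop)
  · exact Filter.Eventually.of_forall fun a => by fun_prop

/-- The expansion coefficient against `e^{imθ} L n (sin α)`. -/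
def expansionCoeff (γ : ℝ) (L : ℕ → Polynomial ℝ) (H : ℝ × ℝ → ℂ) (n : ℕ) (m : ℤ) : ℂ :=
  (2 * π : ℂ)⁻¹ * periodCoeff (angleMoment γ L H n) m /
    ((∫ a, (L n).eval (Real.sin a) ^ 2 ∂angleMeasure γ : ℝ) : ℂ)

lemma IsMonicOrtho.exists_norm_expansionCoeff_le (hL : IsMonicOrtho γ L)
    (hH : IsSmoothSymmetric H) :
    ∃ S : ℕ → ℝ, (∀ n, ∀ x ∈ Icc (-1 : ℝ) 1, |(L n).eval x| ≤ S n) ∧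
      ∀ r : ℕ, ∃ C, ∀ n m, ‖expansionCoeff γ L H n m‖ * S n * (1 + n : ℝ) ^ r ≤ C := by
  obtain ⟨C, K, S, hC, hS, hSI⟩ := hL.exists_abs_eval_mul_integral_le
  refine ⟨S, hS, fun r => ?_⟩
  have hS0 : ∀ n, 0 ≤ S n := fun n => (abs_nonneg _).trans (hS n 0 (by norm_num))
  obtain ⟨D, hD, hdec⟩ := hL.exists_norm_integral_mul_eval_le (r + K)
  obtain ⟨M1, hM1⟩ := exists_bound_of_periodic hH.contDiff.continuous hH.periodic_fst
    hH.periodic_snd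
  obtain ⟨M2, hM2⟩ := exists_bound_iteratedDeriv hH.contDiff hH.periodic_fst
    hH.periodic_snd (r + K + 2)
  have hM0 : 0 ≤ max M1 M2 := (norm_nonneg _).trans ((hM1 0).trans (le_max_left _ _))
  refine ⟨D * max M1 M2 * C, fun n m => ?_⟩
  set N := ∫ a, (L n).eval (Real.sin a) ^ 2 ∂angleMeasure γ with hN
  have hNp : 0 < N := hL.integral_sq_pos n
  have hn : (0 : ℝ) < (1 + n : ℝ) := by positivity
  set I1 := ∫ a, |(L n).eval (Real.sin a)| ∂angleMeasure γ with hI1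
  have hG : ∀ θ, ‖angleMoment γ L H n θ‖ ≤ D * max M1 M2 * I1 / (1 + n : ℝ) ^ (r + K) := by
    intro θ
    rw [le_div_iff₀ (by positivity)]
    exact hdec (fun α => H (θ, α)) (max M1 M2)
      (hH.contDiff.comp (contDiff_const.prodMk contDiff_id)) (hH.periodic_snd θ) (hH.symm θ)
      (fun t => (hM1 _).trans (le_max_left _ _)) (fun t => (hM2 θ t).trans (le_max_right _ _)) n
  have h1 : ‖expansionCoeff γ L H n m‖ ≤
      D * max M1 M2 * I1 / (1 + n : ℝ) ^ (r + K) / N := by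
    rw [expansionCoeff, norm_div, Complex.norm_real, Real.norm_of_nonneg hNp.le]
    gcongr
    rw [norm_mul, norm_inv, norm_mul, Complex.norm_real,
      Real.norm_of_nonneg pi_pos.le, Complex.norm_ofNat,
      inv_mul_le_iff₀ (by positivity)]
    exact norm_periodCoeff_le hG m
  calc _ ≤ D * max M1 M2 * I1 / (1 + n : ℝ) ^ (r + K) / N * S n * (1 + n : ℝ) ^ r := by
        gcongr
        exact hS0 n
    _ = D * max M1 M2 / (1 + n : ℝ) ^ (r + K) / N * (1 + n : ℝ) ^ r * (I1 * S n) := by ring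
    _ ≤ D * max M1 M2 / (1 + n : ℝ) ^ (r + K) / N * (1 + n : ℝ) ^ r *
        (C * (1 + n : ℝ) ^ K * N) := by
        have := hSI n
        gcongr
    _ = D * max M1 M2 * C := by
        rw [pow_add]
        field_simp

lemma IsMonicOrtho.integral_mul_eval_eq_zero (hL : IsMonicOrtho γ L) {g : ℝ → ℝ}
    (hg : Continuous g)
    (h0 : ∀ n, ∫ a, g a * (L n).eval (Real.sin a) ∂angleMeasure γ = 0) (d : ℕ) :
    ∀ q : Polynomial ℝ, q.degree < d →
      ∫ a, g a * q.eval (Real.sin a) ∂angleMeasure γ = 0 := by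
  induction d with
  | zero =>
    intro q hq
    have : q = 0 := Polynomial.ext fun m => by
      simpa using (Polynomial.degree_lt_iff_coeff_zero q 0).1 hq m (Nat.zero_le _)
    simp [this]
  | succ d ih =>
    intro q hq
    have hlt : (q - Polynomial.C (q.coeff d) * L d).degree < d := by
      rw [Polynomial.degree_lt_iff_coeff_zero]
      intro m hm
      rw [Polynomial.coeff_sub, Polynomial.coeff_C_mul]
      rcases hm.eq_or_lt with rfl | hm
      · have h1 := (hL d).1.coeff_natDegree
        rw [(hL d).2.1] at h1
        rw [h1]
        ring
      · rw [Polynomial.coeff_eq_zero_of_natDegree_lt ((hL d).2.1.trans_lt hm),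
          Polynomial.coeff_eq_zero_of_degree_lt (hq.trans_le (by exact_mod_cast hm))]
        ring
    have h1 := ih _ hlt
    have h2 : ∀ a, g a * (q - Polynomial.C (q.coeff d) * L d).eval (Real.sin a) =
        g a * q.eval (Real.sin a) - q.coeff d * (g a * (L d).eval (Real.sin a)) := by
      intro a
      simp only [Polynomial.eval_sub, Polynomial.eval_mul, Polynomial.eval_C]
      ring
    simp_rw [h2] at h1
    rw [integral_sub (Continuous.integrable_angleMeasure (by fun_prop))
      (Continuous.integrable_angleMeasure (by fun_prop)), integral_const_mul, h0, mul_zero,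
      sub_zero] at h1
    exact h1

lemma IsMonicOrtho.eq_zero_of_real_moment_eq_zero (hL : IsMonicOrtho γ L) {g : ℝ → ℝ}
    (hg : Continuous g)
    (h0 : ∀ n, ∫ a, g a * (L n).eval (Real.sin a) ∂angleMeasure γ = 0) :
    ∀ a ∈ Ioo (-(π / 2)) (π / 2), g a = 0 := by
  have hq : ∀ q : Polynomial ℝ, ∫ a, g a * q.eval (Real.sin a) ∂angleMeasure γ = 0 := fun q =>
    hL.integral_mul_eval_eq_zero hg h0 _ q
      (Polynomial.degree_le_natDegree.trans_lt (by exact_mod_cast q.natDegree.lt_succ_self))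
  set J := ∫ a, |g a| ∂angleMeasure γ with hJ
  have hJ0 : 0 ≤ J := integral_nonneg fun _ => abs_nonneg _
  have hle : ∀ ε > 0, ∫ a, g a ^ 2 ∂angleMeasure γ ≤ ε * J := by
    intro ε hε
    obtain ⟨p, hp⟩ := exists_polynomial_near_of_continuousOn (-1) 1 (fun x => g (Real.arcsin x))
      (by fun_prop) ε hε
    have h1 : ∫ a, g a ^ 2 ∂angleMeasure γ =
        ∫ a, g a * (g a - p.eval (Real.sin a)) ∂angleMeasure γ := by
      simp_rw [mul_sub, ← sq]
      rw [integral_sub (Continuous.integrable_angleMeasure (by fun_prop))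
        (Continuous.integrable_angleMeasure (by fun_prop)), hq, sub_zero]
    rw [h1, hJ, ← integral_const_mul]
    refine integral_mono_ae (Continuous.integrable_angleMeasure (by fun_prop))
      (Continuous.integrable_angleMeasure (by fun_prop)) ?_
    filter_upwards [angleMeasure_ae γ] with a ha
    have h2 := hp (Real.sin a) ⟨Real.neg_one_le_sin a, Real.sin_le_one a⟩
    rw [Real.arcsin_sin ha.1.le ha.2.le, abs_sub_comm] at h2
    calc g a * (g a - p.eval (Real.sin a)) ≤ |g a * (g a - p.eval (Real.sin a))| := le_abs_self _
      _ = |g a - p.eval (Real.sin a)| * |g a| := by rw [abs_mul, mul_comm]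
      _ ≤ ε * |g a| := by gcongr
  have hz : ∫ a, g a ^ 2 ∂angleMeasure γ = 0 := by
    refine le_antisymm (le_of_forall_pos_le_add fun δ hδ => ?_)
      (integral_nonneg fun _ => sq_nonneg _)
    refine (hle (δ / (J + 1)) (by positivity)).trans ?_
    rw [zero_add, div_mul_eq_mul_div, div_le_iff₀ (by positivity)]
    nlinarith
  rw [integral_angleMeasure, integral_eq_zero_iff_of_nonneg_ae] at hz
  · have h3 : g =ᵐ[volume.restrict (Ioo (-(π / 2)) (π / 2))] fun _ => 0 := by
      filter_upwards [hz, ae_restrict_mem measurableSet_Ioo] with a ha ha'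
      have hc := Real.rpow_pos_of_pos (Real.cos_pos_of_mem_Ioo ha') (2 * γ + 2)
      simpa [hc.ne'] using ha
    exact Measure.eqOn_open_of_ae_eq h3 isOpen_Ioo hg.continuousOn continuousOn_const
  · filter_upwards [ae_restrict_mem measurableSet_Ioo] with a ha
    have hc := Real.rpow_pos_of_pos (Real.cos_pos_of_mem_Ioo ha) (2 * γ + 2)
    simp only [Pi.zero_apply, smul_eq_mul]
    positivity
  · have := (Continuous.integrable_angleMeasure (γ := γ) (by fun_prop :
      Continuous fun a => g a ^ 2))
    rw [angleMeasure, integrable_withDensity_iff_integrable_smul' (by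
      exact (measurable_cos_rpow _).ennreal_ofReal) (by simp)] at this
    refine this.congr ?_
    filter_upwards [ae_restrict_mem measurableSet_Ioo] with a ha
    rw [ENNReal.toReal_ofReal (Real.rpow_nonneg (Real.cos_pos_of_mem_Ioo ha).le _)]

/-- A continuous function of the angle, all of whose moments vanish, vanishes. -/
lemma IsMonicOrtho.eq_zero_of_moment_eq_zero (hL : IsMonicOrtho γ L) {g : ℝ → ℂ}
    (hg : Continuous g)
    (h0 : ∀ n, ∫ a, g a * (((L n).eval (Real.sin a) : ℝ) : ℂ) ∂angleMeasure γ = 0) :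
    ∀ a ∈ Ioo (-(π / 2)) (π / 2), g a = 0 := by
  have hi : ∀ n, Integrable (fun a => g a * (((L n).eval (Real.sin a) : ℝ) : ℂ))
    (angleMeasure γ) := fun n => Continuous.integrable_angleMeasure (by fun_prop)
  intro a ha
  apply Complex.ext
  · refine hL.eq_zero_of_real_moment_eq_zero (g := fun a => (g a).re) (by fun_prop)
      (fun n => ?_) a ha
    have := Complex.reCLM.integral_comp_comm (hi n)
    rw [h0] at this
    simpa using this
  · refine hL.eq_zero_of_real_moment_eq_zero (g := fun a => (g a).im) (by fun_prop)
      (fun n => ?_) a ha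
    have := Complex.imCLM.integral_comp_comm (hi n)
    rw [h0] at this
    simpa using this

end

noncomputable section

/-- The point with parameter `v ∈ [-1, 1]` on the chord in direction `θ` at angle `α`. -/
def chordPoint (θ α v : ℝ) : ℂ :=
  ((Real.sin α * Real.sin θ - Real.cos α * v * Real.cos θ : ℝ) : ℂ) -
    ((Real.sin α * Real.cos θ + Real.cos α * v * Real.sin θ : ℝ) : ℂ) * Complex.I

@[fun_prop]
lemma continuous_chordPoint {X : Type*} [TopologicalSpace X] {f g h : X → ℝ} (hf : Continuous f)
    (hg : Continuous g) (hh : Continuous h) : Continuous fun x => chordPoint (f x) (g x) (h x) := by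
  unfold chordPoint
  fun_prop

lemma norm_chordPoint_sq (θ α v : ℝ) :
    ‖chordPoint θ α v‖ ^ 2 = 1 - Real.cos α ^ 2 * (1 - v ^ 2) := by
  rw [← Complex.normSq_eq_norm_sq, Complex.normSq_apply]
  simp only [chordPoint, Complex.sub_re, Complex.sub_im, Complex.mul_re, Complex.mul_im,
    Complex.ofReal_re, Complex.ofReal_im, Complex.I_re, Complex.I_im]
  nlinarith [Real.sin_sq_add_cos_sq α, Real.sin_sq_add_cos_sq θ]

lemma chordPoint_mem_closedBall (θ α : ℝ) {v : ℝ} (hv : v ∈ Icc (-1 : ℝ) 1) :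
    chordPoint θ α v ∈ closedBall (0 : ℂ) 1 := by
  rw [mem_closedBall_zero_iff, ← sq_le_one_iff₀ (norm_nonneg _), norm_chordPoint_sq]
  have : 0 ≤ 1 - v ^ 2 := by nlinarith [hv.1, hv.2]
  have := mul_nonneg (sq_nonneg (Real.cos α)) this
  linarith

lemma lineCoord_chordPoint (θ t α v : ℝ) : lineCoord θ (chordPoint t α v) =
    Real.sin α * Real.cos (t - θ) + Real.cos α * v * Real.sin (t - θ) := by
  simp only [lineCoord, chordPoint, Complex.sub_re, Complex.sub_im, Complex.mul_re, Complex.mul_im,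
    Complex.ofReal_re, Complex.ofReal_im, Complex.I_re, Complex.I_im, Real.cos_sub, Real.sin_sub]
  ring

lemma integrable_prod_chordMeasure {γ : ℝ} [Fact (-1 < γ)] {a b : ℝ} {f : ℝ × ℝ → ℂ}
    (hf : Continuous f) : Integrable f ((volume.restrict (uIoc a b)).prod (chordMeasure γ)) := by
  have h := hf.continuousOn.integrableOn_compact
    (μ := (volume.restrict (uIoc a b)).prod (chordMeasure γ))
    ((isCompact_uIcc (a := a) (b := b)).prod (isCompact_Icc (a := (-1 : ℝ)) (b := 1)))
  have h1 : (volume.restrict (uIoc a b)).restrict (uIcc a b) = volume.restrict (uIoc a b) :=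
    Measure.restrict_eq_self_of_ae_mem (by
      filter_upwards [ae_restrict_mem measurableSet_uIoc] with v hv using uIoc_subset_uIcc hv)
  have h2 : (chordMeasure γ).restrict (Icc (-1) 1) = chordMeasure γ :=
    Measure.restrict_eq_self_of_ae_mem (by
      filter_upwards [chordMeasure_ae γ] with v hv using Ioo_subset_Icc_self hv)
  rwa [IntegrableOn, ← Measure.prod_restrict, h1, h2] at h

variable {γ : ℝ} [Fact (-1 < γ)] {L : ℕ → Polynomial ℝ}

lemma IsMonicOrtho.integral_ridgeIntegral (hL : IsMonicOrtho γ L) {n k : ℕ} (hk : k ≤ n) (c : ℂ)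
    (t α : ℝ) :
    ∫ v, ridgeIntegral (fun θ => c * Complex.exp (Complex.I * ((n : ℤ) - 2 * (k : ℤ) : ℤ) * θ))
      (L n) (chordPoint t α v) ∂chordMeasure γ =
      c * (2 * π * multiplierCoeff γ n k) *
        Complex.exp (Complex.I * ((n : ℤ) - 2 * (k : ℤ) : ℤ) * t) *
        (((L n).eval (Real.sin α) : ℝ) : ℂ) := by
  unfold ridgeIntegral
  rw [← intervalIntegral_integral_swap (integrable_prod_chordMeasure (by
    simp only [Function.uncurry_def]; fun_prop))]
  have h : ∀ θ : ℝ, ∫ v, c * Complex.exp (Complex.I * ((n : ℤ) - 2 * (k : ℤ) : ℤ) * θ) *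
      (((L n).eval (lineCoord θ (chordPoint t α v)) : ℝ) : ℂ) ∂chordMeasure γ =
      c * (((L n).eval (Real.sin α) : ℝ) : ℂ) *
        (Complex.exp (Complex.I * ((n : ℤ) - 2 * (k : ℤ) : ℤ) * θ) * multiplier γ n (t - θ)) := by
    intro θ
    rw [integral_const_mul, integral_complex_ofReal]
    simp_rw [lineCoord_chordPoint]
    rw [hL.integral_chordMeasure_eval n (t - θ) α]
    ring
  simp_rw [h]
  rw [intervalIntegral.integral_const_mul, integral_exp_mul_multiplier γ hk]
  ring

lemma summable_sigma_of_le {u : (Σ n : ℕ, Fin (n + 1)) → ℝ} {C : ℝ} (h0 : ∀ i, 0 ≤ u i)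
    (h : ∀ i, u i * (1 + i.1 : ℝ) ^ 3 ≤ C) : Summable u := by
  have h1 : ∀ i, u i ≤ C / (1 + i.1 : ℝ) ^ 3 := fun i => by
    rw [le_div_iff₀ (by positivity)]; exact h i
  refine Summable.of_nonneg_of_le h0 h1 ?_
  have hC : 0 ≤ C := by
    refine le_trans ?_ (h ⟨0, 0⟩)
    have := h0 ⟨0, 0⟩
    positivity
  rw [summable_sigma_of_nonneg fun i => by positivity]
  refine ⟨fun n => (hasSum_fintype _).summable, ?_⟩
  have h2 : ∀ n : ℕ, ∑' _ : Fin (n + 1), C / (1 + n : ℝ) ^ 3 = C * (1 / ((n + 1 : ℕ) : ℝ) ^ 2) := by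
    intro n
    rw [tsum_fintype, Finset.sum_const, Finset.card_univ, Fintype.card_fin, nsmul_eq_mul]
    push_cast
    have : (1 + n : ℝ) ≠ 0 := by positivity
    have h3 : (n + 1 : ℝ) ≠ 0 := by positivity
    rw [add_comm (1 : ℝ)]
    field_simp
  simp_rw [h2]
  exact ((summable_nat_add_iff 1).2 (Real.summable_one_div_nat_pow.2 one_lt_two)).mul_left C

/-- The frequency `n - 2k`. -/
def freq (i : Σ n : ℕ, Fin (n + 1)) : ℤ := (i.1 : ℤ) - 2 * ((i.2 : ℕ) : ℤ)

/-- The terms of the expansion over frequencies `n - 2k`, `0 ≤ k ≤ n`. -/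
def seriesTerm (L : ℕ → Polynomial ℝ) (A : ℕ → ℤ → ℂ) (θ α : ℝ) (i : Σ n : ℕ, Fin (n + 1)) : ℂ :=
  A i.1 (freq i) * Complex.exp (Complex.I * freq i * θ) *
    (((L i.1).eval (Real.sin α) : ℝ) : ℂ)

variable {A : ℕ → ℤ → ℂ} {S : ℕ → ℝ}

lemma norm_seriesTerm_le (hS : ∀ n, ∀ x ∈ Icc (-1 : ℝ) 1, |(L n).eval x| ≤ S n) (θ α : ℝ)
    (i : Σ n : ℕ, Fin (n + 1)) : ‖seriesTerm L A θ α i‖ ≤ ‖A i.1 (freq i)‖ * S i.1 := by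
  rw [seriesTerm, norm_mul, norm_mul, norm_exp_I_mul_int, mul_one, Complex.norm_real,
    Real.norm_eq_abs]
  gcongr
  exact hS _ _ ⟨Real.neg_one_le_sin α, Real.sin_le_one α⟩

lemma exists_smooth_chord_integral_eq_tsum (hL : IsMonicOrtho γ L)
    (hS : ∀ n, ∀ x ∈ Icc (-1 : ℝ) 1, |(L n).eval x| ≤ S n)
    (hA : ∀ r : ℕ, ∃ C, ∀ n m, ‖A n m‖ * S n * (1 + n : ℝ) ^ r ≤ C) :
    ∃ f : ℂ → ℂ, CinfDisk f ∧ ∀ θ α,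
      ∫ v, f (chordPoint θ α v) ∂chordMeasure γ = ∑' i, seriesTerm L A θ α i := by
  have hS0 : ∀ n, 0 ≤ S n := fun n => (abs_nonneg _).trans (hS n 0 (by norm_num))
  obtain ⟨C1, K1, hC1, hlam⟩ := exists_le_multiplierCoeff γ
  have hlam0 : ∀ i : Σ n : ℕ, Fin (n + 1), 0 < multiplierCoeff γ i.1 i.2 := by
    intro i
    have h := hlam i.1 i.2 (Nat.lt_succ_iff.1 i.2.2)
    by_contra! h0
    have : C1 * (1 + i.1 : ℝ) ^ K1 * multiplierCoeff γ i.1 i.2 ≤ 0 :=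
      mul_nonpos_of_nonneg_of_nonpos (by positivity) h0
    linarith
  set c : (Σ n : ℕ, Fin (n + 1)) → ℂ := fun i =>
    A i.1 (freq i) / (2 * π * multiplierCoeff γ i.1 i.2 : ℝ) with hc
  set b : (Σ n : ℕ, Fin (n + 1)) → ℝ → ℂ := fun i θ =>
    c i * Complex.exp (Complex.I * freq i * θ) with hb
  set B : (Σ n : ℕ, Fin (n + 1)) → ℝ := fun i =>
    ‖A i.1 (freq i)‖ * (C1 * (1 + i.1 : ℝ) ^ K1) with hB
  set M : ℕ → (Σ n : ℕ, Fin (n + 1)) → ℝ := fun r i => (2 * (i.1 : ℝ) ^ 2) ^ r * S i.1 with hM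
  have hbB : ∀ i θ, ‖b i θ‖ ≤ B i := by
    intro i θ
    have h := hlam i.1 i.2 (Nat.lt_succ_iff.1 i.2.2)
    have hl := hlam0 i
    rw [hb, hc, hB]
    simp only
    rw [norm_mul, norm_exp_I_mul_int, mul_one, norm_div, Complex.norm_real,
      Real.norm_of_nonneg (by positivity), div_le_iff₀ (by positivity), mul_assoc]
    refine le_mul_of_one_le_right (norm_nonneg _) ?_
    calc (1 : ℝ) ≤ 1 * (C1 * (1 + i.1 : ℝ) ^ K1 * multiplierCoeff γ i.1 i.2) := by rwa [one_mul]
      _ ≤ (2 * π) * (C1 * (1 + i.1 : ℝ) ^ K1 * multiplierCoeff γ i.1 i.2) := by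
        gcongr
        linarith [Real.pi_gt_three]
      _ = _ := by ring
  have hMb : ∀ r i, ∀ x ∈ Icc (-1 : ℝ) 1,
      |(Polynomial.derivative^[r] (L i.1)).eval x| ≤ M r i := fun r i =>
    Polynomial.abs_eval_iterate_derivative_le (hL i.1).2.1.le (hS i.1) r
  have hsum : ∀ r, Summable fun i => B i * M r i := by
    intro r
    obtain ⟨C, hC⟩ := hA (K1 + 2 * r + 3)
    refine summable_sigma_of_le (C := C1 * 2 ^ r * C) (fun i => ?_) fun i => ?_
    · have := hS0 i.1
      positivity
    · have h1 := hC i.1 (freq i)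
      have hs := hS0 i.1
      calc B i * M r i * (1 + i.1 : ℝ) ^ 3
          ≤ ‖A i.1 (freq i)‖ * (C1 * (1 + i.1 : ℝ) ^ K1) *
            ((2 * (1 + i.1 : ℝ) ^ 2) ^ r * S i.1) * (1 + i.1 : ℝ) ^ 3 := by
            simp only [hB, hM]
            gcongr
            linarith
        _ = C1 * 2 ^ r * (‖A i.1 (freq i)‖ * S i.1 * (1 + i.1 : ℝ) ^ (K1 + 2 * r + 3)) := by
            rw [mul_pow, ← pow_mul, pow_add, pow_add]
            ring
        _ ≤ _ := by gcongr
  have hbc : ∀ i, Continuous (b i) := fun i => by fun_prop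
  refine ⟨fun z => ∑' i, ridgeIntegral (b i) (L i.1) z,
    contDiffOn_tsum_ridgeIntegral hbc hbB hMb hsum, fun θ α => ?_⟩
  have hcont := fun i => continuous_ridgeIntegral (hbc i) (L i.1)
  have hterm : ∀ i, ∫ v, ridgeIntegral (b i) (L i.1) (chordPoint θ α v) ∂chordMeasure γ =
      seriesTerm L A θ α i := by
    intro i
    have hl : (multiplierCoeff γ i.1 i.2 : ℂ) ≠ 0 := by exact_mod_cast (hlam0 i).ne'
    have hpi : (π : ℂ) ≠ 0 := by exact_mod_cast Real.pi_ne_zero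
    have := hL.integral_ridgeIntegral (Nat.lt_succ_iff.1 i.2.2) (c i) θ α
    rw [show b i = fun θ : ℝ => c i * Complex.exp (Complex.I *
      (((i.1 : ℤ) - 2 * ((i.2 : ℕ) : ℤ) : ℤ) : ℂ) * θ) from rfl, this, seriesTerm, hc]
    simp only [freq]
    push_cast
    field_simp
  simp_rw [← hterm]
  refine (integral_tsum_of_summable_integral_norm
    (fun i => Continuous.integrable_chordMeasure (by have := hcont i; fun_prop)) ?_).symm
  refine Summable.of_nonneg_of_le (fun i => integral_nonneg fun _ => norm_nonneg _)
    (fun i => ?_) ((hsum 0).mul_left (2 * π * (chordMeasure γ).real univ))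
  have h : ∫ v, ‖ridgeIntegral (b i) (L i.1) (chordPoint θ α v)‖ ∂chordMeasure γ ≤
      ∫ _, 2 * π * (B i * M 0 i) ∂chordMeasure γ := by
    refine integral_mono_ae (Continuous.integrable_chordMeasure (by have := hcont i; fun_prop))
      (integrable_const _) ?_
    filter_upwards [chordMeasure_ae γ] with v hv
    exact norm_ridgeIntegral_le (hbB i) (hMb 0 i)
      (chordPoint_mem_closedBall θ α (Ioo_subset_Icc_self hv))
  refine h.trans_eq ?_
  rw [integral_const, smul_eq_mul]
  ring

end

noncomputable section

lemma IsSmoothSymmetric.periodic_angleMoment {γ : ℝ} {L : ℕ → Polynomial ℝ} {H : ℝ × ℝ → ℂ}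
    (hH : IsSmoothSymmetric H) (n : ℕ) :
    Function.Periodic (angleMoment γ L H n) (2 * π) := fun θ => by
  simp only [angleMoment, hH.periodic_fst]

variable {γ : ℝ} [Fact (-1 < γ)] {L : ℕ → Polynomial ℝ} {H : ℝ × ℝ → ℂ}
  {A : ℕ → ℤ → ℂ} {S : ℕ → ℝ}

lemma summable_norm_mul_of_decay (hS : ∀ n, ∀ x ∈ Icc (-1 : ℝ) 1, |(L n).eval x| ≤ S n)
    (hA : ∀ r : ℕ, ∃ C, ∀ n m, ‖A n m‖ * S n * (1 + n : ℝ) ^ r ≤ C) :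
    Summable fun i => ‖A i.1 (freq i)‖ * S i.1 := by
  obtain ⟨C, hC⟩ := hA 3
  refine summable_sigma_of_le (fun i => ?_) fun i => hC i.1 (freq i)
  exact mul_nonneg (norm_nonneg _) ((abs_nonneg _).trans (hS i.1 0 (by norm_num)))

lemma IsMonicOrtho.integral_mul_eq_zero_of_ne (hL : IsMonicOrtho γ L) {m n : ℕ} (h : m ≠ n) :
    ∫ a, (L m).eval (Real.sin a) * (L n).eval (Real.sin a) ∂angleMeasure γ = 0 := by
  have key : ∀ {m n : ℕ}, m < n →
      ∫ a, (L n).eval (Real.sin a) * (L m).eval (Real.sin a) ∂angleMeasure γ = 0 := by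
    intro m n h
    refine hL.integral_mul_eq_zero ?_
    rw [Polynomial.degree_eq_natDegree (hL m).1.ne_zero, (hL m).2.1]
    exact_mod_cast h
  rcases h.lt_or_gt with h | h
  · simp_rw [mul_comm ((L m).eval _)]
    exact key h
  · exact key h

lemma continuous_tsum_seriesTerm (hS : ∀ n, ∀ x ∈ Icc (-1 : ℝ) 1, |(L n).eval x| ≤ S n)
    (hA : ∀ r : ℕ, ∃ C, ∀ n m, ‖A n m‖ * S n * (1 + n : ℝ) ^ r ≤ C) (θ : ℝ) :
    Continuous fun α => ∑' i, seriesTerm L A θ α i :=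
  continuous_tsum (fun i => by unfold seriesTerm; fun_prop) (summable_norm_mul_of_decay hS hA)
    fun i α => norm_seriesTerm_le hS θ α i

lemma IsMonicOrtho.integral_tsum_seriesTerm (hL : IsMonicOrtho γ L)
    (hS : ∀ n, ∀ x ∈ Icc (-1 : ℝ) 1, |(L n).eval x| ≤ S n)
    (hA : ∀ r : ℕ, ∃ C, ∀ n m, ‖A n m‖ * S n * (1 + n : ℝ) ^ r ≤ C) (θ : ℝ) (n : ℕ) :
    ∫ a, (∑' i, seriesTerm L A θ a i) * (((L n).eval (Real.sin a) : ℝ) : ℂ) ∂angleMeasure γ =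
      (∑ k : Fin (n + 1), A n (freq ⟨n, k⟩) * Complex.exp (Complex.I * freq ⟨n, k⟩ * θ)) *
        ((∫ a, (L n).eval (Real.sin a) ^ 2 ∂angleMeasure γ : ℝ) : ℂ) := by
  have hu := summable_norm_mul_of_decay hS hA
  have hs0 : ∀ n, 0 ≤ S n := fun n => (abs_nonneg _).trans (hS n 0 (by norm_num))
  have hc : ∀ i, Continuous fun a =>
      seriesTerm L A θ a i * (((L n).eval (Real.sin a) : ℝ) : ℂ) := fun i => by
    unfold seriesTerm
    fun_prop
  have hval : ∀ i, ∫ a, seriesTerm L A θ a i * (((L n).eval (Real.sin a) : ℝ) : ℂ)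
      ∂angleMeasure γ = A i.1 (freq i) * Complex.exp (Complex.I * freq i * θ) *
        ((∫ a, (L i.1).eval (Real.sin a) * (L n).eval (Real.sin a) ∂angleMeasure γ : ℝ) : ℂ) := by
    intro i
    rw [← integral_complex_ofReal, ← integral_const_mul]
    congr 1 with a
    rw [seriesTerm]
    push_cast
    ring
  have hb : ∀ i a, ‖seriesTerm L A θ a i * (((L n).eval (Real.sin a) : ℝ) : ℂ)‖ ≤
      ‖A i.1 (freq i)‖ * S i.1 * S n := by
    intro i a
    rw [norm_mul, Complex.norm_real, Real.norm_eq_abs]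
    exact mul_le_mul (norm_seriesTerm_le hS θ a i)
      (hS _ _ ⟨Real.neg_one_le_sin a, Real.sin_le_one a⟩) (abs_nonneg _)
      (mul_nonneg (norm_nonneg _) (hs0 _))
  have hsn : Summable fun i => ∫ a, ‖seriesTerm L A θ a i * (((L n).eval (Real.sin a) : ℝ) : ℂ)‖
      ∂angleMeasure γ := by
    refine Summable.of_nonneg_of_le (fun i => integral_nonneg fun _ => norm_nonneg _)
      (fun i => ?_) ((hu.mul_right (S n)).mul_left ((angleMeasure γ).real univ))
    refine (integral_mono (Continuous.integrable_angleMeasure (hc i).norm)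
      (integrable_const _) (hb i)).trans_eq ?_
    rw [integral_const, smul_eq_mul]
  simp_rw [← tsum_mul_right]
  rw [← integral_tsum_of_summable_integral_norm
    (fun i => Continuous.integrable_angleMeasure (hc i)) hsn]
  have hsum : Summable fun i => ∫ a, seriesTerm L A θ a i * (((L n).eval (Real.sin a) : ℝ) : ℂ)
      ∂angleMeasure γ :=
    Summable.of_norm_bounded hsn fun i => norm_integral_le_integral_norm _
  rw [hsum.tsum_sigma, tsum_eq_single n, tsum_fintype, Finset.sum_mul]
  · refine Finset.sum_congr rfl fun k _ => ?_
    rw [hval]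
    simp only [sq]
  · intro m hm
    refine (tsum_congr fun k => ?_).trans tsum_zero
    rw [hval, hL.integral_mul_eq_zero_of_ne hm, Complex.ofReal_zero, mul_zero]

lemma IsMonicOrtho.angleMoment_add_pi (hL : IsMonicOrtho γ L)
    (hpar : ∀ θ, ∀ α ∈ Icc (-(π / 2)) (π / 2), H (θ + π, -α) = H (θ, α)) (n : ℕ) (θ : ℝ) :
    angleMoment γ L H n (θ + π) = (-1) ^ n * angleMoment γ L H n θ := by
  rw [angleMoment, ← integral_angleMeasure_neg, angleMoment, ← integral_const_mul]
  refine integral_congr_ae ?_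
  filter_upwards [angleMeasure_ae γ] with a ha
  rw [hpar θ a (Ioo_subset_Icc_self ha), Real.sin_neg, hL.eval_neg]
  push_cast
  ring

lemma IsSmoothSymmetric.continuous_angleMoment (hH : IsSmoothSymmetric H) (n : ℕ) :
    Continuous (angleMoment γ L H n) := by
  obtain ⟨M, hM⟩ := exists_bound_of_periodic hH.contDiff.continuous hH.periodic_fst
    hH.periodic_snd
  exact _root_.continuous_angleMoment hH.contDiff.continuous hM n

lemma IsMonicOrtho.periodCoeff_angleMoment_of_odd (hL : IsMonicOrtho γ L)
    (hH : IsSmoothSymmetric H)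
    (hpar : ∀ θ, ∀ α ∈ Icc (-(π / 2)) (π / 2), H (θ + π, -α) = H (θ, α)) (n : ℕ) (l : ℤ) :
    periodCoeff (angleMoment γ L H n) (n + 2 * l + 1) = 0 := by
  have h := periodCoeff_comp_add (hH.periodic_angleMoment (γ := γ) (L := L) n) (n + 2 * l + 1) π
  simp_rw [hL.angleMoment_add_pi hpar] at h
  have h1 : Complex.exp (Complex.I * ((n + 2 * l + 1 : ℤ) : ℂ) * π) = -(-1) ^ n := by
    have : Complex.I * ((n + 2 * l + 1 : ℤ) : ℂ) * π =
        n * (π * Complex.I) + l * (2 * π * Complex.I) + π * Complex.I := by push_cast; ring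
    rw [this, Complex.exp_add, Complex.exp_add, Complex.exp_int_mul_two_pi_mul_I,
      Complex.exp_nat_mul, Complex.exp_pi_mul_I]
    ring
  have h2 : periodCoeff (fun t => (-1) ^ n * angleMoment γ L H n t) (n + 2 * l + 1) =
      (-1) ^ n * periodCoeff (angleMoment γ L H n) (n + 2 * l + 1) := by
    rw [periodCoeff, periodCoeff, ← intervalIntegral.integral_const_mul]
    congr 1 with t
    ring
  rw [h1, h2] at h
  have h3 : (-1 : ℂ) ^ n ≠ 0 := pow_ne_zero _ (by norm_num)
  have h4 : (-1 : ℂ) ^ n * (2 * periodCoeff (angleMoment γ L H n) (n + 2 * l + 1)) = 0 := by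
    linear_combination h
  simpa [h3] using h4

lemma periodCoeff_exp (j m : ℤ) :
    periodCoeff (fun θ : ℝ => Complex.exp (Complex.I * j * θ)) m =
      if j = m then (2 * π : ℂ) else 0 := by
  have h := integral_exp_int_mul (j - m)
  simp only [sub_eq_zero] at h
  rw [show (if j = m then (2 * π : ℂ) else 0) = ((if j = m then 2 * π else 0 : ℝ) : ℂ) by
    split_ifs <;> simp, ← h, periodCoeff]
  congr 1 with t
  rw [← Complex.exp_add]
  congr 1
  push_cast
  ring

lemma IsMonicOrtho.angleMoment_eq_sum (hL : IsMonicOrtho γ L)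
    (hH : IsSmoothSymmetric H)
    (hpar : ∀ θ, ∀ α ∈ Icc (-(π / 2)) (π / 2), H (θ + π, -α) = H (θ, α)) {n : ℕ}
    (h0 : ∀ k : ℤ, (k < 0 ∨ (n : ℤ) < k) → periodCoeff (angleMoment γ L H n) (n - 2 * k) = 0)
    (θ : ℝ) :
    angleMoment γ L H n θ = (∑ k : Fin (n + 1), expansionCoeff γ L H n (freq ⟨n, k⟩) *
      Complex.exp (Complex.I * freq ⟨n, k⟩ * θ)) *
        ((∫ a, (L n).eval (Real.sin a) ^ 2 ∂angleMeasure γ : ℝ) : ℂ) := by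
  set N := ((∫ a, (L n).eval (Real.sin a) ^ 2 ∂angleMeasure γ : ℝ) : ℂ) with hN
  have hN0 : N ≠ 0 := by
    rw [hN]
    exact_mod_cast (hL.integral_sq_pos n).ne'
  have hpi : (π : ℂ) ≠ 0 := by exact_mod_cast Real.pi_ne_zero
  set E : ℝ → ℂ := fun θ => (∑ k : Fin (n + 1), expansionCoeff γ L H n (freq ⟨n, k⟩) *
      Complex.exp (Complex.I * freq ⟨n, k⟩ * θ)) * N with hE
  have hEc : Continuous E := by fun_prop
  have hEp : Function.Periodic E (2 * π) := by
    intro t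
    simp only [hE]
    congr 1
    refine Finset.sum_congr rfl fun k _ => ?_
    have := exp_neg_I_mul_periodic (-freq ⟨n, k⟩) t
    simp only [Int.cast_neg, mul_neg, neg_mul, neg_neg] at this
    rw [this]
  have hGc : Continuous (angleMoment γ L H n) := hH.continuous_angleMoment n
  have hGp : Function.Periodic (angleMoment γ L H n) (2 * π) := hH.periodic_angleMoment n
  have hEm : ∀ m, periodCoeff E m = ∑ k : Fin (n + 1), expansionCoeff γ L H n (freq ⟨n, k⟩) * N *
      (if freq ⟨n, k⟩ = m then (2 * π : ℂ) else 0) := by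
    intro m
    have h1 : ∀ t : ℝ, Complex.exp (-(Complex.I * m * t)) * E t =
        ∑ k : Fin (n + 1), expansionCoeff γ L H n (freq ⟨n, k⟩) * N *
          (Complex.exp (-(Complex.I * m * t)) * Complex.exp (Complex.I * freq ⟨n, k⟩ * t)) := by
      intro t
      rw [hE]
      simp only [Finset.sum_mul, Finset.mul_sum]
      refine Finset.sum_congr rfl fun k _ => ?_
      ring
    rw [periodCoeff]
    simp_rw [h1]
    rw [intervalIntegral.integral_finsetSum fun k _ =>
      Continuous.intervalIntegrable (by fun_prop) _ _]
    refine Finset.sum_congr rfl fun k _ => ?_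
    rw [intervalIntegral.integral_const_mul]
    congr 1
    exact periodCoeff_exp _ _
  have hEG : ∀ m, periodCoeff E m = periodCoeff (angleMoment γ L H n) m := by
    intro m
    rw [hEm]
    by_cases hm : ∃ k : Fin (n + 1), freq ⟨n, k⟩ = m
    · obtain ⟨k, rfl⟩ := hm
      rw [Finset.sum_eq_single k]
      · rw [if_pos rfl, expansionCoeff, ← hN]
        field_simp
      · intro j _ hj
        rw [if_neg, mul_zero]
        simp only [freq]
        intro h
        exact hj (Fin.ext (by omega))
      · simp
    · rw [Finset.sum_eq_zero fun k _ => by rw [if_neg fun h => hm ⟨k, h⟩, mul_zero]]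
      rcases Int.even_or_odd' (m - n) with ⟨l, hl | hl⟩
      · rw [show m = n - 2 * (-l) by omega, h0]
        by_contra! hcon
        refine hm ⟨⟨(-l).toNat, by omega⟩, ?_⟩
        simp only [freq]
        omega
      · rw [show m = n + 2 * l + 1 by omega, hL.periodCoeff_angleMoment_of_odd hH hpar]
  have hz := eq_zero_of_periodCoeff_eq_zero (G := fun t => angleMoment γ L H n t - E t)
    (hGc.sub hEc) (fun t => by simp only [hGp t, hEp t]) (fun m => by
      have h1 : periodCoeff (fun t => angleMoment γ L H n t - E t) m =
          periodCoeff (angleMoment γ L H n) m - periodCoeff E m := by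
        simp only [periodCoeff, mul_sub]
        exact intervalIntegral.integral_sub (Continuous.intervalIntegrable (by fun_prop) _ _)
          (Continuous.intervalIntegrable (by fun_prop) _ _)
      rw [h1, hEG, sub_self]) θ
  exact sub_eq_zero.1 hz

/-- A function satisfying the moment conditions is the chord integral of a smooth function. -/
lemma IsMonicOrtho.exists_smooth_chord_integral_eq (hL : IsMonicOrtho γ L)
    (hH : IsSmoothSymmetric H)
    (hpar : ∀ θ, ∀ α ∈ Icc (-(π / 2)) (π / 2), H (θ + π, -α) = H (θ, α))
    (h0 : ∀ (n : ℕ) (k : ℤ), (k < 0 ∨ (n : ℤ) < k) →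
      periodCoeff (angleMoment γ L H n) (n - 2 * k) = 0) :
    ∃ f : ℂ → ℂ, CinfDisk f ∧ ∀ θ, ∀ α ∈ Ioo (-(π / 2)) (π / 2),
      ∫ v, f (chordPoint θ α v) ∂chordMeasure γ = H (θ, α) := by
  obtain ⟨S, hS, hA⟩ := hL.exists_norm_expansionCoeff_le hH
  obtain ⟨f, hf, hfS⟩ := exists_smooth_chord_integral_eq_tsum hL hS hA
  refine ⟨f, hf, fun θ α hα => ?_⟩
  rw [hfS]
  have hHc := hH.contDiff.continuous
  have hsc := continuous_tsum_seriesTerm hS hA θ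
  refine (sub_eq_zero.1 (hL.eq_zero_of_moment_eq_zero (g := fun α => H (θ, α) -
    ∑' i, seriesTerm L (expansionCoeff γ L H) θ α i) (by fun_prop) (fun n => ?_) α hα)).symm
  simp only [sub_mul]
  rw [integral_sub (Continuous.integrable_angleMeasure (by fun_prop))
    (Continuous.integrable_angleMeasure (by fun_prop)), hL.integral_tsum_seriesTerm hS hA,
    ← hL.angleMoment_eq_sum hH hpar (h0 n), angleMoment, sub_self]

end

noncomputable section

lemma chord_eq_chordPoint (β α v : ℝ) :
    chord β α (Real.cos α * v + Real.cos α) = chordPoint (β + α) α v := by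
  have h1 : Complex.exp ((β : ℂ) * Complex.I) = Real.cos β + Real.sin β * Complex.I := by
    rw [Complex.exp_mul_I, Complex.ofReal_cos, Complex.ofReal_sin]
  have h2 : Complex.exp (((β + π + α : ℝ) : ℂ) * Complex.I) =
      -(Real.cos (β + α) + Real.sin (β + α) * Complex.I) := by
    rw [Complex.exp_mul_I, ← Complex.ofReal_cos, ← Complex.ofReal_sin,
      show β + π + α = β + α + π by ring, Real.cos_add_pi, Real.sin_add_pi]
    push_cast
    ring
  have h3 : Real.cos β = Real.cos (β + α) * Real.cos α + Real.sin (β + α) * Real.sin α := by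
    rw [← Real.cos_sub, add_sub_cancel_right]
  have h4 : Real.sin β = Real.sin (β + α) * Real.cos α - Real.cos (β + α) * Real.sin α := by
    rw [← Real.sin_sub, add_sub_cancel_right]
  rw [chord, h1, h2, h3, h4, chordPoint]
  push_cast
  ring

lemma XRT_eq_integral_chordMeasure (γ : ℝ) (f : ℂ → ℂ) (β : ℝ) {α : ℝ}
    (hα : α ∈ Ioo (-(π / 2)) (π / 2)) :
    XRT (fun w => (((1 - ‖w‖ ^ 2) ^ γ : ℝ) : ℂ) * f w) β α =
      ((Real.cos α ^ (2 * γ + 1) : ℝ) : ℂ) *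
        ∫ v, f (chordPoint (β + α) α v) ∂chordMeasure γ := by
  have hc := Real.cos_pos_of_mem_Ioo hα
  have h := intervalIntegral.smul_integral_comp_mul_add (a := -1) (b := 1)
    (fun t => (((1 - ‖chord β α t‖ ^ 2) ^ γ : ℝ) : ℂ) * f (chord β α t))
    (Real.cos α) (Real.cos α)
  rw [show Real.cos α * -1 + Real.cos α = 0 by ring,
    show Real.cos α * 1 + Real.cos α = 2 * Real.cos α by ring] at h
  rw [XRT, ← h, integral_chordMeasure, intervalIntegral.integral_of_le (by norm_num),
    integral_Ioc_eq_integral_Ioo, Complex.real_smul, ← integral_const_mul, ← integral_const_mul]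
  refine setIntegral_congr_fun measurableSet_Ioo fun v hv => ?_
  have hv' := one_sub_sq_pos hv
  simp only [chord_eq_chordPoint, norm_chordPoint_sq, sub_sub_cancel, Complex.real_smul]
  rw [Real.mul_rpow (by positivity) hv'.le, ← Real.rpow_natCast, ← Real.rpow_mul hc.le,
    Real.rpow_add hc, Real.rpow_one]
  push_cast
  ring

lemma Continuous.integrable_of_ae_mem_compact {X E : Type*} [TopologicalSpace X] [T2Space X]
    [MeasurableSpace X] [OpensMeasurableSpace X] [SecondCountableTopology X]
    [NormedAddCommGroup E]
    {μ : Measure X} [IsFiniteMeasureOnCompacts μ] {s : Set X} (hs : IsCompact s)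
    (h : ∀ᵐ x ∂μ, x ∈ s) {f : X → E} (hf : Continuous f) : Integrable f μ := by
  have h1 := hf.continuousOn.integrableOn_compact' (μ := μ) hs hs.measurableSet
  rwa [IntegrableOn, Measure.restrict_eq_self_of_ae_mem h] at h1

lemma Continuous.integrable_prod_angleMeasure {γ : ℝ} [Fact (-1 < γ)] {f : ℝ × ℝ → ℂ}
    (hf : Continuous f) (a b : ℝ) :
    Integrable f ((volume.restrict (Ioc a b)).prod (angleMeasure γ)) := by
  refine Continuous.integrable_of_ae_mem_compact
    ((isCompact_Icc (a := a) (b := b)).prod (isCompact_Icc (a := -(π / 2)) (b := π / 2))) ?_ hf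
  filter_upwards [Measure.quasiMeasurePreserving_fst.ae (ae_restrict_mem measurableSet_Ioc),
    Measure.quasiMeasurePreserving_snd.ae (angleMeasure_ae γ)] with p h1 h2
  exact ⟨Ioc_subset_Icc_self h1, Ioo_subset_Icc_self h2⟩

lemma integral_bdryMeasure (γ : ℝ) (g : ℝ × ℝ → ℂ) :
    ∫ p, ((Real.cos p.2 ^ (2 * γ + 1) : ℝ) : ℂ) * ((Real.cos p.2 ^ (2 * γ + 1) : ℝ) : ℂ) * g p
        ∂bdryMeasure γ =
      ∫ p, g p ∂(volume.restrict (Ioc 0 (2 * π))).prod (angleMeasure γ) := by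
  have hm : ∀ e : ℝ, Measurable fun p : ℝ × ℝ => ENNReal.ofReal (Real.cos p.2 ^ e) := fun e =>
    ((measurable_cos_rpow e).comp measurable_snd).ennreal_ofReal
  have hR : (volume : Measure (ℝ × ℝ)).restrict Rect =
      (volume.restrict (Ioc 0 (2 * π))).prod (volume.restrict (Ioo (-(π / 2)) (π / 2))) := by
    rw [Rect, Measure.volume_eq_prod, ← Measure.prod_restrict,
      Measure.restrict_congr_set Ioo_ae_eq_Icc]
  rw [bdryMeasure, angleMeasure, prod_withDensity_right
    ((measurable_cos_rpow (2 * γ + 2)).ennreal_ofReal), hR,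
    integral_withDensity_eq_integral_toReal_smul (hm _) (by simp),
    integral_withDensity_eq_integral_toReal_smul (hm _) (by simp)]
  refine integral_congr_ae ?_
  filter_upwards [Measure.quasiMeasurePreserving_snd.ae (ae_restrict_mem measurableSet_Ioo)]
    with p hp
  have hc := Real.cos_pos_of_mem_Ioo hp
  have hpow : Real.cos p.2 ^ (2 * γ + 2) = Real.cos p.2 ^ (-(2 * γ)) *
      (Real.cos p.2 ^ (2 * γ + 1) * Real.cos p.2 ^ (2 * γ + 1)) := by
    rw [← Real.rpow_add hc, ← Real.rpow_add hc]
    congr 1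
    ring
  rw [ENNReal.toReal_ofReal (Real.rpow_nonneg hc.le _),
    ENNReal.toReal_ofReal (Real.rpow_nonneg hc.le _), Complex.real_smul, Complex.real_smul, hpow]
  push_cast
  ring

lemma integral_mul_conj_psiF {γ : ℝ} [Fact (-1 < γ)] (L : ℕ → Polynomial ℝ) {F h : ℝ × ℝ → ℂ}
    (hF : Continuous F) (hFp : ∀ p : ℝ × ℝ, F (p.1 + 2 * π, p.2) = F p)
    (hh : ∀ p : ℝ × ℝ, p.2 ∈ Icc (-(π / 2)) (π / 2) → h p = F p) (n : ℕ) (k : ℤ) :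
    ∫ p, muC (2 * γ + 1) p * h p * (starRingEnd ℂ) (psiF γ L n k p) ∂bdryMeasure γ =
      (((-1 : ℝ) ^ n / (2 * π) : ℝ) : ℂ) *
        periodCoeff (angleMoment γ L (fun q => F (q.1 - q.2, q.2)) n) (n - 2 * k) := by
  set m : ℤ := n - 2 * k with hm
  have h1 : ∀ p : ℝ × ℝ, muC (2 * γ + 1) p * h p * (starRingEnd ℂ) (psiF γ L n k p) =
      ((Real.cos p.2 ^ (2 * γ + 1) : ℝ) : ℂ) * ((Real.cos p.2 ^ (2 * γ + 1) : ℝ) : ℂ) *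
        ((((-1 : ℝ) ^ n / (2 * π) : ℝ) : ℂ) * (Complex.exp (-(Complex.I * m * (p.1 + p.2 : ℝ))) *
          (h p * (((L n).eval (Real.sin p.2) : ℝ) : ℂ)))) := by
    intro p
    have he : (starRingEnd ℂ) (Complex.exp
        (Complex.I * ((n : ℂ) - 2 * (k : ℂ)) * ((p.1 + p.2 : ℝ) : ℂ))) =
        Complex.exp (-(Complex.I * m * (p.1 + p.2 : ℝ))) := by
      have h2 : (starRingEnd ℂ) 2 = 2 := map_ofNat _ 2
      rw [← Complex.exp_conj]
      simp [hm, h2]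
    rw [psiF, map_mul, map_mul, map_mul, he, muC]
    simp only [Complex.conj_ofReal]
    ring
  simp_rw [h1]
  rw [integral_bdryMeasure, integral_const_mul]
  congr 1
  have h2 : ∫ p, Complex.exp (-(Complex.I * m * (p.1 + p.2 : ℝ))) *
      (h p * (((L n).eval (Real.sin p.2) : ℝ) : ℂ))
        ∂(volume.restrict (Ioc 0 (2 * π))).prod (angleMeasure γ) =
      ∫ p, Complex.exp (-(Complex.I * m * (p.1 + p.2 : ℝ))) *
        (F p * (((L n).eval (Real.sin p.2) : ℝ) : ℂ))
          ∂(volume.restrict (Ioc 0 (2 * π))).prod (angleMeasure γ) := by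
    refine integral_congr_ae ?_
    filter_upwards [Measure.quasiMeasurePreserving_snd.ae (angleMeasure_ae γ)] with p hp
    rw [hh p (Ioo_subset_Icc_self hp)]
  rw [h2, integral_prod_symm _ (Continuous.integrable_prod_angleMeasure (by fun_prop) _ _)]
  have h3 : ∀ α : ℝ, ∫ β in Ioc 0 (2 * π), Complex.exp (-(Complex.I * m * (β + α : ℝ))) *
        (F (β, α) * (((L n).eval (Real.sin α) : ℝ) : ℂ)) =
      ∫ θ in Ioc 0 (2 * π), Complex.exp (-(Complex.I * m * θ)) *
        (F (θ - α, α) * (((L n).eval (Real.sin α) : ℝ) : ℂ)) := by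
    intro α
    have hp : Function.Periodic (fun θ : ℝ => Complex.exp (-(Complex.I * m * θ)) *
        (F (θ - α, α) * (((L n).eval (Real.sin α) : ℝ) : ℂ))) (2 * π) := by
      intro t
      have e1 := exp_neg_I_mul_periodic m t
      have e2 := hFp (t - α, α)
      simp only at e1 e2
      simp only [e1, show t + 2 * π - α = t - α + 2 * π by ring, e2]
    rw [← intervalIntegral.integral_of_le Real.two_pi_pos.le,
      ← intervalIntegral.integral_of_le Real.two_pi_pos.le]
    have h4 := intervalIntegral.integral_comp_add_right (a := 0) (b := 2 * π)
      (fun θ : ℝ => Complex.exp (-(Complex.I * m * θ)) *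
        (F (θ - α, α) * (((L n).eval (Real.sin α) : ℝ) : ℂ))) α
    simp only [add_sub_cancel_right] at h4
    rw [h4, zero_add, add_comm (2 * π), hp.intervalIntegral_add_eq α 0, zero_add]
  simp_rw [h3]
  rw [← integral_prod_symm (fun p : ℝ × ℝ => Complex.exp (-(Complex.I * m * p.1)) *
        (F (p.1 - p.2, p.2) * (((L n).eval (Real.sin p.2) : ℝ) : ℂ)))
    (Continuous.integrable_prod_angleMeasure (by fun_prop) _ _),
    integral_prod _ (Continuous.integrable_prod_angleMeasure (by fun_prop) _ _), periodCoeff,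
    intervalIntegral.integral_of_le Real.two_pi_pos.le]
  simp only [angleMoment, integral_const_mul]

lemma periodCoeff_eval_re_eq_zero {P : Polynomial ℝ} {m : ℤ} (hm : P.natDegree < m.natAbs)
    (y : ℂ) :
    periodCoeff (fun θ : ℝ => ((P.eval (Circle.exp θ * y).re : ℝ) : ℂ)) m = 0 := by
  have h1 : ∀ θ : ℝ, Complex.exp (-(Complex.I * m * θ)) *
      ((P.eval ((Circle.exp θ : ℂ) * y).re : ℝ) : ℂ) =
      ∑ j ∈ Finset.range (P.natDegree + 1), ∑ i ∈ Finset.range (j + 1),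
        (P.coeff j * (1 / 2) ^ j * (y ^ i * (starRingEnd ℂ) y ^ (j - i) * (j.choose i))) *
          Complex.exp (Complex.I * ((2 * i - j - m : ℤ) : ℂ) * θ) := by
    intro θ
    rw [Polynomial.eval_eq_sum_range, Complex.ofReal_sum, Finset.mul_sum]
    refine Finset.sum_congr rfl fun j _ => ?_
    rw [Complex.ofReal_mul, Complex.ofReal_pow, Complex.re_eq_add_conj, div_pow, add_pow,
      Finset.sum_div, Finset.mul_sum, Finset.mul_sum]
    refine Finset.sum_congr rfl fun i hi => ?_
    have hij : i ≤ j := Nat.lt_succ_iff.1 (Finset.mem_range.1 hi)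
    have h2 : Complex.exp (Complex.I * ((2 * i - j - m : ℤ) : ℂ) * θ) =
        Complex.exp (-(Complex.I * m * θ)) * Complex.exp (θ * Complex.I) ^ i *
          Complex.exp (-(θ * Complex.I)) ^ (j - i) := by
      rw [← Complex.exp_nat_mul, ← Complex.exp_nat_mul, ← Complex.exp_add, ← Complex.exp_add]
      congr 1
      push_cast [Nat.cast_sub hij]
      ring
    have h3 : (starRingEnd ℂ) (Complex.exp (θ * Complex.I)) =
        Complex.exp (-(θ * Complex.I)) := by
      rw [← Complex.exp_conj]
      simp
    rw [h2, map_mul, Circle.coe_exp, h3, mul_pow, mul_pow, one_div, inv_pow]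
    field_simp
  rw [periodCoeff]
  simp_rw [h1]
  rw [intervalIntegral.integral_finsetSum fun j _ =>
    Continuous.intervalIntegrable (by fun_prop) _ _]
  refine Finset.sum_eq_zero fun j hj => ?_
  rw [intervalIntegral.integral_finsetSum fun i _ =>
    Continuous.intervalIntegrable (by fun_prop) _ _]
  refine Finset.sum_eq_zero fun i hi => ?_
  rw [Finset.mem_range] at hi hj
  rw [intervalIntegral.integral_const_mul, integral_exp_int_mul, if_neg (by omega)]
  simp

lemma chordPoint_eq_rotation (θ α v : ℝ) :
    chordPoint θ α v =
      -Complex.I * (starRingEnd ℂ) ((Circle.exp (-θ) : ℂ) * diskParam (α, v)) := by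
  have h : (Circle.exp (-θ) : ℂ) = Real.cos θ - Real.sin θ * Complex.I := by
    rw [Circle.coe_exp, Complex.exp_mul_I, ← Complex.ofReal_cos, ← Complex.ofReal_sin,
      Real.cos_neg, Real.sin_neg]
    push_cast
    ring
  rw [h]
  apply Complex.ext <;> simp [chordPoint, diskParam, -Complex.ofReal_cos, -Complex.ofReal_sin] <;> ring

lemma integral_chordPoint_mul_eval {γ : ℝ} [Fact (-1 < γ)] {f : ℂ → ℂ} (hf : Continuous f)
    (P : Polynomial ℝ) (θ : ℝ) :
    ∫ a, (∫ v, f (chordPoint θ a v) ∂chordMeasure γ) * ((P.eval (Real.sin a) : ℝ) : ℂ)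
        ∂angleMeasure γ =
      ∫ p, f (-Complex.I * (starRingEnd ℂ) (diskParam p)) *
        ((P.eval ((Circle.exp θ : ℂ) * diskParam p).re : ℝ) : ℂ)
          ∂(angleMeasure γ).prod (chordMeasure γ) := by
  rw [← integral_diskParam_rotation γ (fun y => f (-Complex.I * (starRingEnd ℂ) y) *
    ((P.eval ((Circle.exp θ : ℂ) * y).re : ℝ) : ℂ)) (Circle.exp (-θ))]
  have h : ∀ p : ℝ × ℝ, ((Circle.exp θ : ℂ) * ((Circle.exp (-θ) : ℂ) * diskParam p)).re =
      Real.sin p.1 := by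
    intro p
    rw [← mul_assoc, ← Circle.coe_mul, ← Circle.exp_add, add_neg_cancel, Circle.exp_zero,
      Circle.coe_one, one_mul, diskParam]
  simp_rw [h]
  have h' : ∀ p : ℝ × ℝ, f (-Complex.I * (starRingEnd ℂ) ((Circle.exp (-θ) : ℂ) * diskParam p)) =
      f (chordPoint θ p.1 p.2) := fun p => by rw [chordPoint_eq_rotation]
  simp_rw [h']
  rw [integral_prod _ (Continuous.integrable_angle_chord (by fun_prop))]
  simp_rw [integral_mul_const]

lemma periodCoeff_angleMoment_chord_integral_eq_zero {γ : ℝ} [Fact (-1 < γ)]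
    {L : ℕ → Polynomial ℝ} {H : ℝ × ℝ → ℂ} {f : ℂ → ℂ} (hf : ContinuousOn f (closedBall 0 1))
    (hH : ∀ θ, ∀ α ∈ Ioo (-(π / 2)) (π / 2),
      H (θ, α) = ∫ v, f (chordPoint θ α v) ∂chordMeasure γ) {n : ℕ} {m : ℤ}
    (hm : (L n).natDegree < m.natAbs) :
    periodCoeff (angleMoment γ L H n) m = 0 := by
  set r : ℂ → ℂ := fun z => (((max 1 ‖z‖)⁻¹ : ℝ) : ℂ) * z with hr
  have hrc : Continuous r := by
    have : Continuous fun z : ℂ => (max 1 ‖z‖)⁻¹ :=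
      Continuous.inv₀ (by fun_prop) fun z => (lt_max_of_lt_left one_pos).ne'
    fun_prop
  have hrm : ∀ z, r z ∈ closedBall (0 : ℂ) 1 := by
    intro z
    have : 0 < max 1 ‖z‖ := lt_max_of_lt_left one_pos
    rw [mem_closedBall_zero_iff, hr, norm_mul, Complex.norm_real, Real.norm_eq_abs,
      abs_of_pos (inv_pos.2 this), inv_mul_le_one₀ this]
    exact le_max_right _ _
  have hre : ∀ z ∈ closedBall (0 : ℂ) 1, r z = z := by
    intro z hz
    rw [mem_closedBall_zero_iff] at hz
    simp [hr, max_eq_left hz]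
  have hfc : Continuous fun z => f (r z) := hf.comp_continuous hrc hrm
  have hA : ∀ θ, angleMoment γ L H n θ =
      ∫ p, f (r (-Complex.I * (starRingEnd ℂ) (diskParam p))) *
        (((L n).eval ((Circle.exp θ : ℂ) * diskParam p).re : ℝ) : ℂ)
          ∂(angleMeasure γ).prod (chordMeasure γ) := by
    intro θ
    rw [← integral_chordPoint_mul_eval hfc, angleMoment]
    refine integral_congr_ae ?_
    filter_upwards [angleMeasure_ae γ] with a ha
    rw [hH θ a ha]
    congr 1
    refine integral_congr_ae ?_
    filter_upwards [chordMeasure_ae γ] with v hv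
    rw [hre _ (chordPoint_mem_closedBall θ a (Ioo_subset_Icc_self hv))]
  have hcd := continuous_diskParam
  rw [periodCoeff]
  simp_rw [hA, ← integral_const_mul]
  rw [intervalIntegral.integral_of_le Real.two_pi_pos.le, integral_integral_swap]
  · refine (integral_congr_ae (Filter.Eventually.of_forall fun p => ?_)).trans
      (integral_zero _ _)
    have h := periodCoeff_eval_re_eq_zero hm (diskParam p)
    rw [periodCoeff, intervalIntegral.integral_of_le Real.two_pi_pos.le] at h
    simp_rw [mul_left_comm (Complex.exp _)]
    rw [integral_const_mul, h, mul_zero]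
  · refine Continuous.integrable_of_ae_mem_compact
      ((isCompact_Icc (a := 0) (b := 2 * π)).prod
        ((isCompact_Icc (a := -(π / 2)) (b := π / 2)).prod
          (isCompact_Icc (a := (-1 : ℝ)) (b := 1)))) ?_ ?_
    · filter_upwards [Measure.quasiMeasurePreserving_fst.ae (ae_restrict_mem measurableSet_Ioc),
        Measure.quasiMeasurePreserving_snd.ae
          (Measure.quasiMeasurePreserving_fst.ae (angleMeasure_ae γ)),
        Measure.quasiMeasurePreserving_snd.ae
          (Measure.quasiMeasurePreserving_snd.ae (chordMeasure_ae γ))] with p h1 h2 h3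
      exact ⟨Ioc_subset_Icc_self h1, Ioo_subset_Icc_self h2, Ioo_subset_Icc_self h3⟩
    · have hce : Continuous fun θ : ℝ => (Circle.exp θ : ℂ) := by fun_prop
      have hfr : Continuous fun p : ℝ × ℝ × ℝ =>
          f (r (-Complex.I * (starRingEnd ℂ) (diskParam p.2))) := hfc.comp (by fun_prop)
      have hL : Continuous fun p : ℝ × ℝ × ℝ =>
          (((L n).eval ((Circle.exp p.1 : ℂ) * diskParam p.2).re : ℝ) : ℂ) :=
        Complex.continuous_ofReal.comp ((L n).continuous.comp (Complex.continuous_re.comp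
          ((hce.comp continuous_fst).mul (hcd.comp continuous_snd))))
      exact (by fun_prop : Continuous fun p : ℝ × ℝ × ℝ =>
        Complex.exp (-(Complex.I * m * p.1))).mul (hfr.mul hL)

end

noncomputable section

/-- Range characterization: a function `ψ ∈ μ^{2γ+1} C^∞_{α,+,+}(∂₊S𝔻)` is in
the range of `I₀ d^γ` acting on `C^∞(𝔻)` if and only if it is `L²(μ^{-2γ})`-orthogonal to all
`ψ_{n,k}^γ` with `n ≥ 0` and `k ∈ ℤ \ {0, …, n}`. -/
theorem range_characterization (γ : ℝ) (hγ : -1 < γ)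
    (L : ℕ → Polynomial ℝ) (hL : IsMonicOrtho γ L)
    (ψ h : ℝ × ℝ → ℂ) (hmem : MemCapp h)
    (hψ : ψ = fun p => muC (2 * γ + 1) p * h p) :
    (∃ f : ℂ → ℂ, CinfDisk f ∧
        ∀ p : ℝ × ℝ, p.2 ∈ Set.Ioo (-(π / 2)) (π / 2) →
          ψ p = XRT (fun w => (((1 - ‖w‖ ^ 2) ^ γ : ℝ) : ℂ) * f w) p.1 p.2) ↔
      (∀ (n : ℕ) (k : ℤ), (k < 0 ∨ (n : ℤ) < k) →
        (∫ p, ψ p * (starRingEnd ℂ) (psiF γ L n k p) ∂(bdryMeasure γ)) = 0) := by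
  have : Fact (-1 < γ) := ⟨hγ⟩
  obtain ⟨F, hF, hF1, hF2, hFs, hFa, hFh⟩ := hmem
  subst hψ
  have hinner := integral_mul_conj_psiF (γ := γ) L hF.continuous hF1 hFh
  simp only [hinner]
  set H : ℝ × ℝ → ℂ := fun q => F (q.1 - q.2, q.2) with hHdef
  have hcoef : ∀ n : ℕ, (((-1 : ℝ) ^ n / (2 * π) : ℝ) : ℂ) ≠ 0 := fun n => by
    exact Complex.ofReal_ne_zero.2
      (div_ne_zero (pow_ne_zero _ (by norm_num)) Real.two_pi_pos.ne')
  simp only [mul_eq_zero, hcoef, false_or]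
  have hrange : ∀ f : ℂ → ℂ, (∀ p : ℝ × ℝ, p.2 ∈ Set.Ioo (-(π / 2)) (π / 2) →
      muC (2 * γ + 1) p * h p =
        XRT (fun w => (((1 - ‖w‖ ^ 2) ^ γ : ℝ) : ℂ) * f w) p.1 p.2) ↔
      ∀ θ, ∀ α ∈ Ioo (-(π / 2)) (π / 2),
        ∫ v, f (chordPoint θ α v) ∂chordMeasure γ = H (θ, α) := by
    intro f
    have hc : ∀ α ∈ Ioo (-(π / 2)) (π / 2), ((Real.cos α ^ (2 * γ + 1) : ℝ) : ℂ) ≠ 0 :=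
      fun α hα => Complex.ofReal_ne_zero.2
        (Real.rpow_pos_of_pos (Real.cos_pos_of_mem_Ioo hα) _).ne'
    constructor
    · intro hf θ α hα
      have h1 := hf (θ - α, α) hα
      rw [XRT_eq_integral_chordMeasure γ f _ hα, muC, hFh _ (Ioo_subset_Icc_self hα)] at h1
      have h2 := mul_left_cancel₀ (hc α hα) h1
      simp only [sub_add_cancel] at h2
      exact h2.symm
    · rintro hf ⟨β, α⟩ hα
      rw [XRT_eq_integral_chordMeasure γ f _ hα, muC, hFh _ (Ioo_subset_Icc_self hα),
        hf _ _ hα]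
      simp only [hHdef, add_sub_cancel_right]
  simp only [hrange]
  constructor
  · rintro ⟨f, hf, hfH⟩ n k hk
    refine periodCoeff_angleMoment_chord_integral_eq_zero hf.continuousOn
      (fun θ α hα => (hfH θ α hα).symm) ?_
    rw [(hL n).2.1]
    omega
  · intro h0
    refine hL.exists_smooth_chord_integral_eq ⟨?_, ?_, ?_, ?_⟩ ?_ h0
    · exact hF.comp (by fun_prop)
    · intro θ α
      have := hF1 (θ - α, α)
      simp only [hHdef] at this ⊢
      rw [← this, show θ + 2 * π - α = θ - α + 2 * π by ring]
    · intro θ α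
      have h1 := hF1 (θ - (α + 2 * π), α)
      have h2 := hF2 (θ - (α + 2 * π), α)
      simp only [hHdef] at h1 h2 ⊢
      rw [h2, ← h1, show θ - (α + 2 * π) + 2 * π = θ - α by ring]
    · intro θ α
      have h1 := hFs (θ - α, α)
      have h2 := hF1 (θ - (π - α), π - α)
      simp only [hHdef, Scat] at h1 h2 ⊢
      rw [← h1, ← h2]
      congr 2
      ring
    · intro θ α hα
      have h1 := hFa (θ - α, α) hα
      simp only [hHdef, ScatA] at h1 ⊢
      rw [← h1]
      congr 2
      ring

end
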